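/- (Conjecture.) Fix an integer k and a positive integer n with n ≥ 2κ, and set λ = n/κ (so the mean μ_k(λ) equals n). If k = 2 or k = 3, then the mode, median and mean satisfy m_k(n/κ) = n − 1 and ν_k(n/κ) = μ_k(n/κ) = n. If k ≥ 4, they satisfy the strict ordering m_k(n/κ) < ν_k(n/κ) < μ_k(n/κ); and for all k ≥ 2 and all positive integers n with 1 ≤ n < 2κ one has the weak ordering m_k(n/κ) ≤ ν_k(n/κ) ≤ μ_k(n/κ). -/

import Mathlib

open scoped BigOperators

/-- The pmf of the Poisson distribution of order `k` with parameter `lam`: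
`f_k(n;λ) = e^{-kλ} Σ_{n₁+2n₂+⋯+k n_k = n} λ^{n₁+⋯+n_k}/(n₁!⋯n_k!)`. -/
noncomputable def poissonOrderKPmf (k : ℕ) (lam : ℝ) (n : ℕ) : ℝ :=
  Real.exp (-(k * lam)) *
    ∑' v : Fin k → ℕ,
      if (∑ i : Fin k, ((i : ℕ) + 1) * v i) = n then
        lam ^ (∑ i : Fin k, v i) / ((∏ i : Fin k, Nat.factorial (v i) : ℕ) : ℝ)
      else 0

/-- The median of the Poisson distribution of order `k` with parameter `lam`:
the least integer `n` such that `P(X ≤ n) ≥ 1/2`. -/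
noncomputable def poissonOrderKMedian (k : ℕ) (lam : ℝ) : ℕ :=
  sInf {n : ℕ | (1 : ℝ) / 2 ≤ ∑ j ∈ Finset.range (n + 1), poissonOrderKPmf k lam j}

namespace PoissonK

open Finset Polynomial

/-- The number of `j`-tuples in `{1, …, k}` with sum `x`. -/
def cnt (k : ℕ) : ℕ → ℤ → ℕ
  | 0, x => if x = 0 then 1 else 0
  | j + 1, x => ∑ i ∈ range k, cnt k j (x - (i + 1))

lemma cnt_succ (k j : ℕ) (x : ℤ) :
    cnt k (j + 1) x = ∑ i ∈ range k, cnt k j (x - (i + 1)) := rfl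

lemma cnt_of_lt (k : ℕ) {j : ℕ} {x : ℤ} (h : x < j) : cnt k j x = 0 := by
  induction j generalizing x with
  | zero => simp only [cnt]; rw [if_neg]; simp at h; omega
  | succ j ih =>
    rw [cnt_succ]
    refine sum_eq_zero fun i _ => ih ?_
    push_cast at h; omega

lemma cnt_symm (k j : ℕ) (x : ℤ) : cnt k j (j * (k + 1) - x) = cnt k j x := by
  induction j generalizing x with
  | zero => simp [cnt]
  | succ j ih =>
    rw [cnt_succ, cnt_succ, ← sum_range_reflect]
    refine sum_congr rfl fun i hi => ?_
    rw [← ih]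
    congr 1
    have := mem_range.1 hi
    push_cast [Nat.sub_sub, Nat.cast_sub (show 1 + i ≤ k by omega)]
    ring

lemma cnt_succ_sub (k j : ℕ) (x : ℤ) :
    cnt k (j + 1) x + cnt k j x = cnt k (j + 1) (x + 1) + cnt k j (x - k) := by
  rw [cnt_succ, cnt_succ]
  have h := sum_range_succ (fun i : ℕ => cnt k j (x - i)) k
  rw [sum_range_succ'] at h
  simp only [Nat.cast_zero, sub_zero, Nat.cast_add, Nat.cast_one] at h
  rw [h]
  congr 1
  refine sum_congr rfl fun i _ => ?_
  congr 1; ring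

lemma cnt_antitone_of_succ {k j : ℕ}
    (h : ∀ x : ℤ, (j * (k + 1) : ℤ) ≤ 2 * x + 1 → cnt k j (x + 1) ≤ cnt k j x) {x y : ℤ}
    (hxy : |2 * x - j * (k + 1)| ≤ |2 * y - j * (k + 1)|) : cnt k j y ≤ cnt k j x := by
  have mono : ∀ (n : ℕ) (x : ℤ), (j * (k + 1) : ℤ) ≤ 2 * x + 1 →
      cnt k j (x + n) ≤ cnt k j x := by
    intro n
    induction n with
    | zero => intro x _; simp
    | succ n ih =>
      intro x hx
      refine le_trans ?_ (ih x hx)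
      have := h (x + n) (by omega)
      rw [add_assoc] at this
      exact_mod_cast this
  have right : ∀ x : ℤ, ∃ x', cnt k j x' = cnt k j x ∧
      2 * x' - j * (k + 1) = |2 * x - j * (k + 1)| := by
    intro x
    rcases le_total 0 (2 * x - (j * (k + 1) : ℤ)) with hx | hx
    · exact ⟨x, rfl, by rw [abs_of_nonneg hx]⟩
    · exact ⟨j * (k + 1) - x, cnt_symm k j x, by rw [abs_of_nonpos hx]; ring⟩
  obtain ⟨x', hx, hx'⟩ := right x
  obtain ⟨y', hy, hy'⟩ := right y
  rw [← hx, ← hy]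
  have hle : x' ≤ y' := by omega
  obtain ⟨n, hn⟩ := Int.le.dest hle
  rw [← hn]
  exact mono n x' (by have := abs_nonneg (2 * x - (j * (k + 1) : ℤ)); omega)

/-- The counts are symmetric and unimodal about `j * (k + 1) / 2`. -/
lemma cnt_le_cnt (k j : ℕ) {x y : ℤ}
    (hxy : |2 * x - j * (k + 1)| ≤ |2 * y - j * (k + 1)|) : cnt k j y ≤ cnt k j x := by
  induction j generalizing x y with
  | zero =>
    simp only [cnt]
    split_ifs with h1 h2 <;> simp_all
    exact h2 (abs_nonpos_iff.1 (by omega))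
  | succ j ih =>
    refine cnt_antitone_of_succ (fun x hx => ?_) hxy
    have h1 := cnt_succ_sub k j x
    have h2 : cnt k j x ≤ cnt k j (x - k) := by
      apply ih
      push_cast at hx
      have hx' : (j * (k + 1) : ℤ) + k ≤ 2 * x := by linarith
      refine sq_le_sq.1 ?_
      nlinarith
    omega

lemma cnt_eq_coeff (k j m : ℕ) :
    cnt k j m = ((∑ i ∈ range k, (X : ℕ[X]) ^ (i + 1)) ^ j).coeff m := by
  induction j generalizing m with
  | zero => simp [cnt, coeff_one]
  | succ j ih =>
    rw [cnt_succ, pow_succ, mul_sum, finsetSum_coeff]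
    refine sum_congr rfl fun i _ => ?_
    rw [coeff_mul_X_pow']
    split_ifs with h
    · rw [← ih]; congr 1; push_cast [h]; ring
    · exact cnt_of_lt k (by omega)

/-- The pmf is a Poisson mixture of the normalized counts. -/
lemma pmf_eq (k : ℕ) (lam : ℝ) {m N : ℕ} (hN : m < N) :
    poissonOrderKPmf k lam m =
      Real.exp (-(k * lam)) * ∑ j ∈ range N, lam ^ j / j.factorial * cnt k j m := by
  rw [poissonOrderKPmf]
  congr 1
  set g : (Fin k → ℕ) → ℝ := fun v =>
    if (∑ i : Fin k, ((i : ℕ) + 1) * v i) = m then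
        lam ^ (∑ i : Fin k, v i) / ((∏ i : Fin k, Nat.factorial (v i) : ℕ) : ℝ)
      else 0 with hg
  have hsupp : ∀ v, g v ≠ 0 → ∑ i, v i ≤ m := by
    intro v hv
    simp only [hg, ne_eq, ite_eq_right_iff, not_forall] at hv
    obtain ⟨h, -⟩ := hv
    rw [← h]
    exact sum_le_sum fun i _ => by nlinarith [Nat.zero_le (i : ℕ), Nat.zero_le (v i)]
  have hdisj : ((range N : Finset ℕ) : Set ℕ).PairwiseDisjoint
      (fun j => piAntidiag (univ : Finset (Fin k)) j) := by
    intro a _ b _ hab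
    refine Finset.disjoint_left.2 fun v hv hv' => hab ?_
    rw [← (mem_piAntidiag.1 hv).1, ← (mem_piAntidiag.1 hv').1]
  rw [tsum_eq_sum (s := (range N).disjiUnion (fun j => piAntidiag univ j) hdisj)]
  · rw [sum_disjiUnion]
    refine sum_congr rfl fun j _ => ?_
    rw [cnt_eq_coeff, sum_range (n := k) (f := fun i => (X : ℕ[X]) ^ (i + 1)),
      sum_pow_eq_sum_piAntidiag, finsetSum_coeff, Nat.cast_sum, mul_sum]
    refine sum_congr rfl fun v hv => ?_
    have hv' := (mem_piAntidiag.1 hv).1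
    have hprod : (∏ i : Fin k, ((X : ℕ[X]) ^ ((i : ℕ) + 1)) ^ v i) =
        X ^ (∑ i : Fin k, ((i : ℕ) + 1) * v i) := by
      rw [← prod_pow_eq_pow_sum]
      exact prod_congr rfl fun i _ => (pow_mul _ _ _).symm
    have hmul := Nat.multinomial_spec (univ : Finset (Fin k)) v
    rw [hprod, ← Polynomial.C_eq_natCast, coeff_C_mul, coeff_X_pow]
    split_ifs with h1 h2 h2
    · rw [hv'] at hmul ⊢
      rw [← hmul]
      have : ((∏ i : Fin k, (v i).factorial : ℕ) : ℝ) ≠ 0 := by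
        exact_mod_cast prod_ne_zero_iff.2 fun i _ => Nat.factorial_ne_zero _
      have h3 : ((Nat.multinomial univ v : ℕ) : ℝ) ≠ 0 := by
        exact_mod_cast (Nat.multinomial_pos _ _).ne'
      push_cast at this ⊢
      field_simp
    · exact absurd h1.symm h2
    · exact absurd h2.symm h1
    · simp
  · intro v hv
    by_contra h
    refine hv ?_
    simp only [mem_disjiUnion, mem_range, mem_piAntidiag]
    exact ⟨∑ i, v i, lt_of_le_of_lt (hsupp v h) hN, rfl, by simp⟩

end PoissonK
namespace PoissonK

open Finset

/-- The number of `j`-tuples in `{1, …, k}` with sum at most `y`. -/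
def cum (k : ℕ) : ℕ → ℤ → ℕ
  | 0, y => if 0 ≤ y then 1 else 0
  | j + 1, y => ∑ i ∈ range k, cum k j (y - (i + 1))

lemma cum_succ (k j : ℕ) (y : ℤ) :
    cum k (j + 1) y = ∑ i ∈ range k, cum k j (y - (i + 1)) := rfl

lemma cum_add_cnt (k j : ℕ) (y : ℤ) : cum k j (y - 1) + cnt k j y = cum k j y := by
  induction j generalizing y with
  | zero => simp only [cum, cnt]; split_ifs <;> omega
  | succ j ih =>
    rw [cum_succ, cum_succ, cnt_succ, ← sum_add_distrib]
    refine sum_congr rfl fun i _ => ?_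
    rw [← ih (y - (i + 1))]
    congr 2; ring

lemma cum_of_lt (k : ℕ) {j : ℕ} {y : ℤ} (h : y < j) : cum k j y = 0 := by
  induction j generalizing y with
  | zero => simp only [cum]; rw [if_neg]; simp at h; omega
  | succ j ih =>
    rw [cum_succ]
    refine sum_eq_zero fun i _ => ih ?_
    push_cast at h; omega

lemma sum_cnt (k j m : ℕ) : ∑ i ∈ range (m + 1), cnt k j i = cum k j m := by
  induction m with
  | zero =>
    have := cum_add_cnt k j 0
    rw [cum_of_lt k (show (0 - 1 : ℤ) < j by omega), zero_add] at this
    simpa using this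
  | succ m ih => rw [sum_range_succ, ih, ← cum_add_cnt k j (m + 1 : ℕ)]; congr 2; push_cast; ring

lemma cum_mono (k j : ℕ) : Monotone (cum k j) := by
  induction j with
  | zero => intro x y h; simp only [cum]; split_ifs <;> omega
  | succ j ih =>
    intro x y h
    exact sum_le_sum fun i _ => ih (by omega)

lemma cum_add_cum (k j : ℕ) (y : ℤ) : cum k j y + cum k j (j * (k + 1) - 1 - y) = k ^ j := by
  induction j generalizing y with
  | zero =>
    simp only [cum, pow_zero, Nat.cast_zero, zero_mul]
    split_ifs <;> omega
  | succ j ih =>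
    rw [cum_succ, cum_succ,
      ← sum_range_reflect (fun i : ℕ => cum k j ((j + 1 : ℕ) * (k + 1) - 1 - y - (i + 1))),
      ← sum_add_distrib]
    rw [sum_congr rfl (g := fun _ => k ^ j), sum_const, card_range, smul_eq_mul, pow_succ,
      mul_comm]
    intro i hi
    rw [← ih (y - (i + 1))]
    congr 2
    have := mem_range.1 hi
    push_cast [Nat.sub_sub, Nat.cast_sub (show 1 + i ≤ k by omega)]
    ring

lemma cum_le_pow (k j : ℕ) (y : ℤ) : cum k j y ≤ k ^ j :=
  (Nat.le_add_right _ _).trans (cum_add_cum k j y).le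

lemma cnt_le_pow (k j : ℕ) (y : ℤ) : cnt k j y ≤ k ^ j :=
  (Nat.le_add_left _ _).trans ((cum_add_cnt k j y).le.trans (cum_le_pow k j y))

lemma two_mul_cum_le (k j : ℕ) {m : ℤ} (h : 2 * m + 1 ≤ j * (k + 1)) :
    2 * cum k j m ≤ k ^ j := by
  have := cum_mono k j (show m ≤ j * (k + 1) - 1 - m by linarith)
  have := cum_add_cum k j m
  omega

lemma cum_succ_le (k j : ℕ) (y : ℤ) : cum k (j + 1) y ≤ k * cum k j y := by
  rw [cum_succ]
  refine (sum_le_sum (g := fun _ => cum k j y) fun i _ => cum_mono k j (by omega)).trans ?_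
  simp

/-- The cumulative distribution function. -/
noncomputable def cdf (k : ℕ) (lam : ℝ) (m : ℕ) : ℝ :=
  ∑ j ∈ range (m + 1), poissonOrderKPmf k lam j

lemma cdf_eq (k : ℕ) (lam : ℝ) {m N : ℕ} (hN : m < N) :
    cdf k lam m =
      Real.exp (-(k * lam)) * ∑ j ∈ range N, lam ^ j / j.factorial * cum k j m := by
  rw [cdf, sum_congr rfl fun i hi => pmf_eq k lam ((mem_range.1 hi).trans_le hN), ← mul_sum,
    sum_comm]
  congr 1
  refine sum_congr rfl fun j _ => ?_
  rw [← mul_sum, ← sum_cnt]; push_cast; rfl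

lemma hasSum_pow_div_factorial (x : ℝ) :
    HasSum (fun j : ℕ => x ^ j / j.factorial) (Real.exp x) := by
  rw [Real.exp_eq_exp_ℝ]; exact NormedSpace.expSeries_div_hasSum_exp x

lemma hasSum_cdf (k : ℕ) (lam : ℝ) (m : ℕ) :
    HasSum (fun j : ℕ => lam ^ j / j.factorial * (2 * cum k j m - (k : ℝ) ^ j))
      (Real.exp (k * lam) * (2 * cdf k lam m - 1)) := by
  have h1 : HasSum (fun j : ℕ => lam ^ j / j.factorial * (cum k j m : ℝ))
      (∑ j ∈ range (m + 1), lam ^ j / j.factorial * (cum k j m : ℝ)) := by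
    refine hasSum_sum_of_ne_finset_zero fun j hj => ?_
    rw [cum_of_lt k (by simp at hj; omega)]; simp
  have h2 := hasSum_pow_div_factorial (k * lam)
  have h3 := (h1.mul_left 2).sub h2
  rw [cdf_eq k lam (Nat.lt_succ_self m), Real.exp_neg]
  have hne := (Real.exp_pos (k * lam)).ne'
  have e : ∀ j : ℕ, lam ^ j / j.factorial * (2 * cum k j m - (k : ℝ) ^ j) =
      2 * (lam ^ j / j.factorial * (cum k j m : ℝ)) - (k * lam) ^ j / j.factorial := by
    intro j; rw [mul_pow]; ring
  simp_rw [e]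
  rwa [mul_sub, mul_one, mul_left_comm, mul_inv_cancel_left₀ hne]

/-- Descartes' rule of signs for exponential series with a single sign change. -/
lemma hasSum_le_of_sign_change {d : ℕ → ℝ} {J : ℕ} (h1 : ∀ j ≤ J, 0 ≤ d j)
    (h2 : ∀ j, J < j → d j ≤ 0) {a b x y : ℝ} (ha : 0 < a) (hab : a ≤ b)
    (hx : HasSum (fun j : ℕ => a ^ j / j.factorial * d j) x)
    (hy : HasSum (fun j : ℕ => b ^ j / j.factorial * d j) y) : y ≤ x * (b / a) ^ J := by
  refine hasSum_le (fun j => ?_) hy (hx.mul_right ((b / a) ^ J))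
  have hb := ha.trans_le hab
  have hba : 1 ≤ b / a := (one_le_div ha).2 hab
  have e : a ^ j / (j.factorial : ℝ) * d j * (b / a) ^ J =
      (b / a) ^ J * a ^ j * (d j / j.factorial) := by ring
  have e2 : b ^ j / (j.factorial : ℝ) * d j = (b / a) ^ j * a ^ j * (d j / j.factorial) := by
    rw [div_pow]; field_simp
  rw [e, e2]
  rcases le_or_gt j J with h | h
  · have := h1 j h
    gcongr
  · refine mul_le_mul_of_nonpos_right ?_ (div_nonpos_of_nonpos_of_nonneg (h2 j h) (by positivity))
    gcongr

lemma hasSum_pos_of_sign_change {d : ℕ → ℝ} {J : ℕ} (h1 : ∀ j ≤ J, 0 ≤ d j)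
    (h2 : ∀ j, J < j → d j ≤ 0) {a b x y : ℝ} (ha : 0 < a) (hab : a ≤ b)
    (hx : HasSum (fun j : ℕ => a ^ j / j.factorial * d j) x)
    (hy : HasSum (fun j : ℕ => b ^ j / j.factorial * d j) y) :
    (0 ≤ y → 0 ≤ x) ∧ (0 < y → 0 < x) := by
  have h := hasSum_le_of_sign_change h1 h2 ha hab hx hy
  have hp : 0 < (b / a) ^ J := pow_pos (div_pos (ha.trans_le hab) ha) J
  exact ⟨fun hy => nonneg_of_mul_nonneg_left (hy.trans h) hp,
    fun hy => pos_of_mul_pos_left (hy.trans_le h) hp.le⟩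

lemma exists_sign_change (p : ℕ → Prop) {N : ℕ} (h0 : p 0) (hN : ∀ j, N ≤ j → ¬ p j)
    (h : ∀ j, p (j + 1) → p j) : ∃ J, (∀ j ≤ J, p j) ∧ ∀ j, J < j → ¬ p j := by
  classical
  have hex : ∃ j, ¬ p j := ⟨N, hN N le_rfl⟩
  have hpos : 0 < Nat.find hex := by
    rcases Nat.eq_zero_or_pos (Nat.find hex) with h' | h'
    · exact absurd h0 (h' ▸ Nat.find_spec hex)
    · exact h'
  refine ⟨Nat.find hex - 1, fun j hj => ?_, fun j hj => ?_⟩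
  · by_contra hc
    have := Nat.find_min' hex hc
    omega
  · have : ∀ n, ¬ p (Nat.find hex + n) := by
      intro n
      induction n with
      | zero => exact Nat.find_spec hex
      | succ n ih => exact fun hc => ih (h _ hc)
    have e : j = Nat.find hex + (j - Nat.find hex) := by omega
    rw [e]; exact this _

lemma cdf_sign_change {k : ℕ} (hk : 1 ≤ k) (m : ℕ) : ∃ J : ℕ,
    (∀ j ≤ J, (0 : ℝ) ≤ 2 * cum k j m - (k : ℝ) ^ j) ∧
      ∀ j, J < j → 2 * cum k j m - (k : ℝ) ^ j ≤ 0 := by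
  obtain ⟨J, h1, h2⟩ := exists_sign_change (fun j => k ^ j ≤ 2 * cum k j m) (N := m + 1)
    (by simp [cum]) (fun j hj => by
      rw [cum_of_lt k (show (m : ℤ) < j by omega)]
      have := Nat.pow_pos (n := j) hk
      omega)
    (fun j hj => by
      have := cum_succ_le k j m
      rw [pow_succ] at hj
      refine Nat.le_of_mul_le_mul_right (c := k) ?_ hk
      calc _ ≤ _ := hj
        _ ≤ 2 * (k * cum k j m) := by omega
        _ = _ := by ring)
  refine ⟨J, fun j hj => ?_, fun j hj => ?_⟩
  · have := h1 j hj; rw [sub_nonneg]; exact_mod_cast this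
  · have := (not_le.1 (h2 j hj)).le; rw [sub_nonpos]; exact_mod_cast this

/-- At a fixed integer the distribution function decreases through `1 / 2` at most once. -/
lemma half_le_cdf_of_le {k : ℕ} (hk : 1 ≤ k) {m : ℕ} {a b : ℝ} (ha : 0 < a) (hab : a ≤ b)
    (h : 1 / 2 ≤ cdf k b m) : 1 / 2 ≤ cdf k a m := by
  obtain ⟨J, h1, h2⟩ := cdf_sign_change hk m
  have := (hasSum_pos_of_sign_change h1 h2 ha hab (hasSum_cdf k a m) (hasSum_cdf k b m)).1
    (mul_nonneg (Real.exp_pos _).le (by linarith))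
  have := nonneg_of_mul_nonneg_right this (Real.exp_pos _)
  linarith

lemma cdf_lt_half_of_le {k : ℕ} (hk : 1 ≤ k) {m : ℕ} {a b : ℝ} (ha : 0 < a) (hab : a ≤ b)
    (h : cdf k a m < 1 / 2) : cdf k b m < 1 / 2 := by
  by_contra hc
  exact absurd (half_le_cdf_of_le hk ha hab (not_lt.1 hc)) (not_le.2 h)

lemma hasSum_pmf_sub (k : ℕ) (lam : ℝ) (m m' : ℕ) :
    HasSum (fun j : ℕ => lam ^ j / j.factorial * ((cnt k j m : ℝ) - cnt k j m'))
      (Real.exp (k * lam) * (poissonOrderKPmf k lam m - poissonOrderKPmf k lam m')) := by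
  rw [pmf_eq k lam (show m < m + m' + 1 by omega), pmf_eq k lam (show m' < m + m' + 1 by omega),
    ← mul_sub, ← mul_assoc, ← Real.exp_add, add_neg_cancel, Real.exp_zero, one_mul,
    ← sum_sub_distrib]
  simp_rw [← mul_sub]
  refine hasSum_sum_of_ne_finset_zero fun j hj => ?_
  rw [cnt_of_lt k (by simp at hj; omega), cnt_of_lt k (by simp at hj; omega)]; simp

lemma cnt_sign_change {k : ℕ} {m m' : ℕ} (h : m < m') : ∃ J : ℕ,
    (∀ j ≤ J, (0 : ℝ) ≤ (cnt k j m : ℝ) - cnt k j m') ∧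
      ∀ j, J < j → (cnt k j m : ℝ) - cnt k j m' ≤ 0 := by
  obtain ⟨J, h1, h2⟩ := exists_sign_change (fun j => j * (k + 1) ≤ m + m') (N := m + m' + 1)
    (by simp) (fun j hj => by nlinarith) (fun j hj => by nlinarith)
  refine ⟨J, fun j hj => ?_, fun j hj => ?_⟩
  · have := h1 j hj
    rw [sub_nonneg]
    have h3 : (j : ℤ) * (k + 1) ≤ m + m' := by exact_mod_cast this
    exact_mod_cast cnt_le_cnt k j (sq_le_sq.1 (by nlinarith))
  · have := not_le.1 (h2 j hj)
    rw [sub_nonpos]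
    have h3 : (m : ℤ) + m' < (j : ℤ) * (k + 1) := by exact_mod_cast this
    exact_mod_cast cnt_le_cnt k j (sq_le_sq.1 (by nlinarith))

lemma pmf_lt_of_le {k : ℕ} {m m' : ℕ} (hm : m < m') {a b : ℝ} (ha : 0 < a) (hab : a ≤ b)
    (h : poissonOrderKPmf k b m' < poissonOrderKPmf k b m) :
    poissonOrderKPmf k a m' < poissonOrderKPmf k a m := by
  obtain ⟨J, h1, h2⟩ := cnt_sign_change (k := k) hm
  have := (hasSum_pos_of_sign_change h1 h2 ha hab (hasSum_pmf_sub k a m m')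
    (hasSum_pmf_sub k b m m')).2 (mul_pos (Real.exp_pos _) (by linarith))
  have := pos_of_mul_pos_right this (Real.exp_pos _).le
  linarith

lemma pmf_le_of_le {k : ℕ} {m m' : ℕ} (hm : m < m') {a b : ℝ} (ha : 0 < a) (hab : a ≤ b)
    (h : poissonOrderKPmf k b m' ≤ poissonOrderKPmf k b m) :
    poissonOrderKPmf k a m' ≤ poissonOrderKPmf k a m := by
  obtain ⟨J, h1, h2⟩ := cnt_sign_change (k := k) hm
  have := (hasSum_pos_of_sign_change h1 h2 ha hab (hasSum_pmf_sub k a m m')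
    (hasSum_pmf_sub k b m m')).1 (mul_nonneg (Real.exp_pos _).le (by linarith))
  have := nonneg_of_mul_nonneg_right this (Real.exp_pos _)
  linarith

lemma lt_pmf_of_le {k : ℕ} {m m' : ℕ} (hm : m < m') {a b : ℝ} (ha : 0 < a) (hab : a ≤ b)
    (h : poissonOrderKPmf k a m < poissonOrderKPmf k a m') :
    poissonOrderKPmf k b m < poissonOrderKPmf k b m' := by
  by_contra hc
  exact absurd (pmf_le_of_le hm ha hab (not_lt.1 hc)) (not_le.2 h)

lemma median_le {k : ℕ} {lam : ℝ} {m : ℕ} (h : 1 / 2 ≤ cdf k lam m) :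
    poissonOrderKMedian k lam ≤ m :=
  Nat.sInf_le h

lemma pmf_nonneg (k : ℕ) {lam : ℝ} (h : 0 ≤ lam) (m : ℕ) : 0 ≤ poissonOrderKPmf k lam m := by
  rw [pmf_eq k lam (Nat.lt_succ_self m)]; positivity

lemma lt_median {k : ℕ} {lam : ℝ} (hlam : 0 ≤ lam) {m M : ℕ} (h : cdf k lam m < 1 / 2)
    (hM : 1 / 2 ≤ cdf k lam M) : m < poissonOrderKMedian k lam := by
  have hmem : 1 / 2 ≤ cdf k lam (poissonOrderKMedian k lam) :=
    Nat.sInf_mem (s := {n | (1 : ℝ) / 2 ≤ cdf k lam n}) ⟨M, hM⟩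
  by_contra hc
  refine absurd (hmem.trans ?_) (not_le.2 h)
  exact sum_le_sum_of_subset_of_nonneg (by simpa using not_lt.1 hc)
    fun i _ _ => pmf_nonneg k hlam i

end PoissonK
namespace PoissonK

open Finset MeasureTheory intervalIntegral

lemma hasSum_congr {f g : ℕ → ℝ} {a b : ℝ} (h : HasSum f a) (hfg : ∀ j, f j = g j)
    (hab : a = b) : HasSum g b := by
  rwa [← hab, ← funext hfg]

/-- The trigonometric polynomial `∑ exp (i j t)`, `1 ≤ j ≤ k`. -/
noncomputable def trigSum (k : ℕ) (t : ℝ) : ℂ :=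
  ∑ i ∈ range k, Complex.exp (((i + 1 : ℕ) : ℝ) * t * Complex.I)

/-- The phase `exp (i (y + 1/2) t)`. -/
noncomputable def phase (y : ℤ) (t : ℝ) : ℂ := Complex.exp (((y : ℝ) + 1 / 2 : ℝ) * t * Complex.I)

lemma phase_im (y : ℤ) (t : ℝ) : (phase y t).im = Real.sin ((y + 1 / 2) * t) := by
  rw [phase, ← Complex.ofReal_mul, Complex.exp_ofReal_mul_I_im]

lemma norm_phase (y : ℤ) (t : ℝ) : ‖phase y t‖ = 1 := by
  rw [phase, ← Complex.ofReal_mul, Complex.norm_exp_ofReal_mul_I]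

lemma trigSum_mul_phase (k : ℕ) (y : ℤ) (t : ℝ) :
    trigSum k t * phase y t = ∑ i ∈ range k, phase (y + (i + 1)) t := by
  rw [trigSum, sum_mul]
  refine sum_congr rfl fun i _ => ?_
  rw [phase, phase, ← Complex.exp_add]
  congr 1; push_cast; ring

lemma continuous_trigSum (k : ℕ) : Continuous (trigSum k) := by unfold trigSum; fun_prop

lemma continuous_phase (y : ℤ) : Continuous (phase y) := by unfold phase; fun_prop

/-- The basic oscillating function `Im (P ^ j * phase)`. -/
noncomputable def osc (k j : ℕ) (y : ℤ) (t : ℝ) : ℝ := (trigSum k t ^ j * phase y t).im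

lemma continuous_osc (k j : ℕ) (y : ℤ) : Continuous (osc k j y) :=
  Complex.continuous_im.comp (((continuous_trigSum k).pow j).mul (continuous_phase y))

lemma osc_zero (k : ℕ) (y : ℤ) (t : ℝ) : osc k 0 y t = Real.sin ((y + 1 / 2) * t) := by
  rw [osc, pow_zero, one_mul, phase_im]

lemma osc_succ (k j : ℕ) (y : ℤ) (t : ℝ) :
    osc k (j + 1) y t = ∑ i ∈ range k, osc k j (y + (i + 1)) t := by
  simp only [osc]
  rw [pow_succ, mul_assoc, trigSum_mul_phase, mul_sum, Complex.im_sum]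

lemma abs_osc_le (k j : ℕ) (y : ℤ) {t : ℝ} (ht : 0 ≤ t) :
    |osc k j y t| ≤ (k : ℝ) ^ j * (|(y : ℝ)| + 1 / 2 + j * k) * t := by
  induction j generalizing y with
  | zero =>
    rw [osc_zero]
    refine (Real.abs_sin_le_abs).trans ?_
    rw [abs_mul, abs_of_nonneg ht]
    have := abs_add_le (y : ℝ) (1 / 2)
    rw [abs_of_pos (show (0 : ℝ) < 1 / 2 by norm_num)] at this
    simp only [pow_zero, one_mul, Nat.cast_zero, zero_mul, add_zero]
    gcongr
  | succ j ih =>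
    rw [osc_succ]
    refine (abs_sum_le_sum_abs _ _).trans ?_
    have : ∀ i ∈ range k, |osc k j (y + (i + 1)) t| ≤
        (k : ℝ) ^ j * (|(y : ℝ)| + 1 / 2 + (j + 1) * k) * t := by
      intro i hi
      refine (ih _).trans ?_
      have h1 : (i : ℝ) + 1 ≤ k := by exact_mod_cast mem_range.1 hi
      have h2 : |((y + (i + 1) : ℤ) : ℝ)| ≤ |(y : ℝ)| + k := by
        push_cast
        refine (abs_add_le _ _).trans ?_
        rw [abs_of_nonneg (show (0 : ℝ) ≤ i + 1 by positivity)]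
        linarith
      refine mul_le_mul_of_nonneg_right (mul_le_mul_of_nonneg_left ?_ (by positivity)) ht
      linarith
    refine (sum_le_sum this).trans (le_of_eq ?_)
    simp; ring

lemma sin_half_pos {t : ℝ} (ht : t ∈ Set.Ioc 0 Real.pi) : 0 < Real.sin (t / 2) :=
  Real.sin_pos_of_pos_of_lt_pi (by linarith [ht.1]) (by linarith [ht.2, Real.pi_pos])

lemma le_sin_half {t : ℝ} (ht : t ∈ Set.Icc 0 Real.pi) : t / Real.pi ≤ Real.sin (t / 2) := by
  have := Real.mul_le_sin (x := t / 2) (by linarith [ht.1]) (by linarith [ht.2])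
  calc _ = 2 / Real.pi * (t / 2) := by ring
    _ ≤ _ := this

lemma abs_osc_div_le (k j : ℕ) (y : ℤ) {t : ℝ} (ht : t ∈ Set.Ioc 0 Real.pi) :
    |osc k j y t / Real.sin (t / 2)| ≤
      (k : ℝ) ^ j * (|(y : ℝ)| + 1 / 2 + j * k) * Real.pi := by
  have h := sin_half_pos ht
  rw [abs_div, abs_of_pos h, div_le_iff₀ h]
  refine (abs_osc_le k j y ht.1.le).trans ?_
  have h2 := le_sin_half ⟨ht.1.le, ht.2⟩
  rw [div_le_iff₀ Real.pi_pos] at h2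
  rw [mul_assoc _ Real.pi, mul_comm Real.pi]
  gcongr

lemma intervalIntegrable_osc_div (k j : ℕ) (y : ℤ) :
    IntervalIntegrable (fun t => osc k j y t / Real.sin (t / 2)) volume 0 Real.pi := by
  rw [intervalIntegrable_iff_integrableOn_Ioc_of_le Real.pi_pos.le]
  refine Measure.integrableOn_of_bounded (M := (k : ℝ) ^ j * (|(y : ℝ)| + 1 / 2 + j * k) * Real.pi)
    (by simp) ?_ ?_
  · refine Measurable.aestronglyMeasurable ?_
    exact ((continuous_osc k j y).measurable).div (by fun_prop)
  · exact (ae_restrict_iff' measurableSet_Ioc).2 (.of_forall fun t ht => abs_osc_div_le k j y ht)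

lemma integral_cos_int (x : ℤ) :
    ∫ t in (0 : ℝ)..Real.pi, Real.cos (x * t) = if x = 0 then Real.pi else 0 := by
  split_ifs with h
  · simp [h]
  · have hx : (x : ℝ) ≠ 0 := by exact_mod_cast h
    rw [intervalIntegral.integral_comp_mul_left (fun t => Real.cos t) hx]
    simp [Real.sin_int_mul_pi]

lemma integral_osc_zero_div (k : ℕ) (y : ℤ) :
    ∫ t in (0 : ℝ)..Real.pi, osc k 0 y t / Real.sin (t / 2) =
      Real.pi * (if 0 ≤ y then 1 else -1) := by
  have step : ∀ y : ℤ, (∫ t in (0 : ℝ)..Real.pi, osc k 0 y t / Real.sin (t / 2)) -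
      ∫ t in (0 : ℝ)..Real.pi, osc k 0 (y - 1) t / Real.sin (t / 2) =
      2 * if y = 0 then Real.pi else 0 := by
    intro y
    rw [← integral_cos_int, ← integral_sub (intervalIntegrable_osc_div k 0 y)
      (intervalIntegrable_osc_div k 0 (y - 1)), ← intervalIntegral.integral_const_mul]
    refine integral_congr_ae (.of_forall fun t ht => ?_)
    rw [Set.uIoc_of_le Real.pi_pos.le] at ht
    have h := (sin_half_pos ht).ne'
    rw [osc_zero, osc_zero, ← sub_div, div_eq_iff h]
    have e1 : ((y : ℝ) + 1 / 2) * t = y * t + t / 2 := by ring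
    have e2 : (((y - 1 : ℤ) : ℝ) + 1 / 2) * t = y * t - t / 2 := by push_cast; ring
    rw [e1, e2, Real.sin_add, Real.sin_sub]; ring
  have base : ∫ t in (0 : ℝ)..Real.pi, osc k 0 0 t / Real.sin (t / 2) = Real.pi := by
    have e : ∫ t in (0 : ℝ)..Real.pi, (1 : ℝ) = Real.pi := by simp
    refine Eq.trans ?_ e
    refine integral_congr_ae (.of_forall fun t ht => ?_)
    rw [Set.uIoc_of_le Real.pi_pos.le] at ht
    have h := (sin_half_pos ht).ne'
    rw [osc_zero, div_eq_iff h, one_mul]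
    congr 1; push_cast; ring
  have base' : ∫ t in (0 : ℝ)..Real.pi, osc k 0 (-1) t / Real.sin (t / 2) = -Real.pi := by
    have := step 0
    rw [base] at this
    simp only [zero_sub, if_true] at this
    linarith
  rcases le_or_gt 0 y with hy | hy
  · rw [if_pos hy]
    obtain ⟨n, rfl⟩ := Int.eq_ofNat_of_zero_le hy
    clear hy
    induction n with
    | zero => simpa using base
    | succ n ih =>
      have := step ((n : ℤ) + 1)
      rw [if_neg (by omega), add_sub_cancel_right, ih] at this
      push_cast; linarith
  · rw [if_neg (by omega)]
    obtain ⟨n, hn⟩ := Int.le.dest (show y ≤ -1 by omega)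
    obtain rfl : y = -1 - n := by omega
    clear hy hn
    induction n with
    | zero => simpa using base'
    | succ n ih =>
      have := step (-1 - n)
      rw [if_neg (by omega), ih, sub_sub] at this
      push_cast; linarith

lemma integral_osc_div (k j : ℕ) (y : ℤ) :
    ∫ t in (0 : ℝ)..Real.pi, osc k j y t / Real.sin (t / 2) =
      Real.pi * ((k : ℝ) ^ j - 2 * cum k j (-y - 1)) := by
  induction j generalizing y with
  | zero =>
    rw [integral_osc_zero_div]
    simp only [cum]
    split_ifs with h1 h2 h2
    · omega
    · simp
    · norm_num
    · omega
  | succ j ih =>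
    simp_rw [osc_succ, sum_div]
    rw [intervalIntegral.integral_finsetSum fun i _ => intervalIntegrable_osc_div k j _]
    simp_rw [ih]
    rw [← mul_sum, sum_sub_distrib, ← mul_sum, cum_succ]
    simp only [sum_const, card_range, nsmul_eq_mul, Nat.cast_sum]
    rw [pow_succ, mul_comm (k : ℝ)]
    congr 4 with i
    congr 2; ring

lemma integral_osc_mul (k j : ℕ) (y : ℤ) :
    ∫ t in (0 : ℝ)..Real.pi, osc k j y t * Real.sin (t / 2) =
      Real.pi / 2 * ((cnt k j (-y) : ℝ) - cnt k j (-y - 1)) := by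
  induction j generalizing y with
  | zero =>
    have : ∀ t : ℝ, osc k 0 y t * Real.sin (t / 2) =
        1 / 2 * Real.cos (y * t) - 1 / 2 * Real.cos ((y + 1 : ℤ) * t) := by
      intro t
      rw [osc_zero]
      have e1 : (y : ℝ) * t = (y + 1 / 2) * t - t / 2 := by ring
      have e2 : ((y + 1 : ℤ) : ℝ) * t = (y + 1 / 2) * t + t / 2 := by push_cast; ring
      rw [e1, e2, Real.cos_add, Real.cos_sub]; ring
    simp_rw [this]
    rw [intervalIntegral.integral_sub (by apply Continuous.intervalIntegrable; fun_prop)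
      (by apply Continuous.intervalIntegrable; fun_prop), intervalIntegral.integral_const_mul,
      intervalIntegral.integral_const_mul, integral_cos_int, integral_cos_int]
    simp only [cnt]
    split_ifs <;> first | omega | (push_cast; ring)
  | succ j ih =>
    simp_rw [osc_succ, sum_mul]
    have hint : ∀ i ∈ range k, IntervalIntegrable
        (fun t => osc k j (y + (i + 1)) t * Real.sin (t / 2)) volume 0 Real.pi := fun i _ =>
      ((continuous_osc k j _).mul (by fun_prop)).intervalIntegrable _ _
    rw [intervalIntegral.integral_finsetSum hint]
    simp_rw [ih]
    rw [← mul_sum, sum_sub_distrib, cnt_succ, cnt_succ]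
    push_cast
    congr 2 <;>
    · refine sum_congr rfl fun i _ => ?_
      congr 2; ring

/-- The full oscillating function `Im (exp (λ P) * phase)`. -/
noncomputable def fullOsc (k : ℕ) (lam : ℝ) (y : ℤ) (t : ℝ) : ℝ :=
  (Complex.exp (lam * trigSum k t) * phase y t).im

lemma hasSum_fullOsc (k : ℕ) (lam : ℝ) (y : ℤ) (t : ℝ) :
    HasSum (fun j : ℕ => lam ^ j / j.factorial * osc k j y t) (fullOsc k lam y t) := by
  have h : HasSum (fun j : ℕ => (lam * trigSum k t) ^ j / (j.factorial : ℂ))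
      (Complex.exp (lam * trigSum k t)) := by
    rw [Complex.exp_eq_exp_ℂ]; exact NormedSpace.expSeries_div_hasSum_exp _
  have h2 := Complex.hasSum_im (h.mul_right (phase y t))
  convert h2 using 2 with j
  · rw [osc, mul_pow]
    have e : (lam : ℂ) ^ j * trigSum k t ^ j / (j.factorial : ℂ) * phase y t =
        ((lam ^ j / j.factorial : ℝ) : ℂ) * (trigSum k t ^ j * phase y t) := by
      push_cast; ring
    rw [e, Complex.im_ofReal_mul]
  · rfl

lemma continuous_fullOsc (k : ℕ) (lam : ℝ) (y : ℤ) : Continuous (fullOsc k lam y) := by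
  have := continuous_trigSum k
  have := continuous_phase y
  exact Complex.continuous_im.comp (by fun_prop)

lemma summable_osc_bound (k : ℕ) (lam A B : ℝ) :
    Summable fun j : ℕ => |lam ^ j / j.factorial| * ((k : ℝ) ^ j * (A + j * B)) := by
  have h1 := ((hasSum_pow_div_factorial (|lam| * k)).summable).mul_right |A|
  have h2 := ((hasSum_pow_div_factorial (2 * (|lam| * k))).summable).mul_right |B|
  refine Summable.of_norm_bounded (h1.add h2) fun j => ?_
  have hj : (j : ℝ) ≤ 2 ^ j := by exact_mod_cast Nat.lt_two_pow_self.le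
  rw [Real.norm_eq_abs, abs_mul, abs_abs, abs_mul, abs_of_nonneg (show 0 ≤ (k : ℝ) ^ j by positivity),
    abs_div, abs_pow, Nat.abs_cast]
  have h3 : |A + j * B| ≤ |A| + 2 ^ j * |B| := by
    refine (abs_add_le _ _).trans ?_
    rw [abs_mul, Nat.abs_cast]
    gcongr
  calc _ ≤ |lam| ^ j / j.factorial * ((k : ℝ) ^ j * (|A| + 2 ^ j * |B|)) := by gcongr
    _ = _ := by rw [mul_pow, mul_pow, mul_pow]; ring

lemma hasSum_integral_osc (k : ℕ) (lam : ℝ) (y : ℤ) (w : ℝ → ℝ) {A B : ℝ} (hw : Measurable w)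
    (hb : ∀ j : ℕ, ∀ t ∈ Set.Ioc 0 Real.pi,
      |osc k j y t * w t| ≤ (k : ℝ) ^ j * (A + j * B)) :
    HasSum (fun j : ℕ => lam ^ j / j.factorial * ∫ t in (0 : ℝ)..Real.pi, osc k j y t * w t)
      (∫ t in (0 : ℝ)..Real.pi, fullOsc k lam y t * w t) := by
  simp_rw [← intervalIntegral.integral_const_mul]
  refine intervalIntegral.hasSum_integral_of_dominated_convergence
    (fun j _ => |lam ^ j / j.factorial| * ((k : ℝ) ^ j * (A + j * B))) (fun j => ?_) (fun j => ?_)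
    ?_ ?_ ?_
  · exact (((continuous_osc k j y).measurable.mul hw).const_mul _).aestronglyMeasurable
  · refine .of_forall fun t ht => ?_
    rw [Set.uIoc_of_le Real.pi_pos.le] at ht
    rw [Real.norm_eq_abs, abs_mul]
    exact mul_le_mul_of_nonneg_left (hb j t ht) (abs_nonneg _)
  · exact .of_forall fun t _ => summable_osc_bound k lam A B
  · exact intervalIntegrable_const
  · refine .of_forall fun t _ => ?_
    have := (hasSum_fullOsc k lam y t).mul_right (w t)
    simpa only [mul_assoc] using this

lemma integral_fullOsc_div (k : ℕ) (lam : ℝ) (m : ℕ) :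
    ∫ t in (0 : ℝ)..Real.pi, fullOsc k lam (-m - 1) t / Real.sin (t / 2) =
      Real.pi * (Real.exp (k * lam) * (1 - 2 * cdf k lam m)) := by
  have h := hasSum_integral_osc k lam (-m - 1) (fun t => (Real.sin (t / 2))⁻¹)
    (A := (|((-m - 1 : ℤ) : ℝ)| + 1 / 2) * Real.pi) (B := k * Real.pi) (by fun_prop)
    (fun j t ht => (abs_osc_div_le k j (-m - 1) ht).trans (le_of_eq (by ring)))
  simp_rw [← div_eq_mul_inv, integral_osc_div] at h
  refine h.unique ?_
  have h2 := (hasSum_cdf k lam m).mul_left (-Real.pi)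
  refine hasSum_congr h2 (fun j => ?_) (by ring)
  rw [show -(-(m : ℤ) - 1) - 1 = m by ring]; ring

lemma integral_fullOsc_mul (k : ℕ) (lam : ℝ) (m : ℕ) :
    ∫ t in (0 : ℝ)..Real.pi, fullOsc k lam (-m - 1) t * Real.sin (t / 2) =
      Real.pi / 2 * (Real.exp (k * lam) *
        (poissonOrderKPmf k lam (m + 1) - poissonOrderKPmf k lam m)) := by
  have h := hasSum_integral_osc k lam (-m - 1) (fun t => Real.sin (t / 2))
    (A := (|((-m - 1 : ℤ) : ℝ)| + 1 / 2) * Real.pi) (B := k * Real.pi) (by fun_prop)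
    (fun j t ht => by
      rw [abs_mul]
      refine (mul_le_of_le_one_right (abs_nonneg _) (Real.abs_sin_le_one _)).trans ?_
      refine (abs_osc_le k j (-m - 1) ht.1.le).trans ?_
      refine (mul_le_mul_of_nonneg_left ht.2 (by positivity)).trans (le_of_eq (by ring)))
  simp_rw [integral_osc_mul] at h
  refine h.unique ?_
  have h2 := (hasSum_pmf_sub k lam (m + 1) m).mul_left (Real.pi / 2)
  refine hasSum_congr h2 (fun j => ?_) rfl
  rw [show -(-(m : ℤ) - 1) - 1 = m by ring, show -(-(m : ℤ) - 1) = (m + 1 : ℕ) by push_cast; ring]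
  ring

end PoissonK
namespace PoissonK

open Finset MeasureTheory intervalIntegral

lemma trigSum_mul_sin (k : ℕ) (t : ℝ) :
    trigSum k t * (2 * Real.sin (t / 2) * Complex.I) = phase k t - phase 0 t := by
  induction k with
  | zero => simp [trigSum]
  | succ k ih =>
    have e : trigSum (k + 1) t = trigSum k t + Complex.exp (((k + 1 : ℕ) : ℝ) * t * Complex.I) :=
      sum_range_succ _ _
    have h : Complex.exp (((k + 1 : ℕ) : ℝ) * t * Complex.I) *
        (2 * Real.sin (t / 2) * Complex.I) = phase (k + 1 : ℕ) t - phase k t := by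
      have e2 : (2 * Real.sin (t / 2) * Complex.I : ℂ) =
          Complex.exp ((t / 2 : ℂ) * Complex.I) - Complex.exp (-(t / 2 : ℂ) * Complex.I) := by
        rw [Complex.ofReal_sin, Complex.two_sin]; push_cast
        rw [mul_assoc, Complex.I_mul_I]; ring
      rw [e2, mul_sub, ← Complex.exp_add, ← Complex.exp_add, phase, phase]
      congr 2 <;> push_cast <;> ring
    rw [e, add_mul, ih, h]; push_cast; ring

lemma norm_trigSum_mul_sin_le (k : ℕ) {t : ℝ} (ht : t ∈ Set.Ioc 0 Real.pi) :
    ‖trigSum k t‖ * Real.sin (t / 2) ≤ 1 := by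
  have h := congrArg norm (trigSum_mul_sin k t)
  have h2 : ‖phase k t - phase 0 t‖ ≤ 2 := by
    refine (norm_sub_le _ _).trans ?_
    rw [norm_phase, norm_phase]; norm_num
  rw [← h, norm_mul, norm_mul, norm_mul, Complex.norm_I, Complex.norm_real,
    Real.norm_of_nonneg (sin_half_pos ht).le, Complex.norm_two] at h2
  linarith

lemma trigSum_re_mul_sin (k : ℕ) (t : ℝ) :
    2 * ((trigSum k t).re * Real.sin (t / 2)) =
      Real.sin ((k + 1 / 2) * t) - Real.sin (t / 2) := by
  have h := congrArg Complex.im (trigSum_mul_sin k t)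
  rw [Complex.sub_im, phase_im, phase_im] at h
  have e : (trigSum k t * (2 * Real.sin (t / 2) * Complex.I)).im =
      2 * ((trigSum k t).re * Real.sin (t / 2)) := by
    simp [Complex.mul_im, -Complex.ofReal_sin]; ring
  rw [← e, h]; push_cast; congr 2; ring

lemma trigSum_re_nonpos (k : ℕ) {t : ℝ} (ht : t ∈ Set.Ioc 0 Real.pi)
    (h1 : Real.pi ≤ (k + 1 / 2) * t) (h2 : (k + 1 / 2) * t ≤ 2 * Real.pi) :
    (trigSum k t).re ≤ 0 := by
  have h := trigSum_re_mul_sin k t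
  have hs := sin_half_pos ht
  have h3 : Real.sin ((k + 1 / 2) * t) ≤ 0 := by
    have := Real.sin_nonneg_of_nonneg_of_le_pi (x := (k + 1 / 2) * t - Real.pi) (by linarith)
      (by linarith)
    rw [Real.sin_sub_pi] at this; linarith
  by_contra hc
  have := mul_pos (not_le.1 hc) hs
  linarith

lemma trigSum_re_le (k : ℕ) {t σ : ℝ} (ht : t ∈ Set.Ioc 0 Real.pi) (hσ : 0 < σ)
    (h : σ ≤ Real.sin (t / 2)) : (trigSum k t).re ≤ (1 / σ - 1) / 2 := by
  have h1 := trigSum_re_mul_sin k t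
  have hs := sin_half_pos ht
  have h3 := Real.sin_le_one ((k + 1 / 2) * t)
  have h4 : (trigSum k t).re ≤ (1 / Real.sin (t / 2) - 1) / 2 := by
    rw [le_div_iff₀ two_pos, le_sub_iff_add_le, le_div_iff₀ hs]; linarith
  have : 1 / Real.sin (t / 2) ≤ 1 / σ := one_div_le_one_div_of_le hσ h
  linarith

/-- The exponential remainder after `r` terms. -/
noncomputable def expRem (r : ℕ) (z : ℂ) : ℂ := Complex.exp z - ∑ j ∈ range r, z ^ j / j.factorial

lemma hasDerivAt_expRem (r : ℕ) (z : ℂ) : HasDerivAt (expRem (r + 1)) (expRem r z) z := by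
  unfold expRem
  refine (Complex.hasDerivAt_exp z).sub ?_
  have : ∀ z : ℂ, ∑ j ∈ range (r + 1), z ^ j / (j.factorial : ℂ) =
      ∑ j ∈ range r, z ^ (j + 1) / ((j + 1).factorial : ℂ) + 1 := by
    intro z; rw [sum_range_succ']; simp
  simp_rw [this]
  refine HasDerivAt.add_const _ ?_
  refine HasDerivAt.fun_sum fun j _ => ?_
  have h := (hasDerivAt_pow (j + 1) z).div_const ((j + 1).factorial : ℂ)
  refine h.congr_deriv ?_
  rw [Nat.factorial_succ]; push_cast
  have h1 : (j.factorial : ℂ) ≠ 0 := by exact_mod_cast j.factorial_ne_zero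
  have h2 : (j : ℂ) + 1 ≠ 0 := by exact_mod_cast j.succ_ne_zero
  field_simp

lemma expRem_zero_right (r : ℕ) : expRem (r + 1) 0 = 0 := by
  rw [expRem, sum_range_succ']; simp

lemma norm_expRem_le (r : ℕ) (z : ℂ) {M : ℝ} (h0 : 0 ≤ M) (hz : z.re ≤ M) :
    ‖expRem r z‖ ≤ ‖z‖ ^ r / r.factorial * Real.exp M := by
  induction r generalizing z with
  | zero => simpa [expRem, Complex.norm_exp] using hz
  | succ r ih =>
    have hd : ∀ s : ℝ, HasDerivAt (fun s : ℝ => expRem (r + 1) (s * z)) (expRem r (s * z) * z) s := by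
      intro s
      have h1 : HasDerivAt (fun s : ℝ => (s : ℂ) * z) z s := by
        simpa using (Complex.ofRealCLM.hasDerivAt (x := s)).mul_const z
      exact (hasDerivAt_expRem r (s * z)).comp s h1
    have hB : ∀ s : ℝ, HasDerivAt
        (fun s : ℝ => ‖z‖ ^ (r + 1) / (r + 1).factorial * Real.exp M * s ^ (r + 1))
        (‖z‖ ^ (r + 1) / r.factorial * Real.exp M * s ^ r) s := by
      intro s
      have h := (hasDerivAt_pow (r + 1) s).const_mul
        (‖z‖ ^ (r + 1) / (r + 1).factorial * Real.exp M)
      refine h.congr_deriv ?_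
      rw [Nat.factorial_succ]; push_cast
      have h1 : (r.factorial : ℝ) ≠ 0 := by exact_mod_cast r.factorial_ne_zero
      have h2 : (r : ℝ) + 1 ≠ 0 := by positivity
      field_simp
    have := image_norm_le_of_norm_deriv_right_le_deriv_boundary
      (f := fun s : ℝ => expRem (r + 1) (s * z)) (a := 0) (b := 1)
      (fun s _ => (hd s).continuousAt.continuousWithinAt)
      (fun s _ => (hd s).hasDerivWithinAt) (by simp [expRem_zero_right]) hB (fun s hs => by
        have hs' : (s * z : ℂ).re ≤ M := by
          rw [Complex.re_ofReal_mul]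
          nlinarith [hs.1, hs.2, mul_le_mul_of_nonneg_left hz hs.1]
        rw [norm_mul]
        refine (mul_le_mul_of_nonneg_right (ih _ hs') (norm_nonneg z)).trans (le_of_eq ?_)
        rw [norm_mul, Complex.norm_real, Real.norm_of_nonneg hs.1]; ring)
      (Set.right_mem_Icc.2 zero_le_one)
    simpa using this

/-- The oscillating remainder `Im (expRem r (λ P) * phase)`. -/
noncomputable def remOsc (r k : ℕ) (lam : ℝ) (y : ℤ) (t : ℝ) : ℝ :=
  (expRem r (lam * trigSum k t) * phase y t).im

lemma remOsc_eq (r k : ℕ) (lam : ℝ) (y : ℤ) (t : ℝ) :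
    remOsc r k lam y t =
      fullOsc k lam y t - ∑ j ∈ range r, lam ^ j / j.factorial * osc k j y t := by
  rw [remOsc, expRem, sub_mul, Complex.sub_im, fullOsc, sum_mul, Complex.im_sum]
  congr 1
  refine sum_congr rfl fun j _ => ?_
  have e : (lam * trigSum k t) ^ j / (j.factorial : ℂ) * phase y t =
      ((lam ^ j / j.factorial : ℝ) : ℂ) * (trigSum k t ^ j * phase y t) := by
    rw [mul_pow]; push_cast; ring
  rw [e, Complex.im_ofReal_mul, osc]

lemma abs_remOsc_le (r k : ℕ) {lam : ℝ} (hlam : 0 ≤ lam) (y : ℤ) {t M : ℝ}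
    (ht : t ∈ Set.Ioc 0 Real.pi) (h0 : 0 ≤ M) (hM : (trigSum k t).re ≤ M) :
    |remOsc r k lam y t| * Real.sin (t / 2) ^ r ≤
      lam ^ r / r.factorial * Real.exp (lam * M) := by
  have h1 : |remOsc r k lam y t| ≤ ‖expRem r (lam * trigSum k t)‖ := by
    refine (Complex.abs_im_le_norm _).trans (le_of_eq ?_)
    rw [norm_mul, norm_phase, mul_one]
  have h2 := norm_expRem_le r (lam * trigSum k t) (M := lam * M) (by positivity) (by
    rw [Complex.re_ofReal_mul]; gcongr)
  rw [norm_mul, Complex.norm_real, Real.norm_of_nonneg hlam, mul_pow] at h2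
  have hs := (sin_half_pos ht).le
  have h3 : (‖trigSum k t‖ * Real.sin (t / 2)) ^ r ≤ 1 :=
    pow_le_one₀ (by positivity) (norm_trigSum_mul_sin_le k ht)
  calc _ ≤ (lam ^ r * ‖trigSum k t‖ ^ r / r.factorial * Real.exp (lam * M)) *
        Real.sin (t / 2) ^ r := by gcongr; exact h1.trans h2
    _ = lam ^ r / r.factorial * Real.exp (lam * M) *
        (‖trigSum k t‖ * Real.sin (t / 2)) ^ r := by ring
    _ ≤ _ := mul_le_of_le_one_right (by positivity) h3

lemma integral_inv_sin_sq {a b : ℝ} (ha : 0 < a) (hab : a ≤ b) (hb : b ≤ Real.pi) :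
    ∫ t in a..b, 1 / Real.sin (t / 2) ^ 2 =
      2 * (Real.cos (a / 2) / Real.sin (a / 2)) - 2 * (Real.cos (b / 2) / Real.sin (b / 2)) := by
  have hne : ∀ t ∈ Set.uIcc a b, Real.sin (t / 2) ≠ 0 := by
    intro t ht
    rw [Set.uIcc_of_le hab] at ht
    exact (sin_half_pos ⟨ha.trans_le ht.1, ht.2.trans hb⟩).ne'
  rw [integral_eq_sub_of_hasDerivAt (f := fun t => -(2 * (Real.cos (t / 2) / Real.sin (t / 2))))]
  · ring
  · intro t ht
    have h2 : HasDerivAt (fun t : ℝ => t / 2) (1 / 2) t := (hasDerivAt_id t).div_const 2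
    have h := ((h2.cos.div h2.sin (hne t ht)).const_mul 2).neg
    refine h.congr_deriv ?_
    have h3 := hne t ht
    have h4 := Real.sin_sq_add_cos_sq (t / 2)
    field_simp
    linear_combination h4
  · refine ContinuousOn.intervalIntegrable ?_
    exact continuousOn_const.div (by fun_prop) fun t ht => pow_ne_zero 2 (hne t ht)

lemma cot_half_le {a : ℝ} (ha : 0 < a) (h : a < Real.pi) :
    Real.cos (a / 2) / Real.sin (a / 2) ≤ 2 / a := by
  have h1 := Real.lt_tan (x := a / 2) (by linarith) (by linarith)
  rw [Real.tan_eq_sin_div_cos] at h1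
  have hc : 0 < Real.cos (a / 2) := Real.cos_pos_of_mem_Ioo ⟨by linarith, by linarith⟩
  have hs : 0 < Real.sin (a / 2) := sin_half_pos ⟨ha, h.le⟩
  rw [lt_div_iff₀ hc] at h1
  rw [div_le_div_iff₀ hs ha]; linarith

/-- Bound for the part of an integral away from the origin. -/
lemma abs_integral_tail_le {k : ℕ} (hk : 2 ≤ k) {f : ℝ → ℝ} {C lam M T : ℝ} (hC : 0 ≤ C)
    (hT : T = Real.pi / (k + 1 / 2)) (hM : M = (1 / Real.sin T - 1) / 2)
    (hf : ContinuousOn f (Set.Icc T Real.pi))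
    (h : ∀ t ∈ Set.Ioc 0 Real.pi, ∀ N : ℝ, 0 ≤ N → (trigSum k t).re ≤ N →
      |f t| ≤ C * Real.exp (lam * N) * (1 / Real.sin (t / 2) ^ 2)) :
    |∫ t in T..Real.pi, f t| ≤ C * (4 / T) + C * Real.exp (lam * M) * (2 / T) := by
  have hk' : (2 : ℝ) ≤ k := by exact_mod_cast hk
  have hpi := Real.pi_pos
  have hT0 : 0 < T := by rw [hT]; positivity
  have hTk : (k + 1 / 2) * T = Real.pi := by rw [hT]; field_simp
  have hT2 : 2 * T < Real.pi := by nlinarith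
  have hsT : 0 < Real.sin T := Real.sin_pos_of_pos_of_lt_pi hT0 (by linarith)
  have hM0 : 0 ≤ M := by
    have : 1 ≤ 1 / Real.sin T := (one_le_div hsT).2 (Real.sin_le_one T)
    rw [hM]; linarith
  have hi1 : IntervalIntegrable f volume T (2 * T) := ContinuousOn.intervalIntegrable (by
    rw [Set.uIcc_of_le (by linarith)]; exact hf.mono (Set.Icc_subset_Icc le_rfl hT2.le))
  have hi2 : IntervalIntegrable f volume (2 * T) Real.pi := ContinuousOn.intervalIntegrable (by
    rw [Set.uIcc_of_le hT2.le]; exact hf.mono (Set.Icc_subset_Icc (by linarith) le_rfl))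
  have key : ∀ a b N : ℝ, T ≤ a → a ≤ b → b ≤ Real.pi → 0 ≤ N →
      (∀ t ∈ Set.Icc a b, (trigSum k t).re ≤ N) →
      |∫ t in a..b, f t| ≤ C * Real.exp (lam * N) * ∫ t in a..b, 1 / Real.sin (t / 2) ^ 2 := by
    intro a b N haT hab hb hN hre
    rw [← intervalIntegral.integral_const_mul]
    refine norm_integral_le_of_norm_le (f := f) hab (.of_forall fun t ht => ?_) ?_
    · exact h t ⟨hT0.trans_le (haT.trans ht.1.le), ht.2.trans hb⟩ N hN (hre t ⟨ht.1.le, ht.2⟩)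
    · refine ContinuousOn.intervalIntegrable ?_
      rw [Set.uIcc_of_le hab]
      refine continuousOn_const.mul (continuousOn_const.div (by fun_prop) fun t ht => ?_)
      exact pow_ne_zero 2 (sin_half_pos ⟨hT0.trans_le (haT.trans ht.1), ht.2.trans hb⟩).ne'
  have b1 := key T (2 * T) 0 le_rfl (by linarith) hT2.le le_rfl fun t ht =>
    trigSum_re_nonpos k ⟨hT0.trans_le ht.1, by linarith [ht.2]⟩ (by nlinarith [ht.1])
      (by nlinarith [ht.2])
  have b2 := key (2 * T) Real.pi M (by linarith) hT2.le le_rfl hM0 fun t ht => by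
    rw [hM]
    refine trigSum_re_le k ⟨by linarith [ht.1], ht.2⟩ hsT ?_
    exact Real.sin_le_sin_of_le_of_le_pi_div_two (by linarith) (by linarith [ht.2])
      (by linarith [ht.1])
  rw [integral_inv_sin_sq hT0 (by linarith) hT2.le] at b1
  rw [integral_inv_sin_sq (by linarith) hT2.le le_rfl] at b2
  have c1 := cot_half_le hT0 (by linarith)
  have c2 := cot_half_le (a := 2 * T) (by linarith) hT2
  have c3 : 0 ≤ Real.cos (2 * T / 2) / Real.sin (2 * T / 2) :=
    div_nonneg (Real.cos_nonneg_of_mem_Icc ⟨by linarith, by linarith⟩)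
      (sin_half_pos ⟨by linarith, hT2.le⟩).le
  rw [Real.cos_pi_div_two, zero_div, mul_zero, sub_zero] at b2
  rw [← integral_add_adjacent_intervals hi1 hi2]
  refine (abs_add_le _ _).trans (add_le_add (b1.trans ?_) (b2.trans ?_))
  · rw [mul_zero, Real.exp_zero, mul_one]
    refine mul_le_mul_of_nonneg_left ?_ hC
    calc _ ≤ 2 * (2 / T) - 2 * 0 := by gcongr
      _ = _ := by ring
  · refine mul_le_mul_of_nonneg_left ?_ (by positivity)
    calc _ ≤ 2 * (2 / (2 * T)) := by gcongr
      _ = _ := by field_simp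

end PoissonK
namespace PoissonK

open Finset MeasureTheory intervalIntegral

/-- The decay exponent of the characteristic function. -/
noncomputable def decay (k : ℕ) (lam t : ℝ) : ℝ :=
  lam * ∑ i ∈ range k, (1 - Real.cos (((i + 1 : ℕ) : ℝ) * t))

/-- The phase of the characteristic function relative to the point `mean - s`. -/
noncomputable def twist (k : ℕ) (lam s t : ℝ) : ℝ :=
  lam * ∑ i ∈ range k, (((i + 1 : ℕ) : ℝ) * t - Real.sin (((i + 1 : ℕ) : ℝ) * t)) - s * t

/-- The real part of the characteristic function integrand. -/
noncomputable def wave (k : ℕ) (lam s t : ℝ) : ℝ :=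
  Real.exp (-decay k lam t) * Real.sin (twist k lam s t)

lemma continuous_wave (k : ℕ) (lam s : ℝ) : Continuous (wave k lam s) := by
  unfold wave decay twist; fun_prop

lemma fullOsc_eq (k : ℕ) (lam : ℝ) {s : ℝ} {m : ℕ}
    (hs : (m : ℝ) + 1 / 2 = lam * ∑ i ∈ range k, ((i + 1 : ℕ) : ℝ) - s) (t : ℝ) :
    fullOsc k lam (-m - 1) t = -(Real.exp (k * lam) * wave k lam s t) := by
  have hre : ((lam : ℂ) * trigSum k t).re = k * lam - decay k lam t := by
    rw [Complex.re_ofReal_mul, trigSum, Complex.re_sum, decay, sum_sub_distrib]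
    simp_rw [← Complex.ofReal_mul, Complex.exp_ofReal_mul_I_re]
    simp; ring
  have him : ((lam : ℂ) * trigSum k t).im + (((-m - 1 : ℤ) : ℝ) + 1 / 2) * t =
      -twist k lam s t := by
    have e : (((-m - 1 : ℤ) : ℝ) + 1 / 2) = -((m : ℝ) + 1 / 2) := by push_cast; ring
    rw [e, hs, Complex.im_ofReal_mul, trigSum, Complex.im_sum, twist, sum_sub_distrib, ← sum_mul]
    simp_rw [← Complex.ofReal_mul, Complex.exp_ofReal_mul_I_im]
    ring
  rw [fullOsc, phase, ← Complex.exp_add, Complex.exp_im]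
  have e1 : ((lam : ℂ) * trigSum k t +
      ((((-m - 1 : ℤ) : ℝ) + 1 / 2 : ℝ) : ℂ) * t * Complex.I).re = k * lam - decay k lam t := by
    rw [Complex.add_re, hre, ← Complex.ofReal_mul, Complex.re_ofReal_mul]; simp
  have e2 : ((lam : ℂ) * trigSum k t +
      ((((-m - 1 : ℤ) : ℝ) + 1 / 2 : ℝ) : ℂ) * t * Complex.I).im = -twist k lam s t := by
    rw [← him, Complex.add_im, ← Complex.ofReal_mul, Complex.im_ofReal_mul]; simp
  rw [e1, e2, Real.sin_neg, sub_eq_add_neg, Real.exp_add, wave]; ring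

lemma remOsc_div_bound (k r n : ℕ) {lam : ℝ} (hlam : 0 ≤ lam) (y : ℤ) {t N : ℝ}
    (ht : t ∈ Set.Ioc 0 Real.pi) (hN : 0 ≤ N) (hre : (trigSum k t).re ≤ N) (hr : r + n = 2) :
    |remOsc r k lam y t| / Real.sin (t / 2) ^ n ≤
      lam ^ r / r.factorial * Real.exp (lam * N) * (1 / Real.sin (t / 2) ^ 2) := by
  have hs := sin_half_pos ht
  have := abs_remOsc_le r k hlam y ht hN hre
  rw [mul_one_div, ← hr, pow_add, div_le_div_iff₀ (by positivity) (by positivity), ← mul_assoc]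
  gcongr

lemma continuousOn_remOsc (r k : ℕ) (lam : ℝ) (y : ℤ) : Continuous (remOsc r k lam y) := by
  have : remOsc r k lam y = fun t =>
      fullOsc k lam y t - ∑ j ∈ range r, lam ^ j / j.factorial * osc k j y t :=
    funext (remOsc_eq r k lam y)
  rw [this]
  have h1 := continuous_fullOsc k lam y
  have h2 := fun j => continuous_osc k j y
  fun_prop

lemma continuousOn_div_sin {f : ℝ → ℝ} (hf : Continuous f) {T : ℝ} (hT : 0 < T) :
    ContinuousOn (fun t => f t / Real.sin (t / 2)) (Set.Icc T Real.pi) :=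
  hf.continuousOn.div (by fun_prop) fun _ ht => (sin_half_pos ⟨hT.trans_le ht.1, ht.2⟩).ne'

lemma intervalIntegrable_fullOsc_div (k : ℕ) {lam : ℝ} (y : ℤ) :
    IntervalIntegrable (fun t => fullOsc k lam y t / Real.sin (t / 2)) volume 0 Real.pi := by
  rw [intervalIntegrable_iff_integrableOn_Ioc_of_le Real.pi_pos.le]
  refine Measure.integrableOn_of_bounded (M := ∑' j : ℕ, |lam ^ j / j.factorial| *
    ((k : ℝ) ^ j * ((|(y : ℝ)| + 1 / 2) * Real.pi + j * (k * Real.pi)))) (by simp) ?_ ?_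
  · exact ((continuous_fullOsc k lam y).measurable.div (by fun_prop)).aestronglyMeasurable
  · refine (ae_restrict_iff' measurableSet_Ioc).2 (.of_forall fun t ht => ?_)
    have h := (hasSum_fullOsc k lam y t).div_const (Real.sin (t / 2))
    refine h.norm_le_of_bounded (summable_osc_bound k lam _ _).hasSum fun j => ?_
    rw [mul_div_assoc, Real.norm_eq_abs, abs_mul]
    exact mul_le_mul_of_nonneg_left ((abs_osc_div_le k j y ht).trans (le_of_eq (by ring)))
      (abs_nonneg _)

lemma ioc_subset {T : ℝ} (h0 : 0 ≤ T) (hT : T ≤ Real.pi) :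
    Set.uIcc 0 T ⊆ Set.uIcc 0 Real.pi ∧ Set.uIcc T Real.pi ⊆ Set.uIcc 0 Real.pi := by
  rw [Set.uIcc_of_le h0, Set.uIcc_of_le hT, Set.uIcc_of_le Real.pi_pos.le]
  exact ⟨Set.Icc_subset_Icc le_rfl hT, Set.Icc_subset_Icc h0 le_rfl⟩

lemma cutoff_mem {k : ℕ} (hk : 2 ≤ k) : 0 < Real.pi / (k + 1 / 2 : ℝ) ∧
    Real.pi / (k + 1 / 2 : ℝ) ≤ Real.pi := by
  have hk' : (2 : ℝ) ≤ k := by exact_mod_cast hk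
  have := Real.pi_pos
  exact ⟨by positivity, div_le_self Real.pi_pos.le (by linarith)⟩

lemma integrableOn_wave_div (k : ℕ) (lam : ℝ) {s : ℝ} {m : ℕ}
    (hs : (m : ℝ) + 1 / 2 = lam * ∑ i ∈ range k, ((i + 1 : ℕ) : ℝ) - s) :
    IntervalIntegrable (fun t => wave k lam s t / Real.sin (t / 2)) volume 0 Real.pi := by
  have h := (intervalIntegrable_fullOsc_div k (lam := lam) (-m - 1)).const_mul
    (-Real.exp (-(k * lam)))
  refine h.congr (fun t _ => ?_)
  simp only [fullOsc_eq k lam hs]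
  rw [neg_div, neg_mul_neg, mul_div_assoc, ← mul_assoc, ← Real.exp_add]; simp

lemma abs_cdf_sub_le {k : ℕ} (hk : 2 ≤ k) {lam s T M : ℝ} (hlam : 0 ≤ lam) {m : ℕ}
    (hs : (m : ℝ) + 1 / 2 = lam * ∑ i ∈ range k, ((i + 1 : ℕ) : ℝ) - s)
    (hT : T = Real.pi / (k + 1 / 2)) (hM : M = (1 / Real.sin T - 1) / 2) :
    |Real.pi * (2 * cdf k lam m - 1) -
      ∫ t in (0 : ℝ)..T, wave k lam s t / Real.sin (t / 2)| ≤
      Real.exp (-(k * lam)) * (Real.pi + (m + 1 / 2) * Real.pi * T +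
        (lam * (4 / T) + lam * Real.exp (lam * M) * (2 / T))) := by
  obtain ⟨hT0, hTpi⟩ := cutoff_mem hk
  rw [← hT] at hT0 hTpi
  obtain ⟨hs1, hs2⟩ := ioc_subset hT0.le hTpi
  set y : ℤ := -m - 1 with hy
  have hI := intervalIntegrable_fullOsc_div k (lam := lam) y
  have hI0 := intervalIntegrable_osc_div k 0 y
  have h1 := integral_fullOsc_div k lam m
  have h2 := integral_osc_div k 0 y
  rw [← hy] at h1
  rw [← integral_add_adjacent_intervals (hI.mono_set hs1) (hI.mono_set hs2)] at h1
  rw [← integral_add_adjacent_intervals (hI0.mono_set hs1) (hI0.mono_set hs2)] at h2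
  have h3 := intervalIntegral.integral_sub (hI.mono_set hs2) (hI0.mono_set hs2)
  have h4 := abs_integral_tail_le hk (f := fun t => remOsc 1 k lam y t / Real.sin (t / 2))
    (C := lam ^ 1 / (1 : ℕ).factorial) (lam := lam) (by positivity) hT hM
    (continuousOn_div_sin (continuousOn_remOsc 1 k lam y) hT0) (fun t ht N hN hre => by
      have := remOsc_div_bound k 1 1 hlam y ht hN hre rfl
      rwa [pow_one, ← abs_of_pos (sin_half_pos ht), ← abs_div, abs_of_pos (sin_half_pos ht)] at this)
  have h5 : ∀ t, remOsc 1 k lam y t / Real.sin (t / 2) =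
      fullOsc k lam y t / Real.sin (t / 2) - osc k 0 y t / Real.sin (t / 2) := by
    intro t; rw [remOsc_eq]; simp [sub_div]
  simp_rw [h5] at h4
  rw [h3] at h4
  have h6 : |∫ t in (0 : ℝ)..T, osc k 0 y t / Real.sin (t / 2)| ≤ (m + 1 / 2) * Real.pi * T := by
    have := norm_integral_le_of_norm_le_const (a := 0) (b := T)
      (f := fun t => osc k 0 y t / Real.sin (t / 2)) (C := (m + 1 / 2) * Real.pi) (fun t ht => by
        rw [Set.uIoc_of_le hT0.le] at ht
        have ht' : t ∈ Set.Ioc 0 Real.pi := ⟨ht.1, ht.2.trans hTpi⟩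
        have h := sin_half_pos ht'
        have h2 := le_sin_half ⟨ht'.1.le, ht'.2⟩
        rw [div_le_iff₀ Real.pi_pos] at h2
        rw [Real.norm_eq_abs, abs_div, abs_of_pos h, div_le_iff₀ h, osc_zero]
        refine Real.abs_sin_le_abs.trans ?_
        have e : ((y : ℝ) + 1 / 2) = -((m : ℝ) + 1 / 2) := by rw [hy]; push_cast; ring
        rw [abs_mul, e, abs_neg, abs_of_pos (by positivity), abs_of_pos ht.1, mul_assoc,
          mul_comm Real.pi]
        gcongr)
    rwa [sub_zero, abs_of_pos hT0] at this
  have h7 : ∫ t in (0 : ℝ)..T, fullOsc k lam y t / Real.sin (t / 2) =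
      -(Real.exp (k * lam) * ∫ t in (0 : ℝ)..T, wave k lam s t / Real.sin (t / 2)) := by
    rw [← intervalIntegral.integral_const_mul, ← intervalIntegral.integral_neg]
    refine integral_congr fun t _ => ?_
    simp only [hy, fullOsc_eq k lam hs]; ring
  rw [h7] at h1
  have hc : cum k 0 (-y - 1) = 1 := by rw [hy]; simp [cum]
  rw [hc] at h2
  simp only [pow_one, Nat.factorial_one, Nat.cast_one, div_one, pow_zero] at h4 h2
  have he := Real.exp_pos (k * lam)
  rw [Real.exp_neg, inv_mul_eq_div, le_div_iff₀ he, ← abs_of_pos he, ← abs_mul]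
  rw [abs_le] at h4 h6 ⊢
  constructor <;> linarith [h4.1, h4.2, h6.1, h6.2]

lemma integral_fullOsc_eq (k : ℕ) (lam : ℝ) {s : ℝ} {m : ℕ}
    (hs : (m : ℝ) + 1 / 2 = lam * ∑ i ∈ range k, ((i + 1 : ℕ) : ℝ) - s) (T : ℝ) :
    ∫ t in (0 : ℝ)..T, fullOsc k lam (-m - 1) t * Real.sin (t / 2) =
      -(Real.exp (k * lam) * ∫ t in (0 : ℝ)..T, wave k lam s t * Real.sin (t / 2)) := by
  rw [← intervalIntegral.integral_const_mul, ← intervalIntegral.integral_neg]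
  refine integral_congr fun t _ => ?_
  simp only [fullOsc_eq k lam hs]; ring

lemma abs_osc_le_pow (k j : ℕ) (y : ℤ) (t : ℝ) : |osc k j y t| ≤ (k : ℝ) ^ j := by
  refine (Complex.abs_im_le_norm _).trans ?_
  rw [norm_mul, norm_phase, mul_one, norm_pow]
  refine pow_le_pow_left₀ (norm_nonneg _) ((norm_sum_le _ _).trans (le_of_eq ?_)) j
  simp_rw [← Complex.ofReal_mul, Complex.norm_exp_ofReal_mul_I]
  simp

lemma integral_osc_mul_tail_le (k j m : ℕ) {T : ℝ} (hT0 : 0 < T) (hm : j * (k + 1) ≤ 2 * m + 1) :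
    ∫ t in T..Real.pi, osc k j (-m - 1) t * Real.sin (t / 2) ≤ (k : ℝ) ^ j * (T ^ 2 / 4) := by
  have hc : Continuous fun t => osc k j (-m - 1) t * Real.sin (t / 2) := by
    have := continuous_osc k j (-m - 1); fun_prop
  have h1 := integral_add_adjacent_intervals (μ := volume) (hc.intervalIntegrable 0 T)
    (hc.intervalIntegrable T Real.pi)
  have h2 : ∫ t in (0 : ℝ)..Real.pi, osc k j (-m - 1) t * Real.sin (t / 2) ≤ 0 := by
    rw [integral_osc_mul]
    have : cnt k j (-(-m - 1) : ℤ) ≤ cnt k j (-(-m - 1) - 1 : ℤ) := by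
      refine cnt_le_cnt k j ?_
      have hm' : (j : ℤ) * (k + 1) ≤ 2 * m + 1 := by exact_mod_cast hm
      rw [← sq_le_sq]; nlinarith
    have h' : (cnt k j (-(-m - 1) : ℤ) : ℝ) ≤ cnt k j (-(-m - 1) - 1 : ℤ) := by exact_mod_cast this
    have := Real.pi_pos
    nlinarith
  have h3 : -((k : ℝ) ^ j * (T ^ 2 / 4)) ≤
      ∫ t in (0 : ℝ)..T, osc k j (-m - 1) t * Real.sin (t / 2) := by
    have e : -((k : ℝ) ^ j * (T ^ 2 / 4)) = ∫ t in (0 : ℝ)..T, -((k : ℝ) ^ j / 2) * t := by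
      rw [intervalIntegral.integral_const_mul, integral_id]; ring
    rw [e]
    refine integral_mono_on hT0.le
      ((by fun_prop : Continuous fun t : ℝ => -((k : ℝ) ^ j / 2) * t).intervalIntegrable 0 T)
      (hc.intervalIntegrable 0 T) fun t ht => ?_
    have ha := abs_osc_le_pow k j (-m - 1) t
    have hb : |Real.sin (t / 2)| ≤ t / 2 := by
      have := Real.abs_sin_le_abs (x := t / 2)
      rwa [abs_of_nonneg (by linarith [ht.1] : 0 ≤ t / 2)] at this
    have : |osc k j (-m - 1) t * Real.sin (t / 2)| ≤ (k : ℝ) ^ j * (t / 2) := by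
      rw [abs_mul]; gcongr
    linarith [(abs_le.1 this).1]
  linarith

lemma pmf_sub_ge {k : ℕ} (hk : 2 ≤ k) {lam s T M : ℝ} (hlam : 0 ≤ lam) {m : ℕ} (hm : k + 1 ≤ m)
    (hs : (m : ℝ) + 1 / 2 = lam * ∑ i ∈ range k, ((i + 1 : ℕ) : ℝ) - s)
    (hT : T = Real.pi / (k + 1 / 2)) (hM : M = (1 / Real.sin T - 1) / 2) :
    (∫ t in (0 : ℝ)..T, wave k lam s t * Real.sin (t / 2)) -
      Real.exp (-(k * lam)) * ((1 + k * lam + (k * lam) ^ 2 / 2) * (T ^ 2 / 4) +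
        (lam ^ 3 / 6 * (4 / T) + lam ^ 3 / 6 * Real.exp (lam * M) * (2 / T))) ≤
      Real.pi / 2 * (poissonOrderKPmf k lam m - poissonOrderKPmf k lam (m + 1)) := by
  obtain ⟨hT0, hTpi⟩ := cutoff_mem hk
  rw [← hT] at hT0 hTpi
  set y : ℤ := -m - 1 with hy
  have hcf : Continuous fun t => fullOsc k lam y t * Real.sin (t / 2) := by
    have := continuous_fullOsc k lam y; fun_prop
  have h1 := integral_fullOsc_mul k lam m
  rw [← hy, ← integral_add_adjacent_intervals (hcf.intervalIntegrable 0 T)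
    (hcf.intervalIntegrable T Real.pi), hy, integral_fullOsc_eq k lam hs, ← hy] at h1
  have h4 := abs_integral_tail_le hk (f := fun t => remOsc 3 k lam y t * Real.sin (t / 2))
    (C := lam ^ 3 / (3 : ℕ).factorial) (lam := lam) (by positivity) hT hM
    (by have := continuousOn_remOsc 3 k lam y
        exact (by fun_prop : Continuous fun t =>
          remOsc 3 k lam y t * Real.sin (t / 2)).continuousOn) (fun t ht N hN hre => by
      have := abs_remOsc_le 3 k hlam y ht hN hre
      have hp := sin_half_pos ht
      rw [mul_one_div, le_div_iff₀ (by positivity), abs_mul, abs_of_pos hp]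
      calc _ = _ := by ring
        _ ≤ _ := this)
  have hco : ∀ j, Continuous fun t => osc k j y t * Real.sin (t / 2) := fun j => by
    have := continuous_osc k j y; fun_prop
  have h5 : ∫ t in T..Real.pi, remOsc 3 k lam y t * Real.sin (t / 2) =
      (∫ t in T..Real.pi, fullOsc k lam y t * Real.sin (t / 2)) -
      ∑ j ∈ range 3, lam ^ j / j.factorial * ∫ t in T..Real.pi, osc k j y t * Real.sin (t / 2) := by
    simp_rw [← intervalIntegral.integral_const_mul]
    rw [← intervalIntegral.integral_finsetSum fun j _ =>
      ((hco j).const_mul _).intervalIntegrable _ _, ← intervalIntegral.integral_sub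
      (hcf.intervalIntegrable _ _) ((by have := hco; fun_prop : Continuous _).intervalIntegrable _ _)]
    refine integral_congr fun t _ => ?_
    simp only [remOsc_eq, sub_mul, sum_mul, mul_assoc]
  have h6 : ∑ j ∈ range 3, lam ^ j / j.factorial * ∫ t in T..Real.pi,
      osc k j y t * Real.sin (t / 2) ≤ (1 + k * lam + (k * lam) ^ 2 / 2) * (T ^ 2 / 4) := by
    have : ∑ j ∈ range 3, lam ^ j / j.factorial * ((k : ℝ) ^ j * (T ^ 2 / 4)) =
        (1 + k * lam + (k * lam) ^ 2 / 2) * (T ^ 2 / 4) := by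
      simp [sum_range_succ, Nat.factorial]; ring
    rw [← this]
    refine sum_le_sum fun j hj => ?_
    have hj' := mem_range.1 hj
    refine mul_le_mul_of_nonneg_left (integral_osc_mul_tail_le k j m hT0 ?_) (by positivity)
    nlinarith
  have he := Real.exp_pos (k * lam)
  rw [h5, Nat.factorial] at h4
  norm_num [Nat.factorial] at h4
  rw [Real.exp_neg, inv_mul_eq_div, sub_le_iff_le_add, ← sub_le_iff_le_add', le_div_iff₀ he]
  rw [abs_le] at h4
  linarith [h4.2]

lemma pmf_sub_le {k : ℕ} (hk : 2 ≤ k) {lam s T M : ℝ} (hlam : 0 ≤ lam) {m : ℕ}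
    (hs : (m : ℝ) + 1 / 2 = lam * ∑ i ∈ range k, ((i + 1 : ℕ) : ℝ) - s)
    (hT : T = Real.pi / (k + 1 / 2)) (hM : M = (1 / Real.sin T - 1) / 2) :
    Real.pi / 2 * (poissonOrderKPmf k lam m - poissonOrderKPmf k lam (m + 1)) ≤
      (∫ t in (0 : ℝ)..T, wave k lam s t * Real.sin (t / 2)) +
      Real.exp (-(k * lam)) * (4 / T + Real.exp (lam * M) * (2 / T)) := by
  obtain ⟨hT0, hTpi⟩ := cutoff_mem hk
  rw [← hT] at hT0 hTpi
  set y : ℤ := -m - 1 with hy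
  have hcf : Continuous fun t => fullOsc k lam y t * Real.sin (t / 2) := by
    have := continuous_fullOsc k lam y; fun_prop
  have h1 := integral_fullOsc_mul k lam m
  rw [← hy, ← integral_add_adjacent_intervals (hcf.intervalIntegrable 0 T)
    (hcf.intervalIntegrable T Real.pi), hy, integral_fullOsc_eq k lam hs, ← hy] at h1
  have h4 := abs_integral_tail_le hk (f := fun t => fullOsc k lam y t * Real.sin (t / 2))
    (C := 1) (lam := lam) zero_le_one hT hM hcf.continuousOn (fun t ht N hN hre => by
      have := abs_remOsc_le 0 k hlam y ht hN hre
      have hp := sin_half_pos ht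
      have hp1 := Real.sin_le_one (t / 2)
      have h0 : remOsc 0 k lam y t = fullOsc k lam y t := by simp [remOsc_eq]
      rw [h0] at this
      simp only [pow_zero, mul_one, Nat.factorial_zero, Nat.cast_one, div_one, one_mul] at this ⊢
      rw [abs_mul, abs_of_pos hp, mul_one_div, le_div_iff₀ (by positivity)]
      calc |fullOsc k lam y t| * Real.sin (t / 2) * Real.sin (t / 2) ^ 2
          = |fullOsc k lam y t| * Real.sin (t / 2) ^ 3 := by ring
        _ ≤ |fullOsc k lam y t| * 1 := by
            gcongr; exact pow_le_one₀ hp.le hp1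
        _ ≤ _ := by rwa [mul_one])
  have he := Real.exp_pos (k * lam)
  rw [Real.exp_neg, inv_mul_eq_div, ← sub_le_iff_le_add', le_div_iff₀ he]
  rw [abs_le] at h4
  linarith [h4.1]

end PoissonK
namespace PoissonK

open Finset MeasureTheory intervalIntegral

lemma cos_le_taylor {x : ℝ} (hx : 0 ≤ x) : Real.cos x ≤ 1 - x ^ 2 / 2 + x ^ 4 / 24 := by
  have hd : ∀ y : ℝ, HasDerivAt (fun y => 1 - y ^ 2 / 2 + y ^ 4 / 24 - Real.cos y)
      (Real.sin y - (y - y ^ 3 / 6)) y := fun y => by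
    have := ((((hasDerivAt_pow 2 y).div_const 2).const_sub 1).add
      ((hasDerivAt_pow 4 y).div_const 24)).sub (Real.hasDerivAt_cos y)
    refine this.congr_deriv ?_
    push_cast; ring
  have := monotoneOn_of_deriv_nonneg (convex_Ici (0 : ℝ))
    (fun y _ => (hd y).continuousAt.continuousWithinAt)
    (fun y _ => (hd y).differentiableAt.differentiableWithinAt) (fun y hy => by
      rw [(hd y).deriv, sub_nonneg]
      exact Real.sin_ge_sub_cube (interior_subset hy))
  have := this Set.self_mem_Ici hx hx
  simp at this
  linarith

lemma sin_le_taylor {x : ℝ} (hx : 0 ≤ x) : Real.sin x ≤ x - x ^ 3 / 6 + x ^ 5 / 120 := by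
  have hd : ∀ y : ℝ, HasDerivAt (fun y => y - y ^ 3 / 6 + y ^ 5 / 120 - Real.sin y)
      (1 - y ^ 2 / 2 + y ^ 4 / 24 - Real.cos y) y := fun y => by
    have := (((hasDerivAt_id y).sub ((hasDerivAt_pow 3 y).div_const 6)).add
      ((hasDerivAt_pow 5 y).div_const 120)).sub (Real.hasDerivAt_sin y)
    refine this.congr_deriv ?_
    push_cast; ring
  have := monotoneOn_of_deriv_nonneg (convex_Ici (0 : ℝ))
    (fun y _ => (hd y).continuousAt.continuousWithinAt)
    (fun y _ => (hd y).differentiableAt.differentiableWithinAt) (fun y hy => by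
      rw [(hd y).deriv, sub_nonneg]
      exact cos_le_taylor (interior_subset hy))
  have := this Set.self_mem_Ici hx hx
  simp at this
  linarith

/-- The power sum `1 ^ r + ⋯ + k ^ r` as a real number. -/
noncomputable def powSum (k r : ℕ) : ℝ := ∑ i ∈ range k, ((i + 1 : ℕ) : ℝ) ^ r

lemma decay_le (k : ℕ) {lam : ℝ} (hlam : 0 ≤ lam) (t : ℝ) :
    decay k lam t ≤ lam * powSum k 2 * t ^ 2 / 2 := by
  rw [decay, powSum, mul_assoc, mul_div_assoc, sum_mul, sum_div]
  refine mul_le_mul_of_nonneg_left (sum_le_sum fun i _ => ?_) hlam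
  have := Real.one_sub_sq_div_two_le_cos (x := ((i + 1 : ℕ) : ℝ) * t)
  rw [mul_pow] at this; linarith

lemma le_decay (k : ℕ) {lam t : ℝ} (hlam : 0 ≤ lam) (ht : 0 ≤ t) :
    lam * powSum k 2 * t ^ 2 / 2 - lam * powSum k 4 / 24 * t ^ 4 ≤ decay k lam t := by
  have e : lam * powSum k 2 * t ^ 2 / 2 - lam * powSum k 4 / 24 * t ^ 4 =
      lam * ∑ i ∈ range k, ((((i + 1 : ℕ) : ℝ) * t) ^ 2 / 2 - (((i + 1 : ℕ) : ℝ) * t) ^ 4 / 24) := by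
    simp_rw [mul_pow, sum_sub_distrib, mul_div_right_comm, ← sum_mul, ← sum_div]
    rw [powSum, powSum]; ring
  rw [e, decay]
  refine mul_le_mul_of_nonneg_left (sum_le_sum fun i _ => ?_) hlam
  have := cos_le_taylor (x := ((i + 1 : ℕ) : ℝ) * t) (by positivity)
  linarith

lemma twist_le (k : ℕ) {lam t : ℝ} (s : ℝ) (hlam : 0 ≤ lam) (ht : 0 ≤ t) :
    twist k lam s t ≤ lam * powSum k 3 / 6 * t ^ 3 - s * t := by
  have e : lam * powSum k 3 / 6 * t ^ 3 =
      lam * ∑ i ∈ range k, (((i + 1 : ℕ) : ℝ) * t) ^ 3 / 6 := by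
    simp_rw [mul_pow, mul_div_right_comm, ← sum_mul, ← sum_div]
    rw [powSum]; ring
  rw [e, twist]
  refine sub_le_sub_right (mul_le_mul_of_nonneg_left (sum_le_sum fun i _ => ?_) hlam) _
  have := Real.sin_ge_sub_cube (x := ((i + 1 : ℕ) : ℝ) * t) (by positivity)
  linarith

lemma le_twist (k : ℕ) {lam t : ℝ} (s : ℝ) (hlam : 0 ≤ lam) (ht : 0 ≤ t) :
    lam * powSum k 3 / 6 * t ^ 3 - lam * powSum k 5 / 120 * t ^ 5 - s * t ≤
      twist k lam s t := by
  have e : lam * powSum k 3 / 6 * t ^ 3 - lam * powSum k 5 / 120 * t ^ 5 =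
      lam * ∑ i ∈ range k,
        ((((i + 1 : ℕ) : ℝ) * t) ^ 3 / 6 - (((i + 1 : ℕ) : ℝ) * t) ^ 5 / 120) := by
    simp_rw [mul_pow, sum_sub_distrib, mul_div_right_comm, ← sum_mul, ← sum_div]
    rw [powSum, powSum]; ring
  rw [e, twist]
  refine sub_le_sub_right (mul_le_mul_of_nonneg_left (sum_le_sum fun i _ => ?_) hlam) _
  have := sin_le_taylor (x := ((i + 1 : ℕ) : ℝ) * t) (by positivity)
  linarith

lemma twist_add_nonneg (k : ℕ) {lam t : ℝ} (s : ℝ) (hlam : 0 ≤ lam) (ht : 0 ≤ t) :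
    0 ≤ twist k lam s t + s * t := by
  rw [twist, sub_add_cancel]
  refine mul_nonneg hlam (sum_nonneg fun i _ => ?_)
  have := Real.sin_le (x := ((i + 1 : ℕ) : ℝ) * t) (by positivity)
  linarith

/-- The even Gaussian moments on the half line. -/
lemma integral_gauss_moment {N : ℝ} (hN : 0 < N) (n : ℕ) :
    ∫ t in Set.Ioi (0 : ℝ), t ^ (2 * n) * Real.exp (-(N ^ 2 * t ^ 2 / 2)) =
      Real.sqrt (Real.pi / 2) * (2 * n - 1).doubleFactorial / N ^ (2 * n + 1) := by
  have h := integral_rpow_mul_exp_neg_mul_rpow (p := 2) (q := (2 * n : ℕ)) (b := N ^ 2 / 2)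
    two_pos (by have : (0 : ℝ) ≤ (2 * n : ℕ) := by positivity
                linarith) (by positivity)
  have e : ∀ t : ℝ, t ^ (2 * n) * Real.exp (-(N ^ 2 * t ^ 2 / 2)) =
      t ^ ((2 * n : ℕ) : ℝ) * Real.exp (-(N ^ 2 / 2) * t ^ (2 : ℝ)) := fun t => by
    rw [Real.rpow_natCast, Real.rpow_two]; congr 2; ring
  simp_rw [e]
  rw [h]
  have e2 : (((2 * n : ℕ) : ℝ) + 1) / 2 = n + 1 / 2 := by push_cast; ring
  have e3 : -(((2 * n : ℕ) : ℝ) + 1) / 2 = -((1 / 2 : ℝ) * (2 * n + 1 : ℕ)) := by push_cast; ring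
  have hb : (N ^ 2 / 2) ^ (1 / 2 : ℝ) = N / Real.sqrt 2 := by
    rw [← Real.sqrt_eq_rpow, Real.sqrt_div (by positivity), Real.sqrt_sq hN.le]
  rw [e2, e3, Real.Gamma_nat_add_half, Real.rpow_neg (by positivity),
    Real.rpow_mul (by positivity), hb, Real.rpow_natCast, Real.sqrt_div Real.pi_pos.le]
  have h2 : Real.sqrt 2 ^ 2 = 2 := Real.sq_sqrt two_pos.le
  have h2' : Real.sqrt 2 ^ (2 * n + 1) = 2 ^ n * Real.sqrt 2 := by rw [pow_succ, pow_mul, h2]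
  have h0 : Real.sqrt 2 ≠ 0 := by positivity
  rw [div_pow, h2']
  field_simp
  rw [h2]

lemma integrableOn_gauss_moment {N : ℝ} (hN : 0 < N) (n : ℕ) :
    IntegrableOn (fun t => t ^ (2 * n) * Real.exp (-(N ^ 2 * t ^ 2 / 2))) (Set.Ioi 0) := by
  have h := integrableOn_rpow_mul_exp_neg_mul_sq (b := N ^ 2 / 2) (by positivity)
    (s := (2 * n : ℕ)) (by have : (0 : ℝ) ≤ (2 * n : ℕ) := by positivity
                           linarith)
  refine h.congr_fun (fun t _ => ?_) measurableSet_Ioi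
  simp only [Real.rpow_natCast]; congr 2; ring

end PoissonK
namespace PoissonK

open Finset MeasureTheory intervalIntegral

/-- The constants governing the Gaussian approximation of `wave` on `[0, T]`. -/
structure WaveParams (k : ℕ) (lam N a₃ a₄ a₅ T₁ T σ b : ℝ) : Prop where
  lam_nonneg : 0 ≤ lam
  N_pos : 0 < N
  N_sq : N ^ 2 = lam * powSum k 2
  a₃_eq : a₃ = lam * powSum k 3 / 6
  a₄_eq : a₄ = lam * powSum k 4 / 24
  a₅_eq : a₅ = lam * powSum k 5 / 120
  T₁_pos : 0 < T₁
  cube : a₃ * T₁ ^ 3 = 3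
  T₁_le : T₁ ≤ T
  T_le : T ≤ Real.pi
  σ_pos : 0 < σ
  σ_le : σ * N ^ 2 ≤ N ^ 2 / 2 - a₄ * (T₁ ^ 2 + T ^ 2)
  one_le : 1 ≤ b * (1 - T ^ 2 / 24)

namespace WaveParams

variable {k : ℕ} {lam N a₃ a₄ a₅ T₁ T σ b : ℝ}

section

variable (P : WaveParams k lam N a₃ a₄ a₅ T₁ T σ b)
include P

lemma a₃_pos : 0 < a₃ := by
  have := P.cube
  have := pow_pos P.T₁_pos 3
  by_contra h
  nlinarith

lemma a₄_nonneg : 0 ≤ a₄ := by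
  rw [P.a₄_eq]
  have := P.lam_nonneg
  have : 0 ≤ powSum k 4 := sum_nonneg fun _ _ => by positivity
  positivity

lemma a₅_nonneg : 0 ≤ a₅ := by
  rw [P.a₅_eq]
  have := P.lam_nonneg
  have : 0 ≤ powSum k 5 := sum_nonneg fun _ _ => by positivity
  positivity

end

end WaveParams

lemma integral_poly_gauss_le {N T : ℝ} (hN : 0 < N) (hT : 0 ≤ T) (c₀ c₁ c₂ c₃ c₄ c₅ : ℝ)
    (h : ∀ t, T ≤ t →
      0 ≤ c₀ + c₁ * t ^ 2 + c₂ * t ^ 4 + c₃ * t ^ 6 + c₄ * t ^ 8 + c₅ * t ^ 10) :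
    ∫ t in (0 : ℝ)..T, (c₀ + c₁ * t ^ 2 + c₂ * t ^ 4 + c₃ * t ^ 6 + c₄ * t ^ 8 + c₅ * t ^ 10) *
      Real.exp (-(N ^ 2 * t ^ 2 / 2)) ≤
      Real.sqrt (Real.pi / 2) * (c₀ / N + c₁ / N ^ 3 + 3 * c₂ / N ^ 5 + 15 * c₃ / N ^ 7 +
        105 * c₄ / N ^ 9 + 945 * c₅ / N ^ 11) := by
  set c : ℕ → ℝ := fun n => if n = 0 then c₀ else if n = 1 then c₁ else if n = 2 then c₂ else
    if n = 3 then c₃ else if n = 4 then c₄ else c₅ with hc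
  set f : ℝ → ℝ := fun t => (c₀ + c₁ * t ^ 2 + c₂ * t ^ 4 + c₃ * t ^ 6 + c₄ * t ^ 8 +
    c₅ * t ^ 10) * Real.exp (-(N ^ 2 * t ^ 2 / 2)) with hf
  have e : f = fun t => ∑ n ∈ range 6,
      c n * (t ^ (2 * n) * Real.exp (-(N ^ 2 * t ^ 2 / 2))) := by
    funext t
    simp [hf, hc, sum_range_succ]; ring
  have hi : ∀ n, IntegrableOn (fun t => c n * (t ^ (2 * n) * Real.exp (-(N ^ 2 * t ^ 2 / 2))))
      (Set.Ioi 0) := fun n => (integrableOn_gauss_moment hN n).const_mul _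
  have hfi : IntegrableOn f (Set.Ioi 0) := by
    rw [e]; exact integrable_finsetSum _ fun n _ => hi n
  have h1 : ∫ t in Set.Ioi (0 : ℝ), f t = Real.sqrt (Real.pi / 2) * (c₀ / N + c₁ / N ^ 3 +
      3 * c₂ / N ^ 5 + 15 * c₃ / N ^ 7 + 105 * c₄ / N ^ 9 + 945 * c₅ / N ^ 11) := by
    rw [e, MeasureTheory.integral_finsetSum _ fun n _ => hi n]
    simp_rw [MeasureTheory.integral_const_mul, integral_gauss_moment hN]
    simp [sum_range_succ, hc, Nat.doubleFactorial]; ring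
  rw [← h1, integral_of_le hT, ← Set.Ioc_union_Ioi_eq_Ioi hT,
    setIntegral_union Set.Ioc_disjoint_Ioi_same measurableSet_Ioi
      (hfi.mono_set Set.Ioc_subset_Ioi_self) (hfi.mono_set (Set.Ioi_subset_Ioi hT))]
  refine le_add_of_nonneg_right (setIntegral_nonneg measurableSet_Ioi fun t ht => ?_)
  exact mul_nonneg (h t (le_of_lt ht)) (Real.exp_pos _).le

lemma le_integral_poly_gauss {N T : ℝ} (hN : 0 < N) (hT : 0 ≤ T) (c₀ c₁ c₂ c₃ c₄ c₅ : ℝ)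
    (h : ∀ t, T ≤ t →
      c₀ + c₁ * t ^ 2 + c₂ * t ^ 4 + c₃ * t ^ 6 + c₄ * t ^ 8 + c₅ * t ^ 10 ≤ 0) :
    Real.sqrt (Real.pi / 2) * (c₀ / N + c₁ / N ^ 3 + 3 * c₂ / N ^ 5 + 15 * c₃ / N ^ 7 +
        105 * c₄ / N ^ 9 + 945 * c₅ / N ^ 11) ≤
    ∫ t in (0 : ℝ)..T, (c₀ + c₁ * t ^ 2 + c₂ * t ^ 4 + c₃ * t ^ 6 + c₄ * t ^ 8 + c₅ * t ^ 10) *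
      Real.exp (-(N ^ 2 * t ^ 2 / 2)) := by
  have := integral_poly_gauss_le hN hT (-c₀) (-c₁) (-c₂) (-c₃) (-c₄) (-c₅)
    (fun t ht => by linarith [h t ht])
  have e : ∀ t : ℝ, (-c₀ + -c₁ * t ^ 2 + -c₂ * t ^ 4 + -c₃ * t ^ 6 + -c₄ * t ^ 8 +
      -c₅ * t ^ 10) * Real.exp (-(N ^ 2 * t ^ 2 / 2)) =
      -((c₀ + c₁ * t ^ 2 + c₂ * t ^ 4 + c₃ * t ^ 6 + c₄ * t ^ 8 + c₅ * t ^ 10) *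
      Real.exp (-(N ^ 2 * t ^ 2 / 2))) := fun t => by ring
  simp_rw [e] at this
  rw [intervalIntegral.integral_neg] at this
  refine le_of_neg_le_neg (this.trans (le_of_eq ?_))
  ring

namespace WaveParams

variable {k : ℕ} {lam N a₃ a₄ a₅ T₁ T σ b s : ℝ}

lemma le_wave (P : WaveParams k lam N a₃ a₄ a₅ T₁ T σ b) (hs : 0 ≤ s) {u E : ℝ}
    (h1 : s ≤ a₃ * u - a₅ * u ^ 2) (h2 : s ≤ a₃ * T₁ ^ 2 - a₅ * (T₁ ^ 2) ^ 2)
    (hE : Real.exp (a₄ * u ^ 2) ≤ E) {t : ℝ} (ht : t ∈ Set.Icc 0 T₁) :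
    Real.exp (-(N ^ 2 * t ^ 2 / 2)) * (a₃ * t ^ 3 - (a₅ * t ^ 5 + E * s * t +
      a₃ ^ 3 * t ^ 9 / 6)) ≤ wave k lam s t := by
  obtain ⟨ht0, ht1⟩ := ht
  have ha3 := P.a₃_pos
  have ha4 := P.a₄_nonneg
  have ha5 := P.a₅_nonneg
  have hE1 : 1 ≤ E := (Real.one_le_exp (by positivity)).trans hE
  have hA1 := decay_le k P.lam_nonneg t
  have hA2 := le_decay k P.lam_nonneg ht0
  have hg1 := twist_le k s P.lam_nonneg ht0
  have hg2 := le_twist k s P.lam_nonneg ht0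
  have hψ := twist_add_nonneg k s P.lam_nonneg ht0
  rw [← P.N_sq] at hA1 hA2
  rw [← P.a₄_eq] at hA2
  rw [← P.a₃_eq] at hg1 hg2
  rw [← P.a₅_eq] at hg2
  set G := Real.exp (-(N ^ 2 * t ^ 2 / 2))
  have hG : 0 < G := Real.exp_pos _
  set g := twist k lam s t with hg
  have hc : a₃ * t ^ 3 ≤ 3 := by
    rw [← P.cube]; gcongr
  rw [wave, ← hg]
  by_cases h0 : 0 ≤ g
  · have hst : 0 ≤ s * t := by positivity
    have hgpi : g ≤ Real.pi := by linarith [Real.pi_gt_three]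
    have hsin := Real.sin_nonneg_of_nonneg_of_le_pi h0 hgpi
    have hsin2 := Real.sin_ge_sub_cube h0
    have hg3 : g ^ 3 ≤ (a₃ * t ^ 3) ^ 3 := by
      gcongr; linarith
    have hEst : s * t ≤ E * s * t := by nlinarith
    calc _ ≤ G * Real.sin g := by
          refine mul_le_mul_of_nonneg_left ?_ hG.le
          have e : (a₃ * t ^ 3) ^ 3 = a₃ ^ 3 * t ^ 9 := by ring
          linarith
      _ ≤ _ := by
          refine mul_le_mul_of_nonneg_right (Real.exp_le_exp.2 ?_) hsin
          linarith
  · have h0 := not_le.1 h0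
    have htu : t ^ 2 ≤ u := by
      by_contra hcon
      have hcon := not_le.1 hcon
      have h3 : t ^ 2 ≤ T₁ ^ 2 := by gcongr
      have h4 : s ≤ a₃ * t ^ 2 - a₅ * (t ^ 2) ^ 2 := by
        rcases eq_or_lt_of_le h3 with h3 | h3
        · rw [h3]; exact h2
        · have hd : 0 < T₁ ^ 2 - u := by linarith
          refine le_of_mul_le_mul_left ?_ hd
          have e1 := mul_le_mul_of_nonneg_left h1 (sub_nonneg.2 h3.le)
          have e2 := mul_le_mul_of_nonneg_left h2 (sub_nonneg.2 hcon.le)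
          have e3 : 0 ≤ a₅ * ((T₁ ^ 2 - u) * ((t ^ 2 - u) * (T₁ ^ 2 - t ^ 2))) :=
            mul_nonneg ha5 (mul_nonneg hd.le (mul_nonneg (sub_nonneg.2 hcon.le)
              (sub_nonneg.2 h3.le)))
          linarith
      have h5 := mul_le_mul_of_nonneg_right h4 ht0
      have : 0 ≤ g := by
        calc 0 ≤ (a₃ * t ^ 2 - a₅ * (t ^ 2) ^ 2) * t - s * t := by linarith
          _ = a₃ * t ^ 3 - a₅ * t ^ 5 - s * t := by ring
          _ ≤ g := hg2
      linarith
    have hsin : g ≤ Real.sin g := by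
      have := Real.sin_le (x := -g) (by linarith)
      rw [Real.sin_neg] at this; linarith
    have hexp : Real.exp (-decay k lam t) ≤ G * E := by
      calc _ ≤ Real.exp (-(N ^ 2 * t ^ 2 / 2) + a₄ * u ^ 2) := by
            refine Real.exp_le_exp.2 ?_
            have : a₄ * t ^ 4 ≤ a₄ * u ^ 2 := by
              refine mul_le_mul_of_nonneg_left ?_ ha4
              calc t ^ 4 = (t ^ 2) ^ 2 := by ring
                _ ≤ u ^ 2 := by gcongr
            linarith
        _ = G * Real.exp (a₄ * u ^ 2) := Real.exp_add _ _
        _ ≤ G * E := by gcongr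
    calc _ ≤ G * (E * g) := by
          refine mul_le_mul_of_nonneg_left ?_ hG.le
          have h9 : 0 ≤ a₃ ^ 3 * t ^ 9 / 6 := by positivity
          have hm : g + s * t ≤ E * (g + s * t) := by nlinarith
          linarith
      _ = (G * E) * g := by ring
      _ ≤ Real.exp (-decay k lam t) * g := mul_le_mul_of_nonpos_right hexp h0.le
      _ ≤ _ := mul_le_mul_of_nonneg_left hsin (Real.exp_pos _).le

lemma wave_le (P : WaveParams k lam N a₃ a₄ a₅ T₁ T σ b) (hs : 0 ≤ s) (hs3 : s * T₁ ≤ 3)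
    {X κ : ℝ} (hX0 : 0 < X) (hX : a₄ * T₁ ^ 4 ≤ X) (hκ : Real.exp X ≤ 1 + κ * X)
    {t : ℝ} (ht : t ∈ Set.Icc 0 T₁) :
    wave k lam s t ≤ Real.exp (-(N ^ 2 * t ^ 2 / 2)) *
      (a₃ * t ^ 3 * (1 + κ * a₄ * t ^ 4) + (s * t) ^ 3 / 6 - s * t) := by
  obtain ⟨ht0, ht1⟩ := ht
  have ha3 := P.a₃_pos
  have ha4 := P.a₄_nonneg
  have hA1 := decay_le k P.lam_nonneg t
  have hA2 := le_decay k P.lam_nonneg ht0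
  have hg1 := twist_le k s P.lam_nonneg ht0
  have hψ := twist_add_nonneg k s P.lam_nonneg ht0
  rw [← P.N_sq] at hA1 hA2
  rw [← P.a₄_eq] at hA2
  rw [← P.a₃_eq] at hg1
  set G := Real.exp (-(N ^ 2 * t ^ 2 / 2))
  have hG : 0 < G := Real.exp_pos _
  set g := twist k lam s t with hg
  have hst : 0 ≤ s * t := by positivity
  set x := a₄ * t ^ 4 with hx
  have hx0 : 0 ≤ x := by positivity
  have hxX : x ≤ X := le_trans (by rw [hx]; gcongr) hX
  have hex : Real.exp x ≤ 1 + κ * x := by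
    have h := convexOn_exp.2 (Set.mem_univ 0) (Set.mem_univ X)
      (sub_nonneg.2 ((div_le_one hX0).2 hxX)) (div_nonneg hx0 hX0.le) (by ring)
    simp only [smul_eq_mul, mul_zero, zero_add, Real.exp_zero, mul_one,
      div_mul_cancel₀ x hX0.ne'] at h
    have h2 := mul_le_mul_of_nonneg_left hκ (div_nonneg hx0 hX0.le)
    have e : x / X * (1 + κ * X) = x / X + κ * x := by field_simp
    linarith
  have hκ1 : 0 ≤ κ * x := by linarith [Real.one_le_exp hx0]
  have e4 : κ * a₄ * t ^ 4 = κ * x := by rw [hx]; ring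
  rw [wave, ← hg, e4]
  by_cases h0 : 0 ≤ g
  · have hexp : Real.exp (-decay k lam t) ≤ G * (1 + κ * x) := by
      calc _ ≤ Real.exp (-(N ^ 2 * t ^ 2 / 2) + x) := Real.exp_le_exp.2 (by linarith)
        _ = G * Real.exp x := Real.exp_add _ _
        _ ≤ _ := by gcongr
    calc _ ≤ Real.exp (-decay k lam t) * g :=
          mul_le_mul_of_nonneg_left (Real.sin_le h0) (Real.exp_pos _).le
      _ ≤ G * (1 + κ * x) * g := by gcongr
      _ = G * ((1 + κ * x) * g) := by ring
      _ ≤ _ := by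
          refine mul_le_mul_of_nonneg_left ?_ hG.le
          have h3 : 0 ≤ (s * t) ^ 3 / 6 := by positivity
          nlinarith [mul_nonneg hκ1 hst]
  · have h0 := not_le.1 h0
    have hgs : -g ≤ s * t := by linarith
    have hs3' : s * t ≤ 3 := le_trans (by gcongr) hs3
    have hsin := Real.sin_nonneg_of_nonneg_of_le_pi (x := -g) (by linarith)
      (by linarith [Real.pi_gt_three])
    have hsin2 := Real.sin_ge_sub_cube (x := -g) (by linarith)
    rw [Real.sin_neg] at hsin hsin2
    have hg3 : (-g) ^ 3 ≤ (s * t) ^ 3 := by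
      have : 0 ≤ -g := by linarith
      gcongr
    calc _ ≤ G * Real.sin g := by
          refine mul_le_mul_of_nonpos_right (Real.exp_le_exp.2 (by linarith)) (by linarith)
      _ ≤ _ := by
          refine mul_le_mul_of_nonneg_left ?_ hG.le
          have h3 : 0 ≤ a₃ * t ^ 3 * (κ * x) := by positivity
          linarith

lemma abs_wave_le (P : WaveParams k lam N a₃ a₄ a₅ T₁ T σ b) {t : ℝ} (ht : t ∈ Set.Icc T₁ T) :
    |wave k lam s t| ≤ Real.exp (-(N ^ 2 * T₁ ^ 2 / 2 - a₄ * T₁ ^ 4)) *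
      Real.exp (-(σ * N ^ 2) * (t ^ 2 - T₁ ^ 2)) := by
  have h0 := P.T₁_pos
  have ht0 : 0 ≤ t := h0.le.trans ht.1
  have hA := le_decay k P.lam_nonneg ht0
  rw [← P.N_sq, ← P.a₄_eq] at hA
  rw [wave, abs_mul, abs_of_pos (Real.exp_pos _), ← Real.exp_add]
  refine (mul_le_of_le_one_right (Real.exp_pos _).le (Real.abs_sin_le_one _)).trans
    (Real.exp_le_exp.2 ?_)
  have hd : 0 ≤ t ^ 2 - T₁ ^ 2 := by nlinarith [ht.1]
  have h1 := mul_le_mul_of_nonneg_right P.σ_le hd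
  have h2 : 0 ≤ a₄ * ((t ^ 2 - T₁ ^ 2) * (T ^ 2 - t ^ 2)) := by
    refine mul_nonneg P.a₄_nonneg (mul_nonneg hd ?_)
    nlinarith [ht.2]
  linarith

lemma integral_tail (P : WaveParams k lam N a₃ a₄ a₅ T₁ T σ b) {f : ℝ → ℝ}
    {C : ℝ} (hC : 0 ≤ C) (hf : IntervalIntegrable f volume T₁ T)
    (h : ∀ t ∈ Set.Icc T₁ T, |f t| ≤ |wave k lam s t| * (C * t)) :
    |∫ t in T₁..T, f t| ≤
      C * (Real.exp (-(N ^ 2 * T₁ ^ 2 / 2 - a₄ * T₁ ^ 4)) / (2 * σ * N ^ 2)) := by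
  have hσ := P.σ_pos
  have hN := P.N_pos
  set K := Real.exp (-(N ^ 2 * T₁ ^ 2 / 2 - a₄ * T₁ ^ 4))
  have hd : ∀ t ∈ Set.uIcc T₁ T, HasDerivAt
      (fun t => -(C * K / (2 * σ * N ^ 2)) * Real.exp (-(σ * N ^ 2) * (t ^ 2 - T₁ ^ 2)))
      (C * K * t * Real.exp (-(σ * N ^ 2) * (t ^ 2 - T₁ ^ 2))) t := fun t _ => by
    have h1 := ((((hasDerivAt_pow 2 t).sub_const (T₁ ^ 2)).const_mul (-(σ * N ^ 2))).exp).const_mul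
      (-(C * K / (2 * σ * N ^ 2)))
    refine h1.congr_deriv ?_
    field_simp
    push_cast; ring
  have hi : IntervalIntegrable (fun t => C * K * t *
      Real.exp (-(σ * N ^ 2) * (t ^ 2 - T₁ ^ 2))) volume T₁ T :=
    (by fun_prop : Continuous fun t : ℝ => C * K * t *
      Real.exp (-(σ * N ^ 2) * (t ^ 2 - T₁ ^ 2))).intervalIntegrable _ _
  have h2 := integral_eq_sub_of_hasDerivAt hd hi
  have h3 : |∫ t in T₁..T, f t| ≤ ∫ t in T₁..T, |f t| := abs_integral_le_integral_abs P.T₁_le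
  refine (h3.trans (integral_mono_on P.T₁_le hf.abs hi fun t ht => ?_)).trans (h2.le.trans ?_)
  · have ht0 : 0 ≤ t := P.T₁_pos.le.trans ht.1
    refine (h t ht).trans ?_
    calc _ ≤ (K * Real.exp (-(σ * N ^ 2) * (t ^ 2 - T₁ ^ 2))) * (C * t) := by
          gcongr; exact P.abs_wave_le ht
      _ = _ := by ring
  · simp only [sub_self, mul_zero, Real.exp_zero, mul_one]
    have : 0 ≤ C * K / (2 * σ * N ^ 2) * Real.exp (-(σ * N ^ 2) * (T ^ 2 - T₁ ^ 2)) := by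
      positivity
    rw [mul_div_assoc] at this ⊢
    linarith

end WaveParams

end PoissonK
namespace PoissonK

open Finset MeasureTheory intervalIntegral

lemma half_sub_le_sin {t : ℝ} (ht : 0 ≤ t) : t / 2 - t ^ 3 / 48 ≤ Real.sin (t / 2) := by
  have := Real.sin_ge_sub_cube (x := t / 2) (by linarith)
  linarith [this, show (t / 2) ^ 3 / 6 = t ^ 3 / 48 by ring]

lemma sin_half_le {t : ℝ} (ht : 0 ≤ t) : Real.sin (t / 2) ≤ t / 2 := Real.sin_le (by linarith)

namespace WaveParams

variable {k : ℕ} {lam N a₃ a₄ a₅ T₁ T σ b s : ℝ}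

lemma one_le_b (P : WaveParams k lam N a₃ a₄ a₅ T₁ T σ b) : 1 ≤ b := by
  have h := P.one_le
  have hT : T ^ 2 ≤ 3.15 ^ 2 := by
    have := P.T_le.trans Real.pi_lt_d2.le
    have := P.T₁_pos.trans_le P.T₁_le
    gcongr
  nlinarith [sq_nonneg T]

lemma half_le_mul_sin (P : WaveParams k lam N a₃ a₄ a₅ T₁ T σ b) {t : ℝ}
    (ht : t ∈ Set.Icc 0 T) : t / 2 ≤ b * Real.sin (t / 2) := by
  have h1 := half_sub_le_sin ht.1
  have hb := P.one_le_b
  have h2 : t ^ 2 ≤ T ^ 2 := by have := ht.1; have := ht.2; gcongr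
  calc t / 2 ≤ t / 2 * (b * (1 - t ^ 2 / 24)) := by
        refine le_mul_of_one_le_right (by linarith [ht.1]) (P.one_le.trans ?_)
        gcongr
    _ = b * (t / 2 - t ^ 3 / 48) := by ring
    _ ≤ _ := by gcongr

lemma intervalIntegrable_mul (k : ℕ) (lam s x y : ℝ) :
    IntervalIntegrable (fun t => wave k lam s t * Real.sin (t / 2)) volume x y := by
  have := continuous_wave k lam s
  exact (by fun_prop : Continuous fun t => wave k lam s t * Real.sin (t / 2)).intervalIntegrable _ _

lemma abs_integral_mul_tail_le (P : WaveParams k lam N a₃ a₄ a₅ T₁ T σ b) :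
    |∫ t in T₁..T, wave k lam s t * Real.sin (t / 2)| ≤
      Real.exp (-(N ^ 2 * T₁ ^ 2 / 2 - a₄ * T₁ ^ 4)) / (4 * σ * N ^ 2) := by
  have := P.integral_tail (C := 1 / 2) (by norm_num) (intervalIntegrable_mul k lam s T₁ T)
    (s := s) (fun t ht => by
      rw [abs_mul]
      have ht0 : 0 ≤ t := P.T₁_pos.le.trans ht.1
      have h := Real.abs_sin_le_abs (x := t / 2)
      rw [abs_of_nonneg (by linarith : 0 ≤ t / 2)] at h
      have : |Real.sin (t / 2)| ≤ 1 / 2 * t := by linarith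
      gcongr)
  refine this.trans (le_of_eq ?_)
  have hσ := P.σ_pos
  have hN := P.N_pos
  field_simp; norm_num

lemma abs_integral_div_tail_le (P : WaveParams k lam N a₃ a₄ a₅ T₁ T σ b)
    (hi : IntervalIntegrable (fun t => wave k lam s t / Real.sin (t / 2)) volume 0 Real.pi) :
    |∫ t in T₁..T, wave k lam s t / Real.sin (t / 2)| ≤
      b * Real.exp (-(N ^ 2 * T₁ ^ 2 / 2 - a₄ * T₁ ^ 4)) / (T₁ ^ 2 * σ * N ^ 2) := by
  have h0 := P.T₁_pos
  have hT := P.T₁_le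
  have hb := P.one_le_b
  have hi' : IntervalIntegrable (fun t => wave k lam s t / Real.sin (t / 2)) volume T₁ T := by
    refine hi.mono_set ?_
    rw [Set.uIcc_of_le hT, Set.uIcc_of_le Real.pi_pos.le]
    exact Set.Icc_subset_Icc h0.le P.T_le
  have := P.integral_tail (C := 2 * b / T₁ ^ 2) (by positivity) hi'
    (s := s) (fun t ht => by
      have ht0 : 0 < t := h0.trans_le ht.1
      have hs := sin_half_pos ⟨ht0, ht.2.trans P.T_le⟩
      have h := P.half_le_mul_sin ⟨ht0.le, ht.2⟩
      rw [abs_div, abs_of_pos hs, div_le_iff₀ hs, mul_assoc]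
      refine le_mul_of_one_le_right (abs_nonneg _) ?_
      rw [div_mul_eq_mul_div, div_mul_eq_mul_div, le_div_iff₀ (by positivity), one_mul]
      calc T₁ ^ 2 ≤ t ^ 2 := by gcongr; exact ht.1
        _ = 2 * (t / 2) * t := by ring
        _ ≤ 2 * (b * Real.sin (t / 2)) * t := by gcongr
        _ = _ := by ring)
  refine this.trans (le_of_eq ?_)
  have hσ := P.σ_pos
  have hN := P.N_pos
  field_simp

lemma le_integral_mul (P : WaveParams k lam N a₃ a₄ a₅ T₁ T σ b) (hs : 0 ≤ s) {u E : ℝ}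
    (h1 : s ≤ a₃ * u - a₅ * u ^ 2) (h2 : s ≤ a₃ * T₁ ^ 2 - a₅ * (T₁ ^ 2) ^ 2)
    (hE : Real.exp (a₄ * u ^ 2) ≤ E) :
    Real.sqrt (Real.pi / 2) * (-(E * s / 2) / N ^ 3 + 3 * (a₃ / 2) / N ^ 5 +
        15 * (-(a₃ / 48) - a₅ / 2) / N ^ 7 + 945 * (-(a₃ ^ 3 / 12)) / N ^ 11) -
      Real.exp (-(N ^ 2 * T₁ ^ 2 / 2 - a₄ * T₁ ^ 4)) / (4 * σ * N ^ 2) ≤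
    ∫ t in (0 : ℝ)..T, wave k lam s t * Real.sin (t / 2) := by
  have h0 := P.T₁_pos
  have ha3 := P.a₃_pos
  have ha5 := P.a₅_nonneg
  have hE0 : 0 ≤ E := (Real.exp_pos _).le.trans hE
  rw [← integral_add_adjacent_intervals (intervalIntegrable_mul k lam s 0 T₁)
    (intervalIntegrable_mul k lam s T₁ T)]
  have h3 := P.abs_integral_mul_tail_le (s := s)
  have h4 := le_integral_poly_gauss P.N_pos h0.le 0 (-(E * s / 2)) (a₃ / 2)
    (-(a₃ / 48) - a₅ / 2) 0 (-(a₃ ^ 3 / 12)) (fun t ht => by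
      have ht0 : 0 ≤ t := h0.le.trans ht
      have h5 : 9 ≤ (a₃ * t ^ 3) ^ 2 := by
        have : a₃ * T₁ ^ 3 ≤ a₃ * t ^ 3 := by gcongr
        rw [P.cube] at this; nlinarith
      have h6 : a₃ / 2 * t ^ 4 * 9 ≤ a₃ / 2 * t ^ 4 * (a₃ * t ^ 3) ^ 2 := by gcongr
      have h7 : 0 ≤ E * s / 2 * t ^ 2 := by positivity
      have h8 : 0 ≤ (a₃ / 48 + a₅ / 2) * t ^ 6 := by positivity
      have h9 : 0 ≤ a₃ / 2 * t ^ 4 := by positivity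
      have e : a₃ / 2 * t ^ 4 * (a₃ * t ^ 3) ^ 2 = 6 * (a₃ ^ 3 / 12 * t ^ 10) := by ring
      linarith)
  have h5 := integral_mono_on h0.le ((by fun_prop : Continuous fun t : ℝ =>
    (0 + (-(E * s / 2)) * t ^ 2 + a₃ / 2 * t ^ 4 + (-(a₃ / 48) - a₅ / 2) * t ^ 6 + 0 * t ^ 8 +
      (-(a₃ ^ 3 / 12)) * t ^ 10) * Real.exp (-(N ^ 2 * t ^ 2 / 2))).intervalIntegrable 0 T₁)
    (intervalIntegrable_mul k lam s 0 T₁) (fun t ht => by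
      have hw := P.le_wave hs h1 h2 hE ht
      have hs1 := half_sub_le_sin ht.1
      have hs2 := sin_half_le ht.1
      have hs0 := Real.sin_nonneg_of_nonneg_of_le_pi (x := t / 2) (by linarith [ht.1])
        (by linarith [ht.2, P.T₁_le, P.T_le, Real.pi_pos])
      refine le_trans ?_ (mul_le_mul_of_nonneg_right hw hs0)
      rw [mul_comm, mul_assoc]
      refine mul_le_mul_of_nonneg_left ?_ (Real.exp_pos _).le
      have ht0 := ht.1
      have h6 := mul_le_mul_of_nonneg_left hs1 (show 0 ≤ a₃ * t ^ 3 by positivity)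
      have h7 := mul_le_mul_of_nonneg_left hs2
        (show 0 ≤ a₅ * t ^ 5 + E * s * t + a₃ ^ 3 * t ^ 9 / 6 by positivity)
      linarith)
  have := h4.trans h5
  rw [abs_le] at h3
  simp only [zero_div, mul_zero, zero_add, add_zero] at this
  linarith [h3.1]

lemma integral_mul_le (P : WaveParams k lam N a₃ a₄ a₅ T₁ T σ b) (hs : 0 ≤ s)
    (hs3 : s * T₁ ≤ 3) (hsa : s ≤ a₃ * T₁ ^ 2)
    {X κ : ℝ} (hX0 : 0 < X) (hX : a₄ * T₁ ^ 4 ≤ X) (hκ0 : 0 ≤ κ) (hκ : Real.exp X ≤ 1 + κ * X) :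
    ∫ t in (0 : ℝ)..T, wave k lam s t * Real.sin (t / 2) ≤
    Real.sqrt (Real.pi / 2) * (-(s / 2) / N ^ 3 + 3 * (a₃ / 2 + s ^ 3 / 12 + s / 48) / N ^ 5 +
        105 * (a₃ * κ * a₄ / 2) / N ^ 9) +
      Real.exp (-(N ^ 2 * T₁ ^ 2 / 2 - a₄ * T₁ ^ 4)) / (4 * σ * N ^ 2) := by
  have h0 := P.T₁_pos
  have ha3 := P.a₃_pos
  have ha4 := P.a₄_nonneg
  rw [← integral_add_adjacent_intervals (intervalIntegrable_mul k lam s 0 T₁)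
    (intervalIntegrable_mul k lam s T₁ T)]
  have h3 := P.abs_integral_mul_tail_le (s := s)
  have h4 := integral_poly_gauss_le P.N_pos h0.le 0 (-(s / 2)) (a₃ / 2 + s ^ 3 / 12 + s / 48)
    0 (a₃ * κ * a₄ / 2) 0 (fun t ht => by
      have ht0 : 0 ≤ t := h0.le.trans ht
      have h5 : s * t ^ 2 ≤ a₃ * t ^ 2 * t ^ 2 := by
        refine mul_le_mul_of_nonneg_right (hsa.trans ?_) (by positivity)
        gcongr
      have h6 : 0 ≤ (s ^ 3 / 12 + s / 48) * t ^ 4 := by positivity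
      have h7 : 0 ≤ a₃ * κ * a₄ / 2 * t ^ 8 := by positivity
      linarith)
  have h5 := integral_mono_on h0.le (intervalIntegrable_mul k lam s 0 T₁)
    ((by fun_prop : Continuous fun t : ℝ =>
    (0 + (-(s / 2)) * t ^ 2 + (a₃ / 2 + s ^ 3 / 12 + s / 48) * t ^ 4 + 0 * t ^ 6 +
      a₃ * κ * a₄ / 2 * t ^ 8 + 0 * t ^ 10) *
      Real.exp (-(N ^ 2 * t ^ 2 / 2))).intervalIntegrable 0 T₁) (fun t ht => by
      have hw := P.wave_le hs hs3 hX0 hX hκ ht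
      have hs1 := half_sub_le_sin ht.1
      have hs2 := sin_half_le ht.1
      have hs0 := Real.sin_nonneg_of_nonneg_of_le_pi (x := t / 2) (by linarith [ht.1])
        (by linarith [ht.2, P.T₁_le, P.T_le, Real.pi_pos])
      refine (mul_le_mul_of_nonneg_right hw hs0).trans ?_
      rw [mul_assoc, mul_comm _ (Real.exp _)]
      refine mul_le_mul_of_nonneg_left ?_ (Real.exp_pos _).le
      have ht0 := ht.1
      have h6 := mul_le_mul_of_nonneg_left hs1 (show 0 ≤ s * t by positivity)
      have h7 := mul_le_mul_of_nonneg_left hs2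
        (show 0 ≤ a₃ * t ^ 3 * (1 + κ * a₄ * t ^ 4) + (s * t) ^ 3 / 6 by positivity)
      linarith)
  have := h5.trans h4
  rw [abs_le] at h3
  simp only [zero_div, mul_zero, zero_add, add_zero] at this
  linarith [h3.2]

lemma le_integral_div (P : WaveParams k lam N a₃ a₄ a₅ T₁ T σ b) (hs : 0 ≤ s) {u E : ℝ}
    (hi : IntervalIntegrable (fun t => wave k lam s t / Real.sin (t / 2)) volume 0 Real.pi)
    (h1 : s ≤ a₃ * u - a₅ * u ^ 2) (h2 : s ≤ a₃ * T₁ ^ 2 - a₅ * (T₁ ^ 2) ^ 2)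
    (hE : Real.exp (a₄ * u ^ 2) ≤ E) :
    Real.sqrt (Real.pi / 2) * (-(2 * b * E * s) / N + 2 * a₃ / N ^ 3 +
        3 * (-(2 * b * a₅)) / N ^ 5 + 105 * (-(b * a₃ ^ 3 / 3)) / N ^ 9) -
      b * Real.exp (-(N ^ 2 * T₁ ^ 2 / 2 - a₄ * T₁ ^ 4)) / (T₁ ^ 2 * σ * N ^ 2) ≤
    ∫ t in (0 : ℝ)..T, wave k lam s t / Real.sin (t / 2) := by
  have h0 := P.T₁_pos
  have ha3 := P.a₃_pos
  have ha5 := P.a₅_nonneg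
  have hb := P.one_le_b
  have hE0 : 0 ≤ E := (Real.exp_pos _).le.trans hE
  have hi1 : IntervalIntegrable (fun t => wave k lam s t / Real.sin (t / 2)) volume 0 T₁ := by
    refine hi.mono_set ?_
    rw [Set.uIcc_of_le h0.le, Set.uIcc_of_le Real.pi_pos.le]
    exact Set.Icc_subset_Icc le_rfl (P.T₁_le.trans P.T_le)
  have hi2 : IntervalIntegrable (fun t => wave k lam s t / Real.sin (t / 2)) volume T₁ T := by
    refine hi.mono_set ?_
    rw [Set.uIcc_of_le P.T₁_le, Set.uIcc_of_le Real.pi_pos.le]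
    exact Set.Icc_subset_Icc h0.le P.T_le
  rw [← integral_add_adjacent_intervals hi1 hi2]
  have h3 := P.abs_integral_div_tail_le hi
  have h4 := le_integral_poly_gauss P.N_pos h0.le (-(2 * b * E * s)) (2 * a₃)
    (-(2 * b * a₅)) 0 (-(b * a₃ ^ 3 / 3)) 0 (fun t ht => by
      have ht0 : 0 ≤ t := h0.le.trans ht
      have h5 : 9 ≤ (a₃ * t ^ 3) ^ 2 := by
        have : a₃ * T₁ ^ 3 ≤ a₃ * t ^ 3 := by gcongr
        rw [P.cube] at this; nlinarith
      have h6 : 2 * a₃ * t ^ 2 * (1 * 9) ≤ 2 * a₃ * t ^ 2 * (b * (a₃ * t ^ 3) ^ 2) := by gcongr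
      have h7 : 0 ≤ 2 * b * E * s := by positivity
      have h8 : 0 ≤ 2 * b * a₅ * t ^ 4 := by positivity
      have h9 : 0 ≤ 2 * a₃ * t ^ 2 := by positivity
      have e : 2 * a₃ * t ^ 2 * (b * (a₃ * t ^ 3) ^ 2) = 6 * (b * a₃ ^ 3 / 3 * t ^ 8) := by ring
      linarith)
  have h5 := integral_mono_on_of_le_Ioo h0.le ((by fun_prop : Continuous fun t : ℝ =>
    (-(2 * b * E * s) + 2 * a₃ * t ^ 2 + -(2 * b * a₅) * t ^ 4 + 0 * t ^ 6 +
      -(b * a₃ ^ 3 / 3) * t ^ 8 + 0 * t ^ 10) *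
      Real.exp (-(N ^ 2 * t ^ 2 / 2))).intervalIntegrable 0 T₁) hi1 (fun t ht => by
      have ht' : t ∈ Set.Icc 0 T₁ := ⟨ht.1.le, ht.2.le⟩
      have hw := P.le_wave hs h1 h2 hE ht'
      have hs0 := sin_half_pos ⟨ht.1, ht.2.le.trans (P.T₁_le.trans P.T_le)⟩
      have hs2 := sin_half_le ht.1.le
      have hs1 := P.half_le_mul_sin ⟨ht.1.le, ht.2.le.trans P.T₁_le⟩
      rw [le_div_iff₀ hs0]
      refine le_trans ?_ hw
      rw [mul_comm _ (Real.exp _), mul_assoc]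
      refine mul_le_mul_of_nonneg_left ?_ (Real.exp_pos _).le
      have ht0 := ht.1
      have h6 := mul_le_mul_of_nonneg_left hs2 (show 0 ≤ 2 * a₃ * t ^ 2 by positivity)
      have h7 := mul_le_mul_of_nonneg_left hs1
        (show 0 ≤ 2 * E * s + 2 * a₅ * t ^ 4 + a₃ ^ 3 * t ^ 8 / 3 by positivity)
      linarith)
  have := h4.trans h5
  rw [abs_le] at h3
  simp only [zero_div, mul_zero, add_zero] at this
  linarith [h3.1]

lemma integral_div_le (P : WaveParams k lam N a₃ a₄ a₅ T₁ T σ b) (hs : 0 ≤ s)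
    (hi : IntervalIntegrable (fun t => wave k lam s t / Real.sin (t / 2)) volume 0 Real.pi)
    (hs3 : s * T₁ ≤ 3) (hsa : s ≤ a₃ * T₁ ^ 2)
    {X κ : ℝ} (hX0 : 0 < X) (hX : a₄ * T₁ ^ 4 ≤ X) (hκ0 : 0 ≤ κ) (hκ : Real.exp X ≤ 1 + κ * X) :
    ∫ t in (0 : ℝ)..T, wave k lam s t / Real.sin (t / 2) ≤
    Real.sqrt (Real.pi / 2) * (-(2 * s) / N + 2 * b * (a₃ + s ^ 3 / 6) / N ^ 3 +
        15 * (2 * b * a₃ * κ * a₄) / N ^ 7) +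
      b * Real.exp (-(N ^ 2 * T₁ ^ 2 / 2 - a₄ * T₁ ^ 4)) / (T₁ ^ 2 * σ * N ^ 2) := by
  have h0 := P.T₁_pos
  have ha3 := P.a₃_pos
  have ha4 := P.a₄_nonneg
  have hb := P.one_le_b
  have hi1 : IntervalIntegrable (fun t => wave k lam s t / Real.sin (t / 2)) volume 0 T₁ := by
    refine hi.mono_set ?_
    rw [Set.uIcc_of_le h0.le, Set.uIcc_of_le Real.pi_pos.le]
    exact Set.Icc_subset_Icc le_rfl (P.T₁_le.trans P.T_le)
  have hi2 : IntervalIntegrable (fun t => wave k lam s t / Real.sin (t / 2)) volume T₁ T := by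
    refine hi.mono_set ?_
    rw [Set.uIcc_of_le P.T₁_le, Set.uIcc_of_le Real.pi_pos.le]
    exact Set.Icc_subset_Icc h0.le P.T_le
  rw [← integral_add_adjacent_intervals hi1 hi2]
  have h3 := P.abs_integral_div_tail_le hi
  have h4 := integral_poly_gauss_le P.N_pos h0.le (-(2 * s)) (2 * b * (a₃ + s ^ 3 / 6))
    0 (2 * b * a₃ * κ * a₄) 0 0 (fun t ht => by
      have ht0 : 0 ≤ t := h0.le.trans ht
      have h5 : 2 * s * 1 ≤ 2 * (a₃ * t ^ 2) * b := by
        have : a₃ * T₁ ^ 2 ≤ a₃ * t ^ 2 := by gcongr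
        gcongr; exact hsa.trans this
      have h6 : 0 ≤ 2 * b * (s ^ 3 / 6) * t ^ 2 := by positivity
      have h7 : 0 ≤ 2 * b * a₃ * κ * a₄ * t ^ 6 := by positivity
      linarith)
  have h5 := integral_mono_on_of_le_Ioo h0.le hi1 ((by fun_prop : Continuous fun t : ℝ =>
    (-(2 * s) + 2 * b * (a₃ + s ^ 3 / 6) * t ^ 2 + 0 * t ^ 4 + 2 * b * a₃ * κ * a₄ * t ^ 6 +
      0 * t ^ 8 + 0 * t ^ 10) *
      Real.exp (-(N ^ 2 * t ^ 2 / 2))).intervalIntegrable 0 T₁) (fun t ht => by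
      have ht' : t ∈ Set.Icc 0 T₁ := ⟨ht.1.le, ht.2.le⟩
      have hw := P.wave_le hs hs3 hX0 hX hκ ht'
      have hs0 := sin_half_pos ⟨ht.1, ht.2.le.trans (P.T₁_le.trans P.T_le)⟩
      have hs2 := sin_half_le ht.1.le
      have hs1 := P.half_le_mul_sin ⟨ht.1.le, ht.2.le.trans P.T₁_le⟩
      rw [div_le_iff₀ hs0]
      refine hw.trans ?_
      rw [mul_comm _ (Real.exp _), mul_assoc (Real.exp _)]
      refine mul_le_mul_of_nonneg_left ?_ (Real.exp_pos _).le
      have ht0 := ht.1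
      have h6 := mul_le_mul_of_nonneg_left hs2 (show 0 ≤ 2 * s by positivity)
      have h7 := mul_le_mul_of_nonneg_left hs1
        (show 0 ≤ 2 * (a₃ * t ^ 2 * (1 + κ * a₄ * t ^ 4) + s ^ 3 * t ^ 2 / 6) by positivity)
      linarith)
  have := h5.trans h4
  rw [abs_le] at h3
  simp only [zero_div, mul_zero, add_zero] at this
  linarith [h3.2]

end WaveParams

end PoissonK
namespace PoissonK

open Finset MeasureTheory intervalIntegral

lemma five_quarters_le_sqrt : 5 / 4 ≤ Real.sqrt (Real.pi / 2) := by
  apply Real.le_sqrt_of_sq_le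
  linarith [Real.pi_gt_d2]

lemma rate_le {k : ℕ} (hk : 2 ≤ k) {lam : ℝ} (hlam : 0 ≤ lam) :
    lam * ((1 / Real.sin (Real.pi / (k + 1 / 2)) - 1) / 2) ≤ k * lam / 6 := by
  obtain ⟨hT0, hTpi⟩ := cutoff_mem hk
  set K : ℝ := k + 1 / 2 with hK
  have hK2 : 5 / 2 ≤ K := by
    have : (2 : ℝ) ≤ k := by exact_mod_cast hk
    linarith
  have hK0 : 0 < K := by linarith
  have hsin : 3.14 / K * (1 - 1.654 / K ^ 2) ≤ Real.sin (Real.pi / K) := by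
    refine le_trans ?_ (Real.sin_ge_sub_cube hT0.le)
    have e : Real.pi / K - (Real.pi / K) ^ 3 / 6 = Real.pi / K * (1 - Real.pi ^ 2 / 6 / K ^ 2) := by
      field_simp
    rw [e]
    have hpi : Real.pi ^ 2 / 6 ≤ 1.654 := by
      nlinarith [Real.pi_lt_d2, Real.pi_pos]
    have h1 : 0 ≤ 1 - 1.654 / K ^ 2 := by
      rw [sub_nonneg, div_le_one (by positivity)]; nlinarith
    have h2 : Real.pi ^ 2 / 6 / K ^ 2 ≤ 1.654 / K ^ 2 := by gcongr
    have h3 : 3.14 / K ≤ Real.pi / K := by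
      gcongr; linarith [Real.pi_gt_d2]
    exact mul_le_mul h3 (by linarith) h1 (by positivity)
  have hkey : 1 ≤ (1 + k / 3) * (3.14 / K * (1 - 1.654 / K ^ 2)) := by
    have e : (1 + k / 3) * (3.14 / K * (1 - 1.654 / K ^ 2)) =
        (5 / 2 + K) / 3 * 3.14 * (K ^ 2 - 1.654) / K ^ 3 := by
      rw [hK]; field_simp; ring
    rw [e, le_div_iff₀ (by positivity)]
    nlinarith [mul_nonneg (sub_nonneg.2 hK2) (sub_nonneg.2 hK2), mul_pos hK0 hK0,
      mul_nonneg (mul_nonneg (sub_nonneg.2 hK2) (sub_nonneg.2 hK2)) hK0.le]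
  have hs0 : 0 < Real.sin (Real.pi / K) := by
    refine lt_of_lt_of_le ?_ hsin
    have : 0 < 1 - 1.654 / K ^ 2 := by
      rw [sub_pos, div_lt_one (by positivity)]; nlinarith
    positivity
  have h : 1 / Real.sin (Real.pi / K) ≤ 1 + k / 3 := by
    rw [div_le_iff₀ hs0]
    refine hkey.trans ?_
    gcongr
  nlinarith

/-- Error made in replacing a Fourier integral over `[0, π]` by the one over `[0, T]`, for `pmf`. -/
noncomputable def pmfErr (k : ℕ) (lam : ℝ) : ℝ :=
  Real.exp (-(k * lam)) * ((1 + k * lam + (k * lam) ^ 2 / 2) *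
      ((Real.pi / (k + 1 / 2)) ^ 2 / 4) + lam ^ 3 / 6 * (4 / (Real.pi / (k + 1 / 2)))) +
    Real.exp (-(5 / 6 * (k * lam))) * (lam ^ 3 / 6 * (2 / (Real.pi / (k + 1 / 2))))

/-- As `pmfErr`, for upper bounds. -/
noncomputable def pmfErr' (k : ℕ) (lam : ℝ) : ℝ :=
  Real.exp (-(k * lam)) * (4 / (Real.pi / (k + 1 / 2))) +
    Real.exp (-(5 / 6 * (k * lam))) * (2 / (Real.pi / (k + 1 / 2)))

/-- As `pmfErr`, for the distribution function. -/
noncomputable def cdfErr (k : ℕ) (lam : ℝ) : ℝ :=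
  Real.exp (-(k * lam)) * (Real.pi + lam * powSum k 1 * Real.pi * (Real.pi / (k + 1 / 2)) +
      lam * (4 / (Real.pi / (k + 1 / 2)))) +
    Real.exp (-(5 / 6 * (k * lam))) * (lam * (2 / (Real.pi / (k + 1 / 2))))

lemma exp_mul_exp_rate_le {k : ℕ} (hk : 2 ≤ k) {lam : ℝ} (hlam : 0 ≤ lam) :
    Real.exp (-(k * lam)) *
      Real.exp (lam * ((1 / Real.sin (Real.pi / (k + 1 / 2)) - 1) / 2)) ≤
    Real.exp (-(5 / 6 * (k * lam))) := by
  rw [← Real.exp_add]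
  apply Real.exp_le_exp.2
  linarith [rate_le hk hlam]

lemma powSum_one (k : ℕ) : powSum k 1 = ∑ i ∈ range k, ((i + 1 : ℕ) : ℝ) := by simp [powSum]

namespace WaveParams

variable {k m : ℕ} {lam N a₃ a₄ a₅ T₁ σ b s : ℝ}

lemma aux_u (P : WaveParams k lam N a₃ a₄ a₅ T₁ (Real.pi / (k + 1 / 2)) σ b)
    {x η e₄ E : ℝ} (hx0 : 0 ≤ x)
    (hx : s * N ^ 2 ≤ x * a₃) (hη1 : η < 1) (hη : a₅ * T₁ ^ 2 ≤ η * a₃)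
    (hxq : x ≤ (1 - η) * (N ^ 2 * T₁ ^ 2)) (he₄ : a₄ * (x / (1 - η)) ^ 2 ≤ e₄ * N ^ 4)
    (hE : Real.exp e₄ ≤ E) :
    ∃ u, s ≤ a₃ * u - a₅ * u ^ 2 ∧ s ≤ a₃ * T₁ ^ 2 - a₅ * (T₁ ^ 2) ^ 2 ∧
      Real.exp (a₄ * u ^ 2) ≤ E := by
  have hN := P.N_pos
  have ha3 := P.a₃_pos
  have ha5 := P.a₅_nonneg
  have hη' : 0 < 1 - η := by linarith
  have hu : x / (1 - η) / N ^ 2 ≤ T₁ ^ 2 := by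
    rw [div_le_iff₀ (by positivity), div_le_iff₀ hη']; linarith
  have hu0 : 0 ≤ x / (1 - η) / N ^ 2 := by positivity
  have hs : s ≤ a₃ * (1 - η) * (x / (1 - η) / N ^ 2) := by
    have : a₃ * (1 - η) * (x / (1 - η) / N ^ 2) = x * a₃ / N ^ 2 := by field_simp
    rwa [this, le_div_iff₀ (by positivity)]
  refine ⟨x / (1 - η) / N ^ 2, ?_, ?_, ?_⟩
  · have : a₅ * (x / (1 - η) / N ^ 2) ≤ η * a₃ := le_trans (by gcongr) hη
    nlinarith [mul_le_mul_of_nonneg_right this hu0]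
  · have h1 : a₃ * (1 - η) * (x / (1 - η) / N ^ 2) ≤ a₃ * (1 - η) * T₁ ^ 2 := by gcongr
    nlinarith [mul_le_mul_of_nonneg_right hη (sq_nonneg T₁)]
  · refine le_trans (Real.exp_le_exp.2 ?_) hE
    rw [div_pow, ← mul_div_assoc, div_le_iff₀ (by positivity)]
    linarith [show (N ^ 2) ^ 2 = N ^ 4 by ring]

lemma rel_G (P : WaveParams k lam N a₃ a₄ a₅ T₁ (Real.pi / (k + 1 / 2)) σ b) {Z G : ℝ}
    (hG : 0 ≤ G) (hZ : G * (N * T₁) ^ 3 ≤ Z) :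
    G / (4 * σ * N ^ 2) ≤ 3 * a₃ * Real.sqrt (Real.pi / 2) / (2 * N ^ 5) * (Z / (22.5 * σ)) := by
  have hN := P.N_pos
  have ha3 := P.a₃_pos
  have hσ := P.σ_pos
  have hT := P.T₁_pos
  have hw := five_quarters_le_sqrt
  set w := Real.sqrt (Real.pi / 2)
  have h1 : G * N ^ 3 ≤ Z * a₃ / 3 := by
    have : a₃ * (G * (N * T₁) ^ 3) ≤ a₃ * Z := by gcongr
    have e : a₃ * (G * (N * T₁) ^ 3) = G * N ^ 3 * (a₃ * T₁ ^ 3) := by ring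
    rw [e, P.cube] at this; linarith
  rw [div_mul_div_comm, div_le_div_iff₀ (by positivity) (by positivity)]
  have h2 : G * N ^ 3 * 45 ≤ 12 * a₃ * w * Z := by
    have : 0 ≤ Z := le_trans (by positivity) hZ
    have : 5 / 4 * (a₃ * Z) ≤ w * (a₃ * Z) := by gcongr
    linarith
  calc G * (2 * N ^ 5 * (22.5 * σ)) = (G * N ^ 3 * 45) * (σ * N ^ 2) := by ring
    _ ≤ (12 * a₃ * w * Z) * (σ * N ^ 2) := by gcongr
    _ = _ := by ring

lemma rel_G_div (P : WaveParams k lam N a₃ a₄ a₅ T₁ (Real.pi / (k + 1 / 2)) σ b) {Z G : ℝ}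
    (hG : 0 ≤ G) (hZ : G * (N * T₁) ≤ Z) :
    b * G / (T₁ ^ 2 * σ * N ^ 2) ≤
      2 * a₃ * Real.sqrt (Real.pi / 2) / N ^ 3 * (b * Z / (7.5 * σ)) := by
  have hN := P.N_pos
  have ha3 := P.a₃_pos
  have hσ := P.σ_pos
  have hT := P.T₁_pos
  have hb := P.one_le_b
  have hb0 : 0 < b := by linarith
  have hw := five_quarters_le_sqrt
  set w := Real.sqrt (Real.pi / 2)
  have hZ0 : 0 ≤ Z := le_trans (by positivity) hZ
  have h2 : G * N * 7.5 ≤ 2 * a₃ * w * Z * T₁ ^ 2 := by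
    have h3 : 5 / 4 * (a₃ * (Z * T₁ ^ 2)) ≤ w * (a₃ * (Z * T₁ ^ 2)) := by gcongr
    have h4 : a₃ * (G * (N * T₁) * T₁ ^ 2) ≤ a₃ * (Z * T₁ ^ 2) := by gcongr
    have e : a₃ * (G * (N * T₁) * T₁ ^ 2) = G * N * (a₃ * T₁ ^ 3) := by ring
    rw [e, P.cube] at h4
    linarith
  rw [div_mul_div_comm, div_le_div_iff₀ (by positivity) (by positivity)]
  calc b * G * (N ^ 3 * (7.5 * σ)) = (G * N * 7.5) * (b * σ * N ^ 2) := by ring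
    _ ≤ (2 * a₃ * w * Z * T₁ ^ 2) * (b * σ * N ^ 2) := by gcongr
    _ = _ := by ring

/-- Criterion for the mass function to decrease at `m`. -/
lemma pmf_succ_lt (P : WaveParams k lam N a₃ a₄ a₅ T₁ (Real.pi / (k + 1 / 2)) σ b)
    (hk : 2 ≤ k) (hm : k + 1 ≤ m) (hs0 : 0 ≤ s) (hs : (m : ℝ) + 1 / 2 = lam * powSum k 1 - s)
    {x η e₄ E d R₅ R₃ Z e : ℝ} (hx0 : 0 ≤ x)
    (hx : s * N ^ 2 ≤ x * a₃) (hη1 : η < 1) (hη : a₅ * T₁ ^ 2 ≤ η * a₃)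
    (hxq : x ≤ (1 - η) * (N ^ 2 * T₁ ^ 2)) (he₄ : a₄ * (x / (1 - η)) ^ 2 ≤ e₄ * N ^ 4)
    (hE : Real.exp e₄ ≤ E) (hd : 1 ≤ d * N ^ 2) (hR₅ : a₅ ≤ R₅ * (a₃ * N ^ 2))
    (hR₃ : a₃ ^ 2 ≤ R₃ * N ^ 6)
    (hZ : Real.exp (-(N ^ 2 * T₁ ^ 2 / 2 - a₄ * T₁ ^ 4)) * (N * T₁) ^ 3 ≤ Z)
    (he : pmfErr k lam * (8 * N ^ 5) ≤ e * (15 * a₃))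
    (hfin : E * x / 3 + 5 / 24 * d + 5 * R₅ + 52.5 * R₃ + Z / (22.5 * σ) + e < 1) :
    poissonOrderKPmf k lam (m + 1) < poissonOrderKPmf k lam m := by
  obtain ⟨u, h1, h2, h3⟩ := aux_u P hx0 hx hη1 hη hxq he₄ hE
  have hN := P.N_pos
  have ha3 := P.a₃_pos
  have hI := P.le_integral_mul hs0 h1 h2 h3
  have hG := P.rel_G (Real.exp_pos _).le hZ
  rw [powSum_one] at hs
  have hS := pmf_sub_ge hk P.lam_nonneg hm hs rfl rfl
  have hE2 := exp_mul_exp_rate_le hk P.lam_nonneg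
  have hw := five_quarters_le_sqrt
  set w := Real.sqrt (Real.pi / 2)
  have hE0 : 0 ≤ E := (Real.exp_pos _).le.trans hE
  have hT0 := (cutoff_mem hk).1
  have hl := P.lam_nonneg
  have herr : Real.exp (-(k * lam)) * ((1 + k * lam + (k * lam) ^ 2 / 2) *
      ((Real.pi / (k + 1 / 2)) ^ 2 / 4) +
        (lam ^ 3 / 6 * (4 / (Real.pi / (k + 1 / 2))) + lam ^ 3 / 6 *
          Real.exp (lam * ((1 / Real.sin (Real.pi / (k + 1 / 2)) - 1) / 2)) *
          (2 / (Real.pi / (k + 1 / 2))))) ≤ pmfErr k lam := by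
    rw [pmfErr]
    have : 0 ≤ lam ^ 3 / 6 * (2 / (Real.pi / (k + 1 / 2))) := by positivity
    linarith [mul_le_mul_of_nonneg_right hE2 this]
  have herr2 : pmfErr k lam ≤ 3 * a₃ * w / (2 * N ^ 5) * e := by
    rw [div_mul_eq_mul_div, le_div_iff₀ (by positivity)]
    have he0 : 0 ≤ e := by
      have : 0 ≤ pmfErr k lam := by rw [pmfErr]; positivity
      have : 0 ≤ e * (15 * a₃) := le_trans (by positivity) he
      by_contra h
      have := mul_neg_of_neg_of_pos (not_le.1 h) (show 0 < 15 * a₃ by positivity)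
      linarith
    have : 5 / 4 * (a₃ * e) ≤ w * (a₃ * e) := by gcongr
    linarith
  have hmain : 3 * a₃ * w / (2 * N ^ 5) * (1 - E * x / 3 - 5 / 24 * d - 5 * R₅ - 52.5 * R₃) ≤
      w * (-(E * s / 2) / N ^ 3 + 3 * (a₃ / 2) / N ^ 5 +
        15 * (-(a₃ / 48) - a₅ / 2) / N ^ 7 + 945 * (-(a₃ ^ 3 / 12)) / N ^ 11) := by
    have e1 : w * (-(E * s / 2) / N ^ 3 + 3 * (a₃ / 2) / N ^ 5 +
        15 * (-(a₃ / 48) - a₅ / 2) / N ^ 7 + 945 * (-(a₃ ^ 3 / 12)) / N ^ 11) =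
        3 * a₃ * w / (2 * N ^ 5) * (1 - E * (s * N ^ 2 / a₃) / 3 - 5 / 24 * (1 / N ^ 2) -
          5 * (a₅ / (a₃ * N ^ 2)) - 52.5 * (a₃ ^ 2 / N ^ 6)) := by
      field_simp; ring
    rw [e1]
    have i1 : s * N ^ 2 / a₃ ≤ x := by rwa [div_le_iff₀ ha3]
    have i2 : 1 / N ^ 2 ≤ d := by rwa [div_le_iff₀ (by positivity)]
    have i3 : a₅ / (a₃ * N ^ 2) ≤ R₅ := by rwa [div_le_iff₀ (by positivity)]
    have i4 : a₃ ^ 2 / N ^ 6 ≤ R₃ := by rwa [div_le_iff₀ (by positivity)]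
    gcongr
  have hpos : 0 < 3 * a₃ * w / (2 * N ^ 5) := by positivity
  have hprod := mul_pos hpos (sub_pos.2 hfin)
  have : 0 < Real.pi / 2 * (poissonOrderKPmf k lam m - poissonOrderKPmf k lam (m + 1)) := by
    refine lt_of_lt_of_le ?_ hS
    linarith
  have := pos_of_mul_pos_right this (by positivity)
  linarith

/-- Criterion for the mass function to increase at `m`. -/
lemma pmf_lt_succ (P : WaveParams k lam N a₃ a₄ a₅ T₁ (Real.pi / (k + 1 / 2)) σ b)
    (hk : 2 ≤ k) (hs0 : 0 ≤ s) (hs : (m : ℝ) + 1 / 2 = lam * powSum k 1 - s)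
    {x X κ S R₄ Z e : ℝ} (hxq : s ≤ a₃ * T₁ ^ 2)
    (hx : x * a₃ ≤ s * N ^ 2) (hX0 : 0 < X) (hX : a₄ * T₁ ^ 4 ≤ X) (hκ0 : 0 ≤ κ)
    (hκ : Real.exp X ≤ 1 + κ * X) (hS : s ^ 3 / 6 + s / 24 ≤ S * a₃)
    (hR₄ : a₄ ≤ R₄ * N ^ 4)
    (hZ : Real.exp (-(N ^ 2 * T₁ ^ 2 / 2 - a₄ * T₁ ^ 4)) * (N * T₁) ^ 3 ≤ Z)
    (he : pmfErr' k lam * (8 * N ^ 5) ≤ e * (15 * a₃))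
    (hfin : 1 + S + 35 * κ * R₄ + Z / (22.5 * σ) + e < x / 3) :
    poissonOrderKPmf k lam m < poissonOrderKPmf k lam (m + 1) := by
  have hN := P.N_pos
  have ha3 := P.a₃_pos
  have hT1 := P.T₁_pos
  have hs3 : s * T₁ ≤ 3 := by nlinarith [P.cube]
  have hI := P.integral_mul_le hs0 hs3 hxq hX0 hX hκ0 hκ
  have hG := P.rel_G (Real.exp_pos _).le hZ
  rw [powSum_one] at hs
  have hS' := pmf_sub_le hk P.lam_nonneg hs rfl rfl
  have hE2 := exp_mul_exp_rate_le hk P.lam_nonneg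
  have hw := five_quarters_le_sqrt
  set w := Real.sqrt (Real.pi / 2)
  have hT0 := (cutoff_mem hk).1
  have hl := P.lam_nonneg
  have herr : Real.exp (-(k * lam)) * (4 / (Real.pi / (k + 1 / 2)) +
        Real.exp (lam * ((1 / Real.sin (Real.pi / (k + 1 / 2)) - 1) / 2)) *
          (2 / (Real.pi / (k + 1 / 2)))) ≤ pmfErr' k lam := by
    rw [pmfErr']
    have : 0 ≤ (2 / (Real.pi / (k + 1 / 2)) : ℝ) := by positivity
    linarith [mul_le_mul_of_nonneg_right hE2 this]
  have herr2 : pmfErr' k lam ≤ 3 * a₃ * w / (2 * N ^ 5) * e := by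
    rw [div_mul_eq_mul_div, le_div_iff₀ (by positivity)]
    have he0 : 0 ≤ e := by
      have : 0 ≤ pmfErr' k lam := by rw [pmfErr']; positivity
      have : 0 ≤ e * (15 * a₃) := le_trans (by positivity) he
      by_contra h
      have := mul_neg_of_neg_of_pos (not_le.1 h) (show 0 < 15 * a₃ by positivity)
      linarith
    have : 5 / 4 * (a₃ * e) ≤ w * (a₃ * e) := by gcongr
    linarith
  have hmain : w * (-(s / 2) / N ^ 3 + 3 * (a₃ / 2 + s ^ 3 / 12 + s / 48) / N ^ 5 +
        105 * (a₃ * κ * a₄ / 2) / N ^ 9) ≤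
      3 * a₃ * w / (2 * N ^ 5) * (1 - x / 3 + S + 35 * κ * R₄) := by
    have e1 : w * (-(s / 2) / N ^ 3 + 3 * (a₃ / 2 + s ^ 3 / 12 + s / 48) / N ^ 5 +
        105 * (a₃ * κ * a₄ / 2) / N ^ 9) =
        3 * a₃ * w / (2 * N ^ 5) * (1 - (s * N ^ 2 / a₃) / 3 + (s ^ 3 / 6 + s / 24) / a₃ +
          35 * κ * (a₄ / N ^ 4)) := by
      field_simp; ring
    rw [e1]
    have i1 : x ≤ s * N ^ 2 / a₃ := by rwa [le_div_iff₀ ha3]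
    have i3 : (s ^ 3 / 6 + s / 24) / a₃ ≤ S := by rwa [div_le_iff₀ (by positivity)]
    have i4 : a₄ / N ^ 4 ≤ R₄ := by rwa [div_le_iff₀ (by positivity)]
    gcongr
  have hpos : 0 < 3 * a₃ * w / (2 * N ^ 5) := by positivity
  have hprod := mul_pos hpos (sub_pos.2 hfin)
  have : Real.pi / 2 * (poissonOrderKPmf k lam m - poissonOrderKPmf k lam (m + 1)) < 0 := by
    refine lt_of_le_of_lt hS' ?_
    linarith
  have := neg_of_mul_neg_right this (by positivity)
  linarith

lemma cdfErr_le (hk : 2 ≤ k) (hl : 0 ≤ lam) (hs0 : 0 ≤ s)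
    (hs : (m : ℝ) + 1 / 2 = lam * powSum k 1 - s) :
    Real.exp (-(k * lam)) * (Real.pi + (m + 1 / 2) * Real.pi * (Real.pi / (k + 1 / 2)) +
        (lam * (4 / (Real.pi / (k + 1 / 2))) + lam *
          Real.exp (lam * ((1 / Real.sin (Real.pi / (k + 1 / 2)) - 1) / 2)) *
          (2 / (Real.pi / (k + 1 / 2))))) ≤ cdfErr k lam := by
  have hE2 := exp_mul_exp_rate_le hk hl
  have hT0 := (cutoff_mem hk).1
  rw [cdfErr]
  have h1 : 0 ≤ lam * (2 / (Real.pi / (k + 1 / 2))) := by positivity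
  have h2 : (m + 1 / 2 : ℝ) * (Real.pi * (Real.pi / (k + 1 / 2))) ≤
      lam * powSum k 1 * (Real.pi * (Real.pi / (k + 1 / 2))) := by
    gcongr; linarith
  have h3 := mul_le_mul_of_nonneg_left h2 (Real.exp_pos (-(k * lam))).le
  linarith [mul_le_mul_of_nonneg_right hE2 h1]

lemma cdfErr_le_rel (P : WaveParams k lam N a₃ a₄ a₅ T₁ (Real.pi / (k + 1 / 2)) σ b) {e : ℝ}
    (he : cdfErr k lam * N ^ 3 ≤ e * (2.5 * a₃)) :
    cdfErr k lam ≤ 2 * a₃ * Real.sqrt (Real.pi / 2) / N ^ 3 * e := by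
  have hN := P.N_pos
  have ha3 := P.a₃_pos
  have hl := P.lam_nonneg
  have hw := five_quarters_le_sqrt
  set w := Real.sqrt (Real.pi / 2)
  rw [div_mul_eq_mul_div, le_div_iff₀ (by positivity)]
  have he0 : 0 ≤ e := by
    have : 0 ≤ cdfErr k lam := by
      have : 0 ≤ powSum k 1 := by unfold powSum; positivity
      rw [cdfErr]; positivity
    have : 0 ≤ e * (2.5 * a₃) := le_trans (by positivity) he
    by_contra h
    have := mul_neg_of_neg_of_pos (not_le.1 h) (show 0 < 2.5 * a₃ by positivity)
    linarith
  have : 5 / 4 * (a₃ * e) ≤ w * (a₃ * e) := by gcongr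
  linarith

/-- Criterion for `P(X ≤ m) < 1/2`. -/
lemma cdf_lt_half (P : WaveParams k lam N a₃ a₄ a₅ T₁ (Real.pi / (k + 1 / 2)) σ b)
    (hk : 2 ≤ k) (hs0 : 0 ≤ s) (hs : (m : ℝ) + 1 / 2 = lam * powSum k 1 - s)
    {x X κ S R₄ Z e : ℝ} (hxq : s ≤ a₃ * T₁ ^ 2)
    (hx : x * a₃ ≤ s * N ^ 2) (hX0 : 0 < X) (hX : a₄ * T₁ ^ 4 ≤ X) (hκ0 : 0 ≤ κ)
    (hκ : Real.exp X ≤ 1 + κ * X) (hS : s ^ 3 / 6 ≤ S * a₃)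
    (hR₄ : a₄ ≤ R₄ * N ^ 4)
    (hZ : Real.exp (-(N ^ 2 * T₁ ^ 2 / 2 - a₄ * T₁ ^ 4)) * (N * T₁) ≤ Z)
    (he : cdfErr k lam * N ^ 3 ≤ e * (2.5 * a₃))
    (hfin : b * (1 + S) + 15 * b * κ * R₄ + b * Z / (7.5 * σ) + e < x) :
    cdf k lam m < 1 / 2 := by
  have hN := P.N_pos
  have ha3 := P.a₃_pos
  have hT1 := P.T₁_pos
  have hb := P.one_le_b
  have hs3 : s * T₁ ≤ 3 := by nlinarith [P.cube]
  have herr := cdfErr_le hk P.lam_nonneg hs0 hs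
  rw [powSum_one] at hs
  have hi := integrableOn_wave_div k lam hs
  have hI := P.integral_div_le hs0 hi hs3 hxq hX0 hX hκ0 hκ
  have hG := P.rel_G_div (Real.exp_pos _).le hZ
  have hS' := (abs_le.1 (abs_cdf_sub_le hk P.lam_nonneg hs rfl rfl)).2
  have hw := five_quarters_le_sqrt
  have herr2 := P.cdfErr_le_rel he
  set w := Real.sqrt (Real.pi / 2)
  have hT0 := (cutoff_mem hk).1
  have hl := P.lam_nonneg
  have hmain : w * (-(2 * s) / N + 2 * b * (a₃ + s ^ 3 / 6) / N ^ 3 +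
        15 * (2 * b * a₃ * κ * a₄) / N ^ 7) ≤
      2 * a₃ * w / N ^ 3 * (b * (1 + S) + 15 * b * κ * R₄ - x) := by
    have e1 : w * (-(2 * s) / N + 2 * b * (a₃ + s ^ 3 / 6) / N ^ 3 +
        15 * (2 * b * a₃ * κ * a₄) / N ^ 7) =
        2 * a₃ * w / N ^ 3 * (b * (1 + (s ^ 3 / 6) / a₃) + 15 * b * κ * (a₄ / N ^ 4) -
          (s * N ^ 2 / a₃)) := by
      field_simp; ring
    rw [e1]
    have i1 : x ≤ s * N ^ 2 / a₃ := by rwa [le_div_iff₀ ha3]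
    have i3 : (s ^ 3 / 6) / a₃ ≤ S := by rwa [div_le_iff₀ (by positivity)]
    have i4 : a₄ / N ^ 4 ≤ R₄ := by rwa [div_le_iff₀ (by positivity)]
    gcongr
  have hpos : 0 < 2 * a₃ * w / N ^ 3 := by positivity
  have hprod := mul_pos hpos (sub_pos.2 hfin)
  have : Real.pi * (2 * cdf k lam m - 1) < 0 := by linarith
  have := neg_of_mul_neg_right this Real.pi_pos.le
  linarith

/-- Criterion for `P(X ≤ m) ≥ 1/2`. -/
lemma half_le_cdf (P : WaveParams k lam N a₃ a₄ a₅ T₁ (Real.pi / (k + 1 / 2)) σ b)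
    (hk : 2 ≤ k) (hs0 : 0 ≤ s) (hs : (m : ℝ) + 1 / 2 = lam * powSum k 1 - s)
    {x η e₄ E R₅ R₃ Z e : ℝ} (hx0 : 0 ≤ x)
    (hx : s * N ^ 2 ≤ x * a₃) (hη1 : η < 1) (hη : a₅ * T₁ ^ 2 ≤ η * a₃)
    (hxq : x ≤ (1 - η) * (N ^ 2 * T₁ ^ 2)) (he₄ : a₄ * (x / (1 - η)) ^ 2 ≤ e₄ * N ^ 4)
    (hE : Real.exp e₄ ≤ E) (hR₅ : a₅ ≤ R₅ * (a₃ * N ^ 2))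
    (hR₃ : a₃ ^ 2 ≤ R₃ * N ^ 6)
    (hZ : Real.exp (-(N ^ 2 * T₁ ^ 2 / 2 - a₄ * T₁ ^ 4)) * (N * T₁) ≤ Z)
    (he : cdfErr k lam * N ^ 3 ≤ e * (2.5 * a₃))
    (hfin : b * E * x + 3 * b * R₅ + 17.5 * b * R₃ + b * Z / (7.5 * σ) + e < 1) :
    1 / 2 ≤ cdf k lam m := by
  obtain ⟨u, h1, h2, h3⟩ := aux_u P hx0 hx hη1 hη hxq he₄ hE
  have hN := P.N_pos
  have ha3 := P.a₃_pos
  have hb := P.one_le_b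
  have herr := cdfErr_le hk P.lam_nonneg hs0 hs
  rw [powSum_one] at hs
  have hi := integrableOn_wave_div k lam hs
  have hI := P.le_integral_div hs0 hi h1 h2 h3
  have hG := P.rel_G_div (Real.exp_pos _).le hZ
  have hS := (abs_le.1 (abs_cdf_sub_le hk P.lam_nonneg hs rfl rfl)).1
  have hw := five_quarters_le_sqrt
  have herr2 := P.cdfErr_le_rel he
  set w := Real.sqrt (Real.pi / 2)
  have hE0 : 0 ≤ E := (Real.exp_pos _).le.trans hE
  have hb0 : 0 ≤ b := by linarith
  have hmain : 2 * a₃ * w / N ^ 3 * (1 - b * E * x - 3 * b * R₅ - 17.5 * b * R₃) ≤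
      w * (-(2 * b * E * s) / N + 2 * a₃ / N ^ 3 +
        3 * (-(2 * b * a₅)) / N ^ 5 + 105 * (-(b * a₃ ^ 3 / 3)) / N ^ 9) := by
    have e1 : w * (-(2 * b * E * s) / N + 2 * a₃ / N ^ 3 +
        3 * (-(2 * b * a₅)) / N ^ 5 + 105 * (-(b * a₃ ^ 3 / 3)) / N ^ 9) =
        2 * a₃ * w / N ^ 3 * (1 - b * E * (s * N ^ 2 / a₃) - 
          3 * b * (a₅ / (a₃ * N ^ 2)) - 17.5 * b * (a₃ ^ 2 / N ^ 6)) := by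
      field_simp; ring
    rw [e1]
    have i1 : s * N ^ 2 / a₃ ≤ x := by rwa [div_le_iff₀ ha3]
    have i3 : a₅ / (a₃ * N ^ 2) ≤ R₅ := by rwa [div_le_iff₀ (by positivity)]
    have i4 : a₃ ^ 2 / N ^ 6 ≤ R₃ := by rwa [div_le_iff₀ (by positivity)]
    gcongr
  have hpos : 0 < 2 * a₃ * w / N ^ 3 := by positivity
  have hprod := mul_pos hpos (sub_pos.2 hfin)
  have : 0 < Real.pi * (2 * cdf k lam m - 1) := by linarith
  have := pos_of_mul_pos_right this Real.pi_pos.le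
  linarith

end WaveParams

end PoissonK
namespace PoissonK

open Finset

lemma pow_mul_exp_neg_le {c c₀ h : ℝ} (n : ℕ) (h0 : 0 < c₀) (hc : c₀ ≤ c) (hn : n ≤ h * c₀) :
    c ^ n * Real.exp (-(h * c)) ≤ c₀ ^ n * Real.exp (-(h * c₀)) := by
  have h1 : c / c₀ ≤ Real.exp (c / c₀ - 1) := by
    have := Real.add_one_le_exp (c / c₀ - 1); linarith
  have h2 : (c / c₀) ^ n ≤ Real.exp (n * (c / c₀ - 1)) := by
    rw [Real.exp_nat_mul]
    have : 0 ≤ c / c₀ := div_nonneg (h0.le.trans hc) h0.le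
    gcongr
  have h3 : n * (c / c₀ - 1) ≤ h * (c - c₀) := by
    have e : h * (c - c₀) = h * c₀ * (c / c₀ - 1) := by field_simp
    rw [e]
    have : 0 ≤ c / c₀ - 1 := by rw [sub_nonneg, one_le_div h0]; exact hc
    gcongr
  have h4 : (c / c₀) ^ n ≤ Real.exp (h * (c - c₀)) := h2.trans (Real.exp_le_exp.2 h3)
  rw [div_pow, div_le_iff₀ (by positivity)] at h4
  calc c ^ n * Real.exp (-(h * c)) ≤
      (Real.exp (h * (c - c₀)) * c₀ ^ n) * Real.exp (-(h * c)) := by gcongr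
    _ = c₀ ^ n * (Real.exp (h * (c - c₀)) * Real.exp (-(h * c))) := by ring
    _ = _ := by rw [← Real.exp_add]; congr 2; ring

lemma pow_mul_exp_neg_sq_le {q q₀ : ℝ} (h0 : 0 < q₀) (hq : q₀ ≤ q) (h3 : 3 ≤ q₀ ^ 2) :
    q ^ 3 * Real.exp (-(q ^ 2 / 2)) ≤ q₀ ^ 3 * Real.exp (-(q₀ ^ 2 / 2)) := by
  have h1 : q₀ ^ 2 ≤ q ^ 2 := by gcongr
  have h := pow_mul_exp_neg_le (c := q ^ 2) (c₀ := q₀ ^ 2) (h := 1) 3 (by positivity) h1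
    (by push_cast; linarith)
  have hq0 : 0 < q := h0.trans_le hq
  have e : ∀ x : ℝ, (x ^ 3 * Real.exp (-(x ^ 2 / 2))) ^ 2 =
      (x ^ 2) ^ 3 * Real.exp (-(1 * x ^ 2)) := fun x => by
    rw [mul_pow, ← Real.exp_nat_mul]
    congr 1
    · ring
    · congr 1; push_cast; ring
  refine le_of_pow_le_pow_left₀ two_ne_zero (by positivity) ?_
  rw [e, e]; exact h

/-- Numerical data controlling the Gaussian approximation for all parameters `lam` with
`c₀ ≤ k * lam`. -/
structure Base (k : ℕ) (c₀ R₃ R₄ R₅ X τ₁ τ η q Z α β g Q eI eJ d b : ℝ) : Prop where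
  hk : 2 ≤ k
  hc₀ : 6 ≤ c₀
  hR₃ : k * (powSum k 3 / 6) ^ 2 ≤ R₃ * c₀ * powSum k 2 ^ 3
  hR₄ : k * (powSum k 4 / 24) ≤ R₄ * c₀ * powSum k 2 ^ 2
  hR₅ : k * (powSum k 5 / 120) ≤ R₅ * c₀ * ((powSum k 3 / 6) * powSum k 2)
  R₃_pos : 0 < R₃
  R₄_nonneg : 0 ≤ R₄
  R₅_nonneg : 0 ≤ R₅
  X_pos : 0 < X
  hX : k * (81 * (powSum k 4 / 24) ^ 3) ≤ X ^ 3 * c₀ * (powSum k 3 / 6) ^ 4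
  τ₁_nonneg : 0 ≤ τ₁
  hτ₁ : k ^ 2 * (9 * (powSum k 4 / 24) ^ 3) ≤
    τ₁ ^ 3 * c₀ ^ 2 * ((powSum k 3 / 6) ^ 2 * powSum k 2 ^ 3)
  hτ : powSum k 4 / 24 * 9.87 ≤ τ * powSum k 2 * (k + 1 / 2) ^ 2
  η_nonneg : 0 ≤ η
  hη1 : η < 1
  hη : k ^ 2 * (9 * (powSum k 5 / 120) ^ 3) ≤ η ^ 3 * c₀ ^ 2 * (powSum k 3 / 6) ^ 5
  hστ : τ + τ₁ < 1 / 2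
  hT : 3 * k * (k + 1 / 2) ^ 3 ≤ c₀ * (powSum k 3 / 6) * 31
  q_pos : 0 < q
  hq3 : 3 ≤ q ^ 2
  hq : R₃ * q ^ 6 ≤ 9
  hZ : Real.exp X * (q ^ 3 * Real.exp (-(q ^ 2 / 2))) ≤ Z
  hα : (k : ℝ) + 1 ≤ α * (k + 1 / 2)
  hβ : ((k : ℝ) + 1 / 2) ^ 2 * (k + 1) ≤ β * k ^ 3
  hg : (k : ℝ) + 1 / 2 ≤ g * k
  Q_nonneg : 0 ≤ Q
  hQ : powSum k 2 ^ 3 ≤ Q ^ 2 * k * c₀ * (powSum k 3 / 6) ^ 2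
  heI : 8 / 15 * Q * (9.87 * α / 12 * ((c₀ ^ 2 + c₀ ^ 3 + c₀ ^ 4 / 2) * Real.exp (-c₀)) +
    0.1062 * β * c₀ ^ 5 * (2 / 3 * Real.exp (-c₀) + 1 / 3 * Real.exp (-(5 / 6 * c₀)))) ≤ eI
  heJ : Q / 2.5 * ((3.1416 * c₀ + c₀ ^ 2 * 9.87 * α / 2 + 4 * 0.3184 * g * c₀ ^ 2) *
    Real.exp (-c₀) + 2 * 0.3184 * g * c₀ ^ 2 * Real.exp (-(5 / 6 * c₀))) ≤ eJ
  hd : k ≤ d * c₀ * powSum k 2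
  hb : 0 < b
  hb1 : 1 ≤ b * (1 - 9.87 / (24 * (k + 1 / 2) ^ 2))

lemma powSum_pos {k : ℕ} (hk : 2 ≤ k) (r : ℕ) : 0 < powSum k r := by
  unfold powSum
  apply Finset.sum_pos
  · intro i _; positivity
  · exact ⟨0, by simp; omega⟩

lemma powSum_one_eq (k : ℕ) : powSum k 1 = k * (k + 1) / 2 := by
  unfold powSum
  induction k with
  | zero => simp
  | succ k ih => rw [sum_range_succ, ih]; push_cast; ring

lemma powSum_two_eq (k : ℕ) : powSum k 2 = k * (k + 1) * (2 * k + 1) / 6 := by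
  unfold powSum
  induction k with
  | zero => simp
  | succ k ih => rw [sum_range_succ, ih]; push_cast; ring

lemma powSum_three_eq (k : ℕ) : powSum k 3 = k ^ 2 * (k + 1) ^ 2 / 4 := by
  unfold powSum
  induction k with
  | zero => simp
  | succ k ih => rw [sum_range_succ, ih]; push_cast; ring

lemma powSum_four_eq (k : ℕ) :
    powSum k 4 = k * (k + 1) * (2 * k + 1) * (3 * k ^ 2 + 3 * k - 1) / 30 := by
  unfold powSum
  induction k with
  | zero => simp
  | succ k ih => rw [sum_range_succ, ih]; push_cast; ring

lemma powSum_five_eq (k : ℕ) :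
    powSum k 5 = k ^ 2 * (k + 1) ^ 2 * (2 * k ^ 2 + 2 * k - 1) / 12 := by
  unfold powSum
  induction k with
  | zero => simp
  | succ k ih => rw [sum_range_succ, ih]; push_cast; ring

namespace Base

variable {k m : ℕ} {c₀ R₃ R₄ R₅ X τ₁ τ η q Z α β g Q eI eJ d b lam s : ℝ}

/-- The data extracted from `Base` at a given parameter. -/
structure At (k : ℕ) (R₃ R₄ R₅ X τ₁ τ η q Z eI eJ d b lam N T₁ : ℝ) : Prop where
  params : WaveParams k lam N (lam * powSum k 3 / 6) (lam * powSum k 4 / 24)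
    (lam * powSum k 5 / 120) T₁ (Real.pi / (k + 1 / 2)) (1 / 2 - τ - τ₁) b
  hR₃ : (lam * powSum k 3 / 6) ^ 2 ≤ R₃ * N ^ 6
  hR₄ : lam * powSum k 4 / 24 ≤ R₄ * N ^ 4
  hR₅ : lam * powSum k 5 / 120 ≤ R₅ * ((lam * powSum k 3 / 6) * N ^ 2)
  hX : lam * powSum k 4 / 24 * T₁ ^ 4 ≤ X
  hη : lam * powSum k 5 / 120 * T₁ ^ 2 ≤ η * (lam * powSum k 3 / 6)
  hd : 1 ≤ d * N ^ 2
  hq : q ^ 2 ≤ N ^ 2 * T₁ ^ 2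
  hZ : Real.exp (-(N ^ 2 * T₁ ^ 2 / 2 - lam * powSum k 4 / 24 * T₁ ^ 4)) * (N * T₁) ^ 3 ≤ Z
  hZ' : Real.exp (-(N ^ 2 * T₁ ^ 2 / 2 - lam * powSum k 4 / 24 * T₁ ^ 4)) * (N * T₁) ≤ Z / q ^ 2
  heI : pmfErr k lam * (8 * N ^ 5) ≤ eI * (15 * (lam * powSum k 3 / 6))
  heJ : cdfErr k lam * N ^ 3 ≤ eJ * (2.5 * (lam * powSum k 3 / 6))

lemma pi_sq_le : Real.pi ^ 2 ≤ 9.87 := by nlinarith [Real.pi_lt_d4, Real.pi_gt_d4]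

lemma cube_root_le {x y : ℝ} (hy : 0 ≤ y) (h : x ^ 3 ≤ y ^ 3) : x ≤ y :=
  le_of_pow_le_pow_left₀ (by norm_num) hy h

section

variable (B : Base k c₀ R₃ R₄ R₅ X τ₁ τ η q Z α β g Q eI eJ d b)
include B

lemma kpos : (0 : ℝ) < k := by
  have := B.hk; exact_mod_cast (by omega : 0 < k)

lemma pmfErr_le {N A : ℝ} (hlam : c₀ ≤ k * lam) (hA : 0 ≤ A) (hN : 0 ≤ N)
    (hN2 : N ^ 2 = lam * powSum k 2) (hQN : N ^ 3 ≤ Q * (k * lam) * A) :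
    pmfErr k lam * (8 * N ^ 5) ≤ eI * (15 * A) := by
  have hk0 := B.kpos
  have hc6 := B.hc₀
  have hpi := pi_sq_le
  have hpi0 := Real.pi_pos
  obtain ⟨c, hc⟩ : ∃ c, c = k * lam := ⟨_, rfl⟩
  rw [← hc] at hlam hQN
  have hlc : lam = c / k := by rw [hc]; field_simp
  have hc0 : 0 < c := by linarith
  have hQ0 := B.Q_nonneg
  set K : ℝ := k + 1 / 2 with hK
  have hK0 : 0 < K := by positivity
  have hα0 : 0 < α := by
    have h := B.hα
    rw [← hK] at h
    by_contra h'
    have : α * K ≤ 0 := mul_nonpos_of_nonpos_of_nonneg (not_lt.1 h') hK0.le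
    linarith
  have hβ0 : 0 < β := by
    have h := B.hβ
    rw [← hK] at h
    by_contra h'
    have : β * k ^ 3 ≤ 0 := mul_nonpos_of_nonpos_of_nonneg (not_lt.1 h') (by positivity)
    have : 0 < K ^ 2 * (k + 1) := by positivity
    linarith
  have hN2' : N ^ 2 = c * (k + 1) * K / 3 := by
    rw [hN2, powSum_two_eq, hlc, hK]; field_simp; ring
  have t1 : (Real.pi / K) ^ 2 / 4 * N ^ 2 ≤ 9.87 * α / 12 * c := by
    have e : (Real.pi / K) ^ 2 / 4 * N ^ 2 = Real.pi ^ 2 * c * ((k + 1) / K) / 12 := by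
      rw [hN2']; field_simp; ring
    have h : (k + 1) / K ≤ α := by rw [div_le_iff₀ hK0]; exact B.hα
    rw [e]
    calc Real.pi ^ 2 * c * ((k + 1) / K) / 12 ≤ 9.87 * c * α / 12 := by gcongr
      _ = _ := by ring
  have t2 : lam ^ 3 * (1 / (Real.pi / K)) * N ^ 2 ≤ 0.1062 * β * c ^ 4 := by
    have e : lam ^ 3 * (1 / (Real.pi / K)) * N ^ 2 =
        c ^ 4 * (K ^ 2 * (k + 1) / k ^ 3) * (1 / (3 * Real.pi)) := by
      rw [hN2', hlc]; field_simp
    have h : K ^ 2 * (k + 1) / k ^ 3 ≤ β := by rw [div_le_iff₀ (by positivity)]; exact B.hβ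
    have h2 : 1 / (3 * Real.pi) ≤ 0.1062 := by
      rw [div_le_iff₀ (by positivity)]; linarith [Real.pi_gt_d4]
    rw [e]
    calc c ^ 4 * (K ^ 2 * (k + 1) / k ^ 3) * (1 / (3 * Real.pi)) ≤ c ^ 4 * β * 0.1062 := by gcongr
      _ = _ := by ring
  have hmain : pmfErr k lam * N ^ 2 ≤
      9.87 * α / 12 * ((c + c ^ 2 + c ^ 3 / 2) * Real.exp (-c)) +
        0.1062 * β * c ^ 4 * (2 / 3 * Real.exp (-c) + 1 / 3 * Real.exp (-(5 / 6 * c))) := by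
    rw [pmfErr, ← hc, ← hK]
    have e1 := Real.exp_pos (-c)
    have e2 := Real.exp_pos (-(5 / 6 * c))
    have s1 := mul_le_mul_of_nonneg_left t1 (show 0 ≤ Real.exp (-c) * (1 + c + c ^ 2 / 2) by
      positivity)
    have s2 := mul_le_mul_of_nonneg_left t2 (show 0 ≤ 2 / 3 * Real.exp (-c) +
      1 / 3 * Real.exp (-(5 / 6 * c)) by positivity)
    calc _ = Real.exp (-c) * (1 + c + c ^ 2 / 2) * ((Real.pi / K) ^ 2 / 4 * N ^ 2) +
          (2 / 3 * Real.exp (-c) + 1 / 3 * Real.exp (-(5 / 6 * c))) *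
            (lam ^ 3 * (1 / (Real.pi / K)) * N ^ 2) := by ring
      _ ≤ _ := add_le_add s1 s2
      _ = _ := by ring
  have hp0 : 0 ≤ pmfErr k lam * N ^ 2 := by
    have : 0 ≤ lam := by rw [hlc]; positivity
    rw [pmfErr]; positivity
  have p : ∀ n : ℕ, n ≤ 5 → c ^ n * Real.exp (-c) ≤ c₀ ^ n * Real.exp (-c₀) := fun n hn => by
    have hn' : (n : ℝ) ≤ 5 := by exact_mod_cast hn
    have := pow_mul_exp_neg_le (c := c) (c₀ := c₀) (h := 1) n (by linarith) hlam (by linarith)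
    simpa using this
  have p' : c ^ 5 * Real.exp (-(5 / 6 * c)) ≤ c₀ ^ 5 * Real.exp (-(5 / 6 * c₀)) :=
    pow_mul_exp_neg_le (c := c) (c₀ := c₀) (h := 5 / 6) 5 (by linarith) hlam
      (by push_cast; linarith)
  have hmono : 9.87 * α / 12 * ((c ^ 2 + c ^ 3 + c ^ 4 / 2) * Real.exp (-c)) +
        0.1062 * β * c ^ 5 * (2 / 3 * Real.exp (-c) + 1 / 3 * Real.exp (-(5 / 6 * c))) ≤
      9.87 * α / 12 * ((c₀ ^ 2 + c₀ ^ 3 + c₀ ^ 4 / 2) * Real.exp (-c₀)) +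
        0.1062 * β * c₀ ^ 5 * (2 / 3 * Real.exp (-c₀) + 1 / 3 * Real.exp (-(5 / 6 * c₀))) := by
    have q1 := mul_le_mul_of_nonneg_left (add_le_add (add_le_add (p 2 (by norm_num))
      (p 3 (by norm_num))) (div_le_div_of_nonneg_right (p 4 (by norm_num)) zero_le_two))
      (show 0 ≤ 9.87 * α / 12 by positivity)
    have q2 := mul_le_mul_of_nonneg_left (add_le_add (mul_le_mul_of_nonneg_left (p 5 le_rfl)
      (show (0 : ℝ) ≤ 2 / 3 by norm_num)) (mul_le_mul_of_nonneg_left p'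
      (show (0 : ℝ) ≤ 1 / 3 by norm_num))) (show 0 ≤ 0.1062 * β by positivity)
    linarith
  calc pmfErr k lam * (8 * N ^ 5) = 8 * (pmfErr k lam * N ^ 2) * N ^ 3 := by ring
    _ ≤ 8 * (pmfErr k lam * N ^ 2) * (Q * c * A) := by gcongr
    _ = 8 * Q * A * (c * (pmfErr k lam * N ^ 2)) := by ring
    _ ≤ 8 * Q * A * (c * (9.87 * α / 12 * ((c + c ^ 2 + c ^ 3 / 2) * Real.exp (-c)) +
        0.1062 * β * c ^ 4 * (2 / 3 * Real.exp (-c) + 1 / 3 * Real.exp (-(5 / 6 * c))))) := by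
        gcongr
    _ = 8 * Q * A * (9.87 * α / 12 * ((c ^ 2 + c ^ 3 + c ^ 4 / 2) * Real.exp (-c)) +
        0.1062 * β * c ^ 5 * (2 / 3 * Real.exp (-c) + 1 / 3 * Real.exp (-(5 / 6 * c)))) := by
        ring
    _ ≤ 8 * Q * A * (9.87 * α / 12 * ((c₀ ^ 2 + c₀ ^ 3 + c₀ ^ 4 / 2) * Real.exp (-c₀)) +
        0.1062 * β * c₀ ^ 5 * (2 / 3 * Real.exp (-c₀) + 1 / 3 * Real.exp (-(5 / 6 * c₀)))) := by
        gcongr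
    _ = 8 / 15 * Q * (9.87 * α / 12 * ((c₀ ^ 2 + c₀ ^ 3 + c₀ ^ 4 / 2) * Real.exp (-c₀)) +
        0.1062 * β * c₀ ^ 5 * (2 / 3 * Real.exp (-c₀) + 1 / 3 * Real.exp (-(5 / 6 * c₀)))) *
          (15 * A) := by ring
    _ ≤ eI * (15 * A) := mul_le_mul_of_nonneg_right B.heI (by positivity)

lemma cdfErr_le {N A : ℝ} (hlam : c₀ ≤ k * lam) (hA : 0 ≤ A) (hN : 0 ≤ N)
    (hQN : N ^ 3 ≤ Q * (k * lam) * A) :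
    cdfErr k lam * N ^ 3 ≤ eJ * (2.5 * A) := by
  have hk0 := B.kpos
  have hc6 := B.hc₀
  have hpi := pi_sq_le
  have hpi0 := Real.pi_pos
  obtain ⟨c, hc⟩ : ∃ c, c = k * lam := ⟨_, rfl⟩
  rw [← hc] at hlam hQN
  have hlc : lam = c / k := by rw [hc]; field_simp
  have hc0 : 0 < c := by linarith
  have hQ0 := B.Q_nonneg
  set K : ℝ := k + 1 / 2 with hK
  have hK0 : 0 < K := by positivity
  have hα0 : 0 < α := by
    have h := B.hα
    rw [← hK] at h
    by_contra h'
    have : α * K ≤ 0 := mul_nonpos_of_nonpos_of_nonneg (not_lt.1 h') hK0.le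
    linarith
  have hg0 : 0 < g := by
    have h := B.hg
    by_contra h'
    have : g * k ≤ 0 := mul_nonpos_of_nonpos_of_nonneg (not_lt.1 h') hk0.le
    linarith
  have t1 : lam * powSum k 1 * Real.pi * (Real.pi / K) ≤ c * 9.87 * α / 2 := by
    have e : lam * powSum k 1 * Real.pi * (Real.pi / K) = c * Real.pi ^ 2 * ((k + 1) / K) / 2 := by
      rw [powSum_one_eq, hlc]; field_simp
    have h : (k + 1) / K ≤ α := by rw [div_le_iff₀ hK0]; exact B.hα
    rw [e]
    gcongr
  have t2 : lam * (1 / (Real.pi / K)) ≤ 0.3184 * g * c := by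
    have e : lam * (1 / (Real.pi / K)) = c * (K / k) * (1 / Real.pi) := by
      rw [hlc]; field_simp
    have h : K / k ≤ g := by rw [div_le_iff₀ hk0]; exact B.hg
    have h2 : 1 / Real.pi ≤ 0.3184 := by
      rw [div_le_iff₀ (by positivity)]; linarith [Real.pi_gt_d4]
    rw [e]
    calc c * (K / k) * (1 / Real.pi) ≤ c * g * 0.3184 := by gcongr
      _ = _ := by ring
  have hmain : cdfErr k lam ≤ (3.1416 + c * 9.87 * α / 2 + 4 * 0.3184 * g * c) * Real.exp (-c) +
      2 * 0.3184 * g * c * Real.exp (-(5 / 6 * c)) := by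
    rw [cdfErr, ← hc, ← hK]
    have s0 := mul_le_mul_of_nonneg_left Real.pi_lt_d4.le (Real.exp_pos (-c)).le
    have s1 := mul_le_mul_of_nonneg_left t1 (Real.exp_pos (-c)).le
    have s2 := mul_le_mul_of_nonneg_left t2 (show 0 ≤ 4 * Real.exp (-c) +
      2 * Real.exp (-(5 / 6 * c)) by positivity)
    calc _ = Real.exp (-c) * Real.pi + Real.exp (-c) * (lam * powSum k 1 * Real.pi *
          (Real.pi / K)) + (4 * Real.exp (-c) + 2 * Real.exp (-(5 / 6 * c))) *
            (lam * (1 / (Real.pi / K))) := by ring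
      _ ≤ _ := add_le_add (add_le_add s0 s1) s2
      _ = _ := by ring
  have hp0 : 0 ≤ cdfErr k lam := by
    have : 0 ≤ lam := by rw [hlc]; positivity
    have := powSum_pos B.hk 1
    rw [cdfErr]; positivity
  have p : ∀ n : ℕ, n ≤ 5 → c ^ n * Real.exp (-c) ≤ c₀ ^ n * Real.exp (-c₀) := fun n hn => by
    have hn' : (n : ℝ) ≤ 5 := by exact_mod_cast hn
    have := pow_mul_exp_neg_le (c := c) (c₀ := c₀) (h := 1) n (by linarith) hlam (by linarith)
    simpa using this
  have p' : c ^ 2 * Real.exp (-(5 / 6 * c)) ≤ c₀ ^ 2 * Real.exp (-(5 / 6 * c₀)) :=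
    pow_mul_exp_neg_le (c := c) (c₀ := c₀) (h := 5 / 6) 2 (by linarith) hlam
      (by push_cast; linarith)
  have hmono : (3.1416 * c + c ^ 2 * 9.87 * α / 2 + 4 * 0.3184 * g * c ^ 2) * Real.exp (-c) +
      2 * 0.3184 * g * c ^ 2 * Real.exp (-(5 / 6 * c)) ≤
      (3.1416 * c₀ + c₀ ^ 2 * 9.87 * α / 2 + 4 * 0.3184 * g * c₀ ^ 2) * Real.exp (-c₀) +
      2 * 0.3184 * g * c₀ ^ 2 * Real.exp (-(5 / 6 * c₀)) := by
    have q1 := p 1 (by norm_num)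
    have q2 := mul_le_mul_of_nonneg_left (p 2 (by norm_num))
      (show 0 ≤ 9.87 * α / 2 + 4 * 0.3184 * g by positivity)
    have q3 := mul_le_mul_of_nonneg_left p' (show 0 ≤ 2 * 0.3184 * g by positivity)
    linarith
  calc cdfErr k lam * N ^ 3 ≤ cdfErr k lam * (Q * c * A) := by gcongr
    _ = Q * A * (c * cdfErr k lam) := by ring
    _ ≤ Q * A * (c * ((3.1416 + c * 9.87 * α / 2 + 4 * 0.3184 * g * c) * Real.exp (-c) +
      2 * 0.3184 * g * c * Real.exp (-(5 / 6 * c)))) := by gcongr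
    _ = Q * A * ((3.1416 * c + c ^ 2 * 9.87 * α / 2 + 4 * 0.3184 * g * c ^ 2) * Real.exp (-c) +
      2 * 0.3184 * g * c ^ 2 * Real.exp (-(5 / 6 * c))) := by ring
    _ ≤ Q * A * ((3.1416 * c₀ + c₀ ^ 2 * 9.87 * α / 2 + 4 * 0.3184 * g * c₀ ^ 2) *
      Real.exp (-c₀) + 2 * 0.3184 * g * c₀ ^ 2 * Real.exp (-(5 / 6 * c₀))) := by gcongr
    _ = Q / 2.5 * ((3.1416 * c₀ + c₀ ^ 2 * 9.87 * α / 2 + 4 * 0.3184 * g * c₀ ^ 2) *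
      Real.exp (-c₀) + 2 * 0.3184 * g * c₀ ^ 2 * Real.exp (-(5 / 6 * c₀))) * (2.5 * A) := by ring
    _ ≤ eJ * (2.5 * A) := mul_le_mul_of_nonneg_right B.heJ (by positivity)

lemma exists_at (hlam : c₀ ≤ k * lam) :
    ∃ N T₁, At k R₃ R₄ R₅ X τ₁ τ η q Z eI eJ d b lam N T₁ := by
  have hk := B.hk
  have hk0 := B.kpos
  have hc0 : 0 < c₀ := by linarith [B.hc₀]
  have hl : 0 < lam := pos_of_mul_pos_right (hc0.trans_le hlam) hk0.le
  have hA2 := powSum_pos hk 2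
  have hA3 := powSum_pos hk 3
  have hA4 := powSum_pos hk 4
  have hA5 := powSum_pos hk 5
  set A₂ := powSum k 2 with hA2def
  set A₃ := powSum k 3 / 6 with hA3def
  set A₄ := powSum k 4 / 24 with hA4def
  set A₅ := powSum k 5 / 120 with hA5def
  have hA3 : 0 < A₃ := by positivity
  have hA4 : 0 < A₄ := by positivity
  have hA5 : 0 < A₅ := by positivity
  have r3 : lam * powSum k 3 / 6 = lam * A₃ := by rw [hA3def]; ring
  have r4 : lam * powSum k 4 / 24 = lam * A₄ := by rw [hA4def]; ring
  have r5 : lam * powSum k 5 / 120 = lam * A₅ := by rw [hA5def]; ring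
  have hpi := pi_sq_le
  have hpi3 : 31 ≤ Real.pi ^ 3 := by
    have : 3.1415 ≤ Real.pi := Real.pi_gt_d4.le
    calc (31 : ℝ) ≤ 3.1415 ^ 3 := by norm_num
      _ ≤ _ := by gcongr
  have h3 : A₃ ^ 2 ≤ R₃ * lam * A₂ ^ 3 := by
    have h := B.hR₃
    rw [← hA2def, ← hA3def] at h
    have : R₃ * c₀ * A₂ ^ 3 ≤ R₃ * (k * lam) * A₂ ^ 3 := by have := B.R₃_pos; gcongr
    refine le_of_mul_le_mul_left ?_ hk0
    linarith
  have h4 : A₄ ≤ R₄ * lam * A₂ ^ 2 := by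
    have h := B.hR₄
    rw [← hA2def, ← hA4def] at h
    have : R₄ * c₀ * A₂ ^ 2 ≤ R₄ * (k * lam) * A₂ ^ 2 := by have := B.R₄_nonneg; gcongr
    refine le_of_mul_le_mul_left ?_ hk0
    linarith
  have h5 : A₅ ≤ R₅ * lam * (A₃ * A₂) := by
    have h := B.hR₅
    rw [← hA2def, ← hA5def, ← hA3def] at h
    have : R₅ * c₀ * (A₃ * A₂) ≤ R₅ * (k * lam) * (A₃ * A₂) := by have := B.R₅_nonneg; gcongr
    refine le_of_mul_le_mul_left ?_ hk0
    linarith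
  have hX : 81 * A₄ ^ 3 ≤ X ^ 3 * lam * A₃ ^ 4 := by
    have h := B.hX
    rw [← hA4def, ← hA3def] at h
    have : X ^ 3 * c₀ * A₃ ^ 4 ≤ X ^ 3 * (k * lam) * A₃ ^ 4 := by have := B.X_pos; gcongr
    refine le_of_mul_le_mul_left ?_ hk0
    linarith
  have hτ₁ : 9 * A₄ ^ 3 ≤ τ₁ ^ 3 * lam ^ 2 * (A₃ ^ 2 * A₂ ^ 3) := by
    have h := B.hτ₁
    rw [← hA4def, ← hA3def, ← hA2def] at h
    have : τ₁ ^ 3 * c₀ ^ 2 * (A₃ ^ 2 * A₂ ^ 3) ≤ τ₁ ^ 3 * (k * lam) ^ 2 * (A₃ ^ 2 * A₂ ^ 3) := by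
      have := B.τ₁_nonneg; gcongr
    refine le_of_mul_le_mul_left ?_ (pow_pos hk0 2)
    linarith
  have hη : 9 * A₅ ^ 3 ≤ η ^ 3 * lam ^ 2 * A₃ ^ 5 := by
    have h := B.hη
    rw [← hA5def, ← hA3def] at h
    have : η ^ 3 * c₀ ^ 2 * A₃ ^ 5 ≤ η ^ 3 * (k * lam) ^ 2 * A₃ ^ 5 := by
      have := B.η_nonneg; gcongr
    refine le_of_mul_le_mul_left ?_ (pow_pos hk0 2)
    linarith
  have hd : 1 ≤ d * (lam * A₂) := by
    have h := B.hd
    rw [← hA2def] at h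
    have hd0 : 0 ≤ d := by
      by_contra hd
      have : d * c₀ * A₂ < 0 := by
        rw [mul_assoc]; exact mul_neg_of_neg_of_pos (not_le.1 hd) (by positivity)
      linarith
    have : d * c₀ * A₂ ≤ d * (k * lam) * A₂ := by gcongr
    refine le_of_mul_le_mul_left ?_ hk0
    linarith
  have hQ : A₂ ^ 3 ≤ Q ^ 2 * k ^ 2 * lam * A₃ ^ 2 := by
    have h := B.hQ
    rw [← hA2def, ← hA3def] at h
    have : Q ^ 2 * k * c₀ * A₃ ^ 2 ≤ Q ^ 2 * k * (k * lam) * A₃ ^ 2 := by gcongr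
    linarith
  -- the scale
  set N := Real.sqrt (lam * A₂) with hNdef
  have hN : 0 < N := Real.sqrt_pos.2 (by positivity)
  have hN2 : N ^ 2 = lam * A₂ := Real.sq_sqrt (by positivity)
  have hN4 : N ^ 4 = (lam * A₂) ^ 2 := by rw [← hN2]; ring
  have hN6 : N ^ 6 = (lam * A₂) ^ 3 := by rw [← hN2]; ring
  obtain ⟨T₁, hT1, hcube⟩ : ∃ T₁ : ℝ, 0 < T₁ ∧ lam * A₃ * T₁ ^ 3 = 3 := by
    refine ⟨(3 / (lam * A₃)) ^ (1 / 3 : ℝ), by positivity, ?_⟩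
    rw [← Real.rpow_natCast, ← Real.rpow_mul (by positivity)]
    norm_num
    field_simp
  have hT0 := (cutoff_mem hk).1
  have hTpi := (cutoff_mem hk).2
  set T := Real.pi / (k + 1 / 2 : ℝ) with hTdef
  have hT1T : T₁ ≤ T := by
    refine cube_root_le hT0.le ?_
    have h := B.hT
    rw [← hA3def] at h
    have e : 3 * (k + 1 / 2 : ℝ) ^ 3 ≤ lam * A₃ * Real.pi ^ 3 := by
      have h1 : c₀ * A₃ * 31 ≤ k * lam * A₃ * Real.pi ^ 3 := by gcongr
      refine le_of_mul_le_mul_left ?_ hk0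
      linarith
    rw [hTdef, div_pow, le_div_iff₀ (by positivity)]
    refine le_of_mul_le_mul_left ?_ (show 0 < lam * A₃ by positivity)
    calc lam * A₃ * (T₁ ^ 3 * (k + 1 / 2 : ℝ) ^ 3) = (lam * A₃ * T₁ ^ 3) * (k + 1 / 2 : ℝ) ^ 3 := by
          ring
      _ ≤ _ := by rw [hcube]; exact e
  have hτT : A₄ * T ^ 2 ≤ τ * A₂ := by
    have h := B.hτ
    rw [← hA4def, ← hA2def] at h
    rw [hTdef, div_pow, ← mul_div_assoc, div_le_iff₀ (by positivity)]
    refine le_trans ?_ h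
    gcongr
  have hτT1 : lam * A₄ * T₁ ^ 2 ≤ τ₁ * N ^ 2 := by
    refine cube_root_le (by have := B.τ₁_nonneg; positivity) ?_
    refine le_of_mul_le_mul_left ?_ (show 0 < (lam * A₃) ^ 2 by positivity)
    calc (lam * A₃) ^ 2 * (lam * A₄ * T₁ ^ 2) ^ 3 = lam ^ 3 * A₄ ^ 3 * (lam * A₃ * T₁ ^ 3) ^ 2 := by
          ring
      _ = lam ^ 3 * (9 * A₄ ^ 3) := by rw [hcube]; ring
      _ ≤ lam ^ 3 * (τ₁ ^ 3 * lam ^ 2 * (A₃ ^ 2 * A₂ ^ 3)) := by gcongr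
      _ = (lam * A₃) ^ 2 * (τ₁ * N ^ 2) ^ 3 := by rw [hN2]; ring
  have hXT : lam * A₄ * T₁ ^ 4 ≤ X := by
    refine cube_root_le B.X_pos.le ?_
    refine le_of_mul_le_mul_left ?_ (show 0 < (lam * A₃) ^ 4 by positivity)
    calc (lam * A₃) ^ 4 * (lam * A₄ * T₁ ^ 4) ^ 3 = lam ^ 3 * A₄ ^ 3 * (lam * A₃ * T₁ ^ 3) ^ 4 := by
          ring
      _ = lam ^ 3 * (81 * A₄ ^ 3) := by rw [hcube]; ring
      _ ≤ lam ^ 3 * (X ^ 3 * lam * A₃ ^ 4) := by gcongr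
      _ = _ := by ring
  have hηT : lam * A₅ * T₁ ^ 2 ≤ η * (lam * A₃) := by
    refine cube_root_le (by have := B.η_nonneg; positivity) ?_
    refine le_of_mul_le_mul_left ?_ (show 0 < (lam * A₃) ^ 2 by positivity)
    calc (lam * A₃) ^ 2 * (lam * A₅ * T₁ ^ 2) ^ 3 = lam ^ 3 * A₅ ^ 3 * (lam * A₃ * T₁ ^ 3) ^ 2 := by
          ring
      _ = lam ^ 3 * (9 * A₅ ^ 3) := by rw [hcube]; ring
      _ ≤ lam ^ 3 * (η ^ 3 * lam ^ 2 * A₃ ^ 5) := by gcongr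
      _ = _ := by ring
  have hR3 : (lam * A₃) ^ 2 ≤ R₃ * N ^ 6 := by
    calc (lam * A₃) ^ 2 = lam ^ 2 * A₃ ^ 2 := by ring
      _ ≤ lam ^ 2 * (R₃ * lam * A₂ ^ 3) := by gcongr
      _ = _ := by rw [hN6]; ring
  have hqT : q ≤ N * T₁ := by
    refine le_of_pow_le_pow_left₀ (n := 6) (by norm_num) (by positivity) ?_
    refine le_of_mul_le_mul_left (B.hq.trans ?_) B.R₃_pos
    calc (9 : ℝ) = (lam * A₃ * T₁ ^ 3) ^ 2 := by rw [hcube]; norm_num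
      _ = (lam * A₃) ^ 2 * T₁ ^ 6 := by ring
      _ ≤ R₃ * N ^ 6 * T₁ ^ 6 := by gcongr
      _ = _ := by ring
  have hq0 := B.q_pos
  have hZ : Real.exp (-(N ^ 2 * T₁ ^ 2 / 2 - lam * A₄ * T₁ ^ 4)) * (N * T₁) ^ 3 ≤ Z := by
    calc Real.exp (-(N ^ 2 * T₁ ^ 2 / 2 - lam * A₄ * T₁ ^ 4)) * (N * T₁) ^ 3 =
        Real.exp (lam * A₄ * T₁ ^ 4) * ((N * T₁) ^ 3 * Real.exp (-((N * T₁) ^ 2 / 2))) := by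
          rw [mul_left_comm, ← Real.exp_add, mul_comm]; congr 2; ring
      _ ≤ Real.exp X * (q ^ 3 * Real.exp (-(q ^ 2 / 2))) := by
          gcongr ?_ * ?_
          · exact Real.exp_le_exp.2 hXT
          · exact pow_mul_exp_neg_sq_le hq0 hqT B.hq3
      _ ≤ Z := B.hZ
  have hQN : N ^ 3 ≤ Q * (k * lam) * (lam * A₃) := by
    have hQ0 := B.Q_nonneg
    refine le_of_pow_le_pow_left₀ (n := 2) (by norm_num) (by positivity) ?_
    calc (N ^ 3) ^ 2 = lam ^ 3 * A₂ ^ 3 := by rw [← pow_mul]; norm_num; rw [hN6]; ring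
      _ ≤ lam ^ 3 * (Q ^ 2 * k ^ 2 * lam * A₃ ^ 2) := by gcongr
      _ = _ := by ring
  refine ⟨N, T₁, ⟨⟨hl.le, hN, hN2, rfl, rfl, rfl, hT1, ?_, hT1T, hTpi, ?_, ?_, ?_⟩, ?_, ?_, ?_, ?_, ?_,
    ?_, ?_, ?_, ?_, ?_, ?_⟩⟩
  · rw [r3, hcube]
  · linarith [B.hστ]
  · rw [r4]
    have : lam * (A₄ * T ^ 2) ≤ lam * (τ * A₂) := by gcongr
    have e : lam * (τ * A₂) = τ * N ^ 2 := by rw [hN2]; ring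
    linarith
  · refine B.hb1.trans ?_
    have hb := B.hb
    have : T ^ 2 / 24 ≤ 9.87 / (24 * (k + 1 / 2 : ℝ) ^ 2) := by
      rw [hTdef, div_pow, div_div, mul_comm]; gcongr
    gcongr
  · rw [r3]; exact hR3
  · rw [r4, hN4]
    calc lam * A₄ ≤ lam * (R₄ * lam * A₂ ^ 2) := by gcongr
      _ = _ := by ring
  · rw [r5, r3, hN2]
    calc lam * A₅ ≤ lam * (R₅ * lam * (A₃ * A₂)) := by gcongr
      _ = _ := by ring
  · rw [r4]; exact hXT
  · rw [r5, r3]; exact hηT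
  · rw [hN2]; exact hd
  · rw [← mul_pow]; gcongr
  · rw [r4]; exact hZ
  · rw [r4, le_div_iff₀ (by positivity)]
    refine le_trans ?_ hZ
    have : q ^ 2 ≤ (N * T₁) ^ 2 := by gcongr
    calc _ ≤ Real.exp (-(N ^ 2 * T₁ ^ 2 / 2 - lam * A₄ * T₁ ^ 4)) * (N * T₁) * (N * T₁) ^ 2 := by
          gcongr
      _ = _ := by ring
  · rw [r3]
    exact B.pmfErr_le hlam (by positivity) hN.le hN2 hQN
  · rw [r3]
    exact B.cdfErr_le hlam (by positivity) hN.le hQN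

lemma at_a₃_pos (hlam : c₀ ≤ k * lam) : 0 < lam * powSum k 3 / 6 := by
  have hk0 := B.kpos
  have hc0 : 0 < c₀ := by linarith [B.hc₀]
  have hl : 0 < lam := pos_of_mul_pos_right (hc0.trans_le hlam) hk0.le
  have := powSum_pos B.hk 3
  positivity

lemma R₄_mul_sq_le {N x : ℝ} (h : lam * powSum k 4 / 24 ≤ R₄ * N ^ 4) {e₄ : ℝ}
    (he : R₄ * (x / (1 - η)) ^ 2 ≤ e₄) :
    lam * powSum k 4 / 24 * (x / (1 - η)) ^ 2 ≤ e₄ * N ^ 4 := by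
  calc lam * powSum k 4 / 24 * (x / (1 - η)) ^ 2 ≤ R₄ * N ^ 4 * (x / (1 - η)) ^ 2 := by gcongr
    _ = R₄ * (x / (1 - η)) ^ 2 * N ^ 4 := by ring
    _ ≤ _ := by gcongr

lemma pmf_succ_lt (hlam : c₀ ≤ k * lam) (hm : k + 1 ≤ m) (hs0 : 0 ≤ s)
    (hs : (m : ℝ) + 1 / 2 = lam * powSum k 1 - s) {x e₄ E : ℝ} (hx0 : 0 ≤ x)
    (hx : s * powSum k 2 ≤ x * (powSum k 3 / 6)) (hxq : x ≤ (1 - η) * q ^ 2)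
    (he₄ : R₄ * (x / (1 - η)) ^ 2 ≤ e₄) (hE : Real.exp e₄ ≤ E)
    (hfin : E * x / 3 + 5 / 24 * d + 5 * R₅ + 52.5 * R₃ + Z / (22.5 * (1 / 2 - τ - τ₁)) + eI < 1) :
    poissonOrderKPmf k lam (m + 1) < poissonOrderKPmf k lam m := by
  obtain ⟨N, T₁, A⟩ := B.exists_at hlam
  have hl := A.params.lam_nonneg
  have hη1 := B.hη1
  refine A.params.pmf_succ_lt B.hk hm hs0 hs hx0 ?_ B.hη1 A.hη ?_
    (B.R₄_mul_sq_le A.hR₄ he₄) hE A.hd A.hR₅ A.hR₃ A.hZ A.heI hfin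
  · rw [A.params.N_sq]
    have := mul_le_mul_of_nonneg_left hx hl
    linarith
  · refine hxq.trans ?_
    have h1 : 0 ≤ 1 - η := by linarith
    have := A.hq
    gcongr

lemma half_le_cdf (hlam : c₀ ≤ k * lam) (hs0 : 0 ≤ s)
    (hs : (m : ℝ) + 1 / 2 = lam * powSum k 1 - s) {x e₄ E : ℝ} (hx0 : 0 ≤ x)
    (hx : s * powSum k 2 ≤ x * (powSum k 3 / 6)) (hxq : x ≤ (1 - η) * q ^ 2)
    (he₄ : R₄ * (x / (1 - η)) ^ 2 ≤ e₄) (hE : Real.exp e₄ ≤ E)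
    (hfin : b * E * x + 3 * b * R₅ + 17.5 * b * R₃ +
      b * (Z / q ^ 2) / (7.5 * (1 / 2 - τ - τ₁)) + eJ < 1) :
    1 / 2 ≤ cdf k lam m := by
  obtain ⟨N, T₁, A⟩ := B.exists_at hlam
  have hl := A.params.lam_nonneg
  have hη1 := B.hη1
  refine A.params.half_le_cdf B.hk hs0 hs hx0 ?_ B.hη1 A.hη ?_
    (B.R₄_mul_sq_le A.hR₄ he₄) hE A.hR₅ A.hR₃ A.hZ' A.heJ hfin
  · rw [A.params.N_sq]
    have := mul_le_mul_of_nonneg_left hx hl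
    linarith
  · refine hxq.trans ?_
    have h1 : 0 ≤ 1 - η := by linarith
    have := A.hq
    gcongr

lemma le_a₃_mul (hlam : c₀ ≤ k * lam) {N T₁ x' : ℝ}
    (A : At k R₃ R₄ R₅ X τ₁ τ η q Z eI eJ d b lam N T₁)
    (hx' : s * powSum k 2 ≤ x' * (powSum k 3 / 6)) (hxq : x' ≤ q ^ 2) :
    s ≤ lam * powSum k 3 / 6 * T₁ ^ 2 := by
  have hl := A.params.lam_nonneg
  have hN := A.params.N_pos
  have ha := B.at_a₃_pos hlam
  have h1 := mul_le_mul_of_nonneg_left hx' hl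
  have h2 : s * N ^ 2 ≤ x' * (lam * powSum k 3 / 6) := by rw [A.params.N_sq]; linarith
  have h3 : x' * (lam * powSum k 3 / 6) ≤ N ^ 2 * T₁ ^ 2 * (lam * powSum k 3 / 6) := by
    have := A.hq; gcongr; linarith
  refine le_of_mul_le_mul_right ?_ (show 0 < N ^ 2 by positivity)
  linarith

lemma cdf_lt_half (hlam : c₀ ≤ k * lam) (hs0 : 0 ≤ s)
    (hs : (m : ℝ) + 1 / 2 = lam * powSum k 1 - s) {x x' κ S : ℝ}
    (hx' : s * powSum k 2 ≤ x' * (powSum k 3 / 6)) (hxq : x' ≤ q ^ 2)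
    (hx : x * (powSum k 3 / 6) ≤ s * powSum k 2) (hκ0 : 0 ≤ κ)
    (hκ : Real.exp X ≤ 1 + κ * X) (hS0 : 0 ≤ S) (hS : k * s ^ 3 ≤ S * c₀ * powSum k 3)
    (hfin : b * (1 + S) + 15 * b * κ * R₄ + b * (Z / q ^ 2) / (7.5 * (1 / 2 - τ - τ₁)) + eJ < x) :
    cdf k lam m < 1 / 2 := by
  obtain ⟨N, T₁, A⟩ := B.exists_at hlam
  have hl := A.params.lam_nonneg
  have hk0 := B.kpos
  have h3 := powSum_pos B.hk 3
  refine A.params.cdf_lt_half B.hk hs0 hs (B.le_a₃_mul hlam A hx' hxq) ?_ B.X_pos A.hX hκ0 hκ ?_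
    A.hR₄ A.hZ' A.heJ hfin
  · rw [A.params.N_sq]
    have := mul_le_mul_of_nonneg_left hx hl
    linarith
  · refine le_of_mul_le_mul_left ?_ hk0
    have : S * c₀ * powSum k 3 ≤ S * (k * lam) * powSum k 3 := by gcongr
    linarith

lemma pmf_lt_succ (hlam : c₀ ≤ k * lam) (hs0 : 0 ≤ s)
    (hs : (m : ℝ) + 1 / 2 = lam * powSum k 1 - s) {x x' κ S : ℝ}
    (hx' : s * powSum k 2 ≤ x' * (powSum k 3 / 6)) (hxq : x' ≤ q ^ 2)
    (hx : x * (powSum k 3 / 6) ≤ s * powSum k 2) (hκ0 : 0 ≤ κ)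
    (hκ : Real.exp X ≤ 1 + κ * X) (hS0 : 0 ≤ S)
    (hS : k * (s ^ 3 + s / 4) ≤ S * c₀ * powSum k 3)
    (hc : 6 * (k : ℝ) ^ 3 ≤ c₀ ^ 3)
    (hfin : 1 + S + 35 * κ * R₄ + Z / (22.5 * (1 / 2 - τ - τ₁)) + eI < x / 3) :
    poissonOrderKPmf k lam m < poissonOrderKPmf k lam (m + 1) := by
  obtain ⟨N, T₁, A⟩ := B.exists_at hlam
  have hl := A.params.lam_nonneg
  have hN := A.params.N_pos
  have hk0 := B.kpos
  have hc6 := B.hc₀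
  have h3 := powSum_pos B.hk 3
  refine A.params.pmf_lt_succ B.hk hs0 hs (B.le_a₃_mul hlam A hx' hxq) ?_ B.X_pos A.hX hκ0 hκ ?_
    A.hR₄ A.hZ ?_ hfin
  · rw [A.params.N_sq]
    have := mul_le_mul_of_nonneg_left hx hl
    linarith
  · refine le_of_mul_le_mul_left ?_ hk0
    have : S * c₀ * powSum k 3 ≤ S * (k * lam) * powSum k 3 := by gcongr
    linarith
  · refine le_trans (mul_le_mul_of_nonneg_right ?_ (by positivity)) A.heI
    have hl3 : 6 ≤ lam ^ 3 := by
      have h : c₀ ^ 3 ≤ (k * lam) ^ 3 := by gcongr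
      rw [mul_pow] at h
      refine le_of_mul_le_mul_left (a := (k : ℝ) ^ 3) ?_ (by positivity)
      linarith
    have hK : 0 < Real.pi / (k + 1 / 2) := by have := Real.pi_pos; positivity
    have e1 := Real.exp_pos (-(k * lam))
    have e2 := Real.exp_pos (-(5 / 6 * (k * lam)))
    have h6 : 1 ≤ lam ^ 3 / 6 := by linarith
    have t1 : 4 / (Real.pi / (k + 1 / 2)) ≤ lam ^ 3 / 6 * (4 / (Real.pi / (k + 1 / 2))) :=
      le_mul_of_one_le_left (by positivity) h6
    have t2 : 2 / (Real.pi / (k + 1 / 2)) ≤ lam ^ 3 / 6 * (2 / (Real.pi / (k + 1 / 2))) :=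
      le_mul_of_one_le_left (by positivity) h6
    rw [pmfErr', pmfErr]
    refine add_le_add (mul_le_mul_of_nonneg_left (t1.trans ?_) e1.le)
      (mul_le_mul_of_nonneg_left t2 e2.le)
    have : 0 ≤ k * lam := by positivity
    exact le_add_of_nonneg_left (by positivity)

end

end Base

end PoissonK
namespace PoissonK

open Finset

lemma powSum_sq_three_le (k : ℕ) :
    k * (powSum k 3 / 6) ^ 2 ≤ 3 / 64 * powSum k 2 ^ 3 := by
  rw [powSum_two_eq, powSum_three_eq, ← sub_nonneg]
  ring_nf; positivity

lemma mul_powSum_four_le (k : ℕ) : k * (powSum k 4 / 24) ≤ 0.075 * powSum k 2 ^ 2 := by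
  rw [powSum_two_eq, powSum_four_eq, ← sub_nonneg]
  ring_nf; positivity

lemma mul_powSum_five_le (k : ℕ) :
    k * (powSum k 5 / 120) ≤ 0.1 * ((powSum k 3 / 6) * powSum k 2) := by
  rw [powSum_two_eq, powSum_three_eq, powSum_five_eq, ← sub_nonneg]
  ring_nf; positivity

lemma exp_neg_le_of_sum {x r : ℝ} (n : ℕ) (hx : 0 ≤ x)
    (h : 1 ≤ r * ∑ i ∈ range n, x ^ i / (Nat.factorial i : ℝ)) : Real.exp (-x) ≤ r := by
  have h1 := Real.sum_le_exp_of_nonneg hx n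
  have hp := Real.exp_pos x
  have hr : 0 ≤ r := by
    by_contra hr
    have : 0 ≤ ∑ i ∈ range n, x ^ i / (Nat.factorial i : ℝ) := sum_nonneg fun i _ => by positivity
    have := mul_nonpos_of_nonpos_of_nonneg (not_le.1 hr).le this
    linarith
  rw [Real.exp_neg, inv_le_iff_one_le_mul₀ hp]
  exact h.trans (mul_le_mul_of_nonneg_left h1 hr)

lemma exp_le_of_sum {x r : ℝ} (hx : 0 ≤ x) (hx2 : x ≤ 2)
    (h : ∑ i ∈ range 8, (x / 2) ^ i / (Nat.factorial i : ℝ) + (x / 2) ^ 8 * (8 + 1) /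
      ((Nat.factorial 8 : ℝ) * 8) ≤ r) : Real.exp x ≤ r ^ 2 := by
  have h1 := Real.exp_bound' (show 0 ≤ x / 2 by linarith) (by linarith) (show 0 < 8 by norm_num)
  have e : Real.exp x = Real.exp (x / 2) ^ 2 := by
    rw [← Real.exp_nat_mul]; congr 1; push_cast; ring
  rw [e]
  gcongr
  exact h1.trans (by exact_mod_cast h)

lemma Base.of_ratio {k : ℕ} {c₀ ρ X τ₁ η q Z α β g Q eI eJ d b : ℝ} (hk : 2 ≤ k) (hc₀ : 6 ≤ c₀)
    (hρ0 : 0 < ρ) (hρ : ρ * powSum k 2 ^ 3 ≤ k * (powSum k 3 / 6) ^ 2)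
    (hX0 : 0 < X) (hX : 81 * 0.075 ^ 3 ≤ ρ ^ 2 * (X ^ 3 * c₀))
    (hτ0 : 0 ≤ τ₁) (hτ : 9 * 0.075 ^ 3 ≤ ρ * (τ₁ ^ 3 * c₀ ^ 2)) (hτ1 : 0.24675 + τ₁ < 1 / 2)
    (hη0 : 0 ≤ η) (hη1 : η < 1) (hη : 9 * 0.1 ^ 3 ≤ ρ * (η ^ 3 * c₀ ^ 2))
    (hq0 : 0 < q) (hq3 : 3 ≤ q ^ 2) (hq : q ^ 6 ≤ 192 * c₀)
    (hZ : Real.exp X * (q ^ 3 * Real.exp (-(q ^ 2 / 2))) ≤ Z)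
    (hα : (k : ℝ) + 1 ≤ α * (k + 1 / 2)) (hβ : ((k : ℝ) + 1 / 2) ^ 2 * (k + 1) ≤ β * k ^ 3)
    (hg : (k : ℝ) + 1 / 2 ≤ g * k) (hQ0 : 0 ≤ Q) (hQ : 1 ≤ ρ * (Q ^ 2 * c₀))
    (heI : 8 / 15 * Q * (9.87 * α / 12 * ((c₀ ^ 2 + c₀ ^ 3 + c₀ ^ 4 / 2) * Real.exp (-c₀)) +
      0.1062 * β * c₀ ^ 5 * (2 / 3 * Real.exp (-c₀) + 1 / 3 * Real.exp (-(5 / 6 * c₀)))) ≤ eI)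
    (heJ : Q / 2.5 * ((3.1416 * c₀ + c₀ ^ 2 * 9.87 * α / 2 + 4 * 0.3184 * g * c₀ ^ 2) *
      Real.exp (-c₀) + 2 * 0.3184 * g * c₀ ^ 2 * Real.exp (-(5 / 6 * c₀))) ≤ eJ)
    (hd : k ≤ d * c₀ * powSum k 2)
    (hb : 0 < b) (hb1 : 1 ≤ b * (1 - 9.87 / (24 * (k + 1 / 2) ^ 2))) :
    Base k c₀ (3 / 64 / c₀) (0.075 / c₀) (0.1 / c₀) X τ₁ 0.24675 η q Z α β g Q eI eJ d b := by
  have hk0 : (0 : ℝ) < k := by exact_mod_cast (by omega : 0 < k)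
  have hk2 : (2 : ℝ) ≤ k := by exact_mod_cast hk
  have h2 := powSum_pos hk 2
  have h3 := powSum_pos hk 3
  have h4 := powSum_pos hk 4
  have h5 := powSum_pos hk 5
  have hc : 0 < c₀ := by linarith
  have f3 := powSum_sq_three_le k
  have f4 := mul_powSum_four_le k
  have f5 := mul_powSum_five_le k
  have f43 : (k * (powSum k 4 / 24)) ^ 3 ≤ (0.075 * powSum k 2 ^ 2) ^ 3 := by gcongr
  have f53 : (k * (powSum k 5 / 120)) ^ 3 ≤ (0.1 * ((powSum k 3 / 6) * powSum k 2)) ^ 3 := by gcongr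
  have hρ2 : (ρ * powSum k 2 ^ 3) ^ 2 ≤ (k * (powSum k 3 / 6) ^ 2) ^ 2 := by gcongr
  refine ⟨hk, hc₀, ?_, ?_, ?_, by positivity, by positivity, by positivity, hX0, ?_, hτ0, ?_, ?_,
    hη0, hη1, ?_, hτ1, ?_, hq0, hq3, ?_, hZ, hα, hβ, hg, hQ0, ?_, heI, heJ, hd, hb, hb1⟩
  · rw [div_mul_cancel₀ _ hc.ne']; exact f3
  · rw [div_mul_cancel₀ _ hc.ne']; exact f4
  · rw [div_mul_cancel₀ _ hc.ne']; exact f5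
  · refine le_of_mul_le_mul_left ?_ (show 0 < (k : ℝ) ^ 2 by positivity)
    calc (k : ℝ) ^ 2 * (k * (81 * (powSum k 4 / 24) ^ 3)) = 81 * (k * (powSum k 4 / 24)) ^ 3 := by
          ring
      _ ≤ 81 * (0.075 * powSum k 2 ^ 2) ^ 3 := by gcongr
      _ = 81 * 0.075 ^ 3 * powSum k 2 ^ 6 := by ring
      _ ≤ ρ ^ 2 * (X ^ 3 * c₀) * powSum k 2 ^ 6 := by gcongr
      _ = X ^ 3 * c₀ * (ρ * powSum k 2 ^ 3) ^ 2 := by ring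
      _ ≤ X ^ 3 * c₀ * (k * (powSum k 3 / 6) ^ 2) ^ 2 := by gcongr
      _ = _ := by ring
  · refine le_of_mul_le_mul_left ?_ hk0
    calc (k : ℝ) * (k ^ 2 * (9 * (powSum k 4 / 24) ^ 3)) = 9 * (k * (powSum k 4 / 24)) ^ 3 := by
          ring
      _ ≤ 9 * (0.075 * powSum k 2 ^ 2) ^ 3 := by gcongr
      _ = 9 * 0.075 ^ 3 * powSum k 2 ^ 6 := by ring
      _ ≤ ρ * (τ₁ ^ 3 * c₀ ^ 2) * powSum k 2 ^ 6 := by gcongr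
      _ = τ₁ ^ 3 * c₀ ^ 2 * powSum k 2 ^ 3 * (ρ * powSum k 2 ^ 3) := by ring
      _ ≤ τ₁ ^ 3 * c₀ ^ 2 * powSum k 2 ^ 3 * (k * (powSum k 3 / 6) ^ 2) := by gcongr
      _ = _ := by ring
  · rw [powSum_two_eq, powSum_four_eq, ← sub_nonneg]
    ring_nf; positivity
  · refine le_of_mul_le_mul_left ?_ hk0
    calc (k : ℝ) * (k ^ 2 * (9 * (powSum k 5 / 120) ^ 3)) = 9 * (k * (powSum k 5 / 120)) ^ 3 := by
          ring
      _ ≤ 9 * (0.1 * ((powSum k 3 / 6) * powSum k 2)) ^ 3 := by gcongr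
      _ = 9 * 0.1 ^ 3 * ((powSum k 3 / 6) * powSum k 2) ^ 3 := by ring
      _ ≤ ρ * (η ^ 3 * c₀ ^ 2) * ((powSum k 3 / 6) * powSum k 2) ^ 3 := by gcongr
      _ = η ^ 3 * c₀ ^ 2 * (powSum k 3 / 6) ^ 3 * (ρ * powSum k 2 ^ 3) := by ring
      _ ≤ η ^ 3 * c₀ ^ 2 * (powSum k 3 / 6) ^ 3 * (k * (powSum k 3 / 6) ^ 2) := by gcongr
      _ = _ := by ring
  · have : 6 * (powSum k 3 / 6 * 31) ≤ c₀ * (powSum k 3 / 6 * 31) := by gcongr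
    refine le_trans ?_ (this.trans_eq (by ring))
    rw [powSum_three_eq]
    obtain ⟨t, ht⟩ : ∃ t : ℝ, t = k - 2 := ⟨_, rfl⟩
    have ht0 : 0 ≤ t := by linarith
    have : (k : ℝ) = t + 2 := by linarith
    rw [this, ← sub_nonneg]
    ring_nf; positivity
  · rw [div_mul_eq_mul_div, div_le_iff₀ hc]; linarith
  · calc powSum k 2 ^ 3 ≤ ρ * (Q ^ 2 * c₀) * powSum k 2 ^ 3 := le_mul_of_one_le_left (by positivity) hQ
      _ = Q ^ 2 * c₀ * (ρ * powSum k 2 ^ 3) := by ring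
      _ ≤ Q ^ 2 * c₀ * (k * (powSum k 3 / 6) ^ 2) := by gcongr
      _ = _ := by ring

end PoissonK
namespace PoissonK

open Finset

/-- Some parameter witnesses both that the median exceeds `i` and that `i + 1` is less likely than
an earlier value. -/
def Separated (k i : ℕ) : Prop :=
  ∃ lam : ℝ, 0 < lam ∧ cdf k lam i < 1 / 2 ∧
    ∃ i' ≤ i, poissonOrderKPmf k lam (i + 1) < poissonOrderKPmf k lam i'

section

variable {k : ℕ}

lemma ratio_of_seven_le (hk : 7 ≤ k) :
    0.0435 * powSum k 2 ^ 3 ≤ k * (powSum k 3 / 6) ^ 2 := by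
  have hk7 : (7 : ℝ) ≤ k := by exact_mod_cast hk
  obtain ⟨t, ht⟩ : ∃ t : ℝ, t = k - 7 := ⟨_, rfl⟩
  have ht0 : 0 ≤ t := by linarith
  rw [powSum_two_eq, powSum_three_eq, show (k : ℝ) = t + 7 by linarith, ← sub_nonneg]
  ring_nf; positivity

lemma ratio_of_two_le (hk : 2 ≤ k) :
    0.036 * powSum k 2 ^ 3 ≤ k * (powSum k 3 / 6) ^ 2 := by
  have hk7 : (2 : ℝ) ≤ k := by exact_mod_cast hk
  obtain ⟨t, ht⟩ : ∃ t : ℝ, t = k - 2 := ⟨_, rfl⟩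
  have ht0 : 0 ≤ t := by linarith
  rw [powSum_two_eq, powSum_three_eq, show (k : ℝ) = t + 2 by linarith, ← sub_nonneg]
  ring_nf; positivity

lemma one_le_b_mul {b K : ℝ} (k₀ : ℝ) (hk₀ : 1 ≤ k₀) (hk : k₀ ≤ K) (hb : 0 < b)
    (h : 1 ≤ b * (1 - 9.87 / (24 * (k₀ + 1 / 2) ^ 2))) :
    1 ≤ b * (1 - 9.87 / (24 * (K + 1 / 2) ^ 2)) := by
  refine h.trans ?_
  gcongr

lemma base_fourteen (hk : 7 ≤ k) : Base k 14 (3 / 64 / 14) (0.075 / 14) (0.1 / 14) 1.0886 0.0764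
    0.24675 0.1019 3.728 0.1478 (16 / 15) 1.3121 (15 / 14) 1.2815 0.186 0.00117 (1 / 280)
    1.0074 := by
  have hk7 : (7 : ℝ) ≤ k := by exact_mod_cast hk
  obtain ⟨t, ht⟩ : ∃ t : ℝ, t = k - 7 := ⟨_, rfl⟩
  have ht0 : 0 ≤ t := by linarith
  have hkt : (k : ℝ) = t + 7 := by linarith
  have e1 : Real.exp (-14) ≤ 8.32 / 10 ^ 7 := exp_neg_le_of_sum 45 (by norm_num) (by
    norm_num [sum_range_succ, Nat.factorial])
  have e2 : Real.exp (-(5 / 6 * 14)) ≤ 8.58 / 10 ^ 6 := exp_neg_le_of_sum 45 (by norm_num) (by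
    norm_num [sum_range_succ, Nat.factorial])
  have e3 : Real.exp (-(3.728 ^ 2 / 2)) ≤ 0.0009597 := exp_neg_le_of_sum 30 (by norm_num) (by
    norm_num [sum_range_succ, Nat.factorial])
  have e4 : Real.exp 1.0886 ≤ 1.7235 ^ 2 := exp_le_of_sum (by norm_num) (by norm_num) (by
    norm_num [sum_range_succ, Nat.factorial])
  have p3 := Real.exp_pos (-(3.728 ^ 2 / 2))
  refine Base.of_ratio (ρ := 0.0435) (by omega) (by norm_num) (by norm_num) (ratio_of_seven_le hk)
    (by norm_num) (by norm_num) (by norm_num) (by norm_num) (by norm_num) (by norm_num)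
    (by norm_num) (by norm_num) (by norm_num) (by norm_num) (by norm_num) ?_ ?_ ?_ ?_ (by norm_num)
    (by norm_num) ?_ ?_ ?_ (by norm_num) (one_le_b_mul 7 (by norm_num) hk7 (by norm_num)
      (by norm_num))
  · calc _ ≤ (1.7235 : ℝ) ^ 2 * (3.728 ^ 3 * 0.0009597) := by gcongr
      _ ≤ _ := by norm_num
  · linarith
  · rw [hkt, ← sub_nonneg]; ring_nf; positivity
  · linarith
  · norm_num1 at e1 e2 ⊢; linarith
  · norm_num1 at e1 e2 ⊢; linarith
  · rw [powSum_two_eq, hkt, ← sub_nonneg]; ring_nf; positivity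

lemma base_sixteen (hk : 7 ≤ k) : Base k 16 (3 / 64 / 16) (0.075 / 16) (0.1 / 16) 1.0412 0.0699
    0.24675 0.0932 3.812 0.1098 (16 / 15) 1.3121 (15 / 14) 1.1987 0.0599 0.00024 (1 / 320)
    1.0074 := by
  have hk7 : (7 : ℝ) ≤ k := by exact_mod_cast hk
  obtain ⟨t, ht⟩ : ∃ t : ℝ, t = k - 7 := ⟨_, rfl⟩
  have ht0 : 0 ≤ t := by linarith
  have hkt : (k : ℝ) = t + 7 := by linarith
  have e1 : Real.exp (-16) ≤ 1.13 / 10 ^ 7 := exp_neg_le_of_sum 50 (by norm_num) (by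
    norm_num [sum_range_succ, Nat.factorial])
  have e2 : Real.exp (-(5 / 6 * 16)) ≤ 1.62 / 10 ^ 6 := exp_neg_le_of_sum 45 (by norm_num) (by
    norm_num [sum_range_succ, Nat.factorial])
  have e3 : Real.exp (-(3.812 ^ 2 / 2)) ≤ 0.0006992 := exp_neg_le_of_sum 30 (by norm_num) (by
    norm_num [sum_range_succ, Nat.factorial])
  have e4 : Real.exp 1.0412 ≤ 1.6831 ^ 2 := exp_le_of_sum (by norm_num) (by norm_num) (by
    norm_num [sum_range_succ, Nat.factorial])
  have p3 := Real.exp_pos (-(3.812 ^ 2 / 2))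
  refine Base.of_ratio (ρ := 0.0435) (by omega) (by norm_num) (by norm_num) (ratio_of_seven_le hk)
    (by norm_num) (by norm_num) (by norm_num) (by norm_num) (by norm_num) (by norm_num)
    (by norm_num) (by norm_num) (by norm_num) (by norm_num) (by norm_num) ?_ ?_ ?_ ?_ (by norm_num)
    (by norm_num) ?_ ?_ ?_ (by norm_num) (one_le_b_mul 7 (by norm_num) hk7 (by norm_num)
      (by norm_num))
  · calc _ ≤ (1.6831 : ℝ) ^ 2 * (3.812 ^ 3 * 0.0006992) := by gcongr
      _ ≤ _ := by norm_num
  · linarith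
  · rw [hkt, ← sub_nonneg]; ring_nf; positivity
  · linarith
  · norm_num1 at e1 e2 ⊢; linarith
  · norm_num1 at e1 e2 ⊢; linarith
  · rw [powSum_two_eq, hkt, ← sub_nonneg]; ring_nf; positivity

lemma base_sixty_four {b : ℝ} (hk : 2 ≤ k) (hb : 0 < b)
    (hb1 : 1 ≤ b * (1 - 9.87 / (24 * ((k : ℝ) + 1 / 2) ^ 2))) :
    Base k 64 (3 / 64 / 64) (0.075 / 64) (0.1 / 64) 0.7441 0.0296
    0.24675 0.0394 4.803 0.0023 1.2 2.35 1.25 0.6589 0.0001 0.00001 (1 / 160) b := by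
  have hk7 : (2 : ℝ) ≤ k := by exact_mod_cast hk
  obtain ⟨t, ht⟩ : ∃ t : ℝ, t = k - 2 := ⟨_, rfl⟩
  have ht0 : 0 ≤ t := by linarith
  have hkt : (k : ℝ) = t + 2 := by linarith
  have e0 : Real.exp (-16) ≤ 1.13 / 10 ^ 7 := exp_neg_le_of_sum 50 (by norm_num) (by
    norm_num [sum_range_succ, Nat.factorial])
  have e0' : Real.exp (-(5 / 6 * 16)) ≤ 1.62 / 10 ^ 6 := exp_neg_le_of_sum 45 (by norm_num) (by
    norm_num [sum_range_succ, Nat.factorial])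
  have e1 : Real.exp (-64) ≤ 2 / 10 ^ 28 := by
    rw [show (-64 : ℝ) = (4 : ℕ) * (-16) by norm_num, Real.exp_nat_mul]
    calc _ ≤ (1.13 / 10 ^ 7 : ℝ) ^ 4 := by gcongr
      _ ≤ _ := by norm_num
  have e2 : Real.exp (-(5 / 6 * 64)) ≤ 7 / 10 ^ 24 := by
    rw [show (-(5 / 6 * 64) : ℝ) = (4 : ℕ) * (-(5 / 6 * 16)) by norm_num, Real.exp_nat_mul]
    calc _ ≤ (1.62 / 10 ^ 6 : ℝ) ^ 4 := by gcongr
      _ ≤ _ := by norm_num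
  have e3 : Real.exp (-(4.803 ^ 2 / 2)) ≤ 0.0000098 := exp_neg_le_of_sum 45 (by norm_num) (by
    norm_num [sum_range_succ, Nat.factorial])
  have e4 : Real.exp 0.7441 ≤ 1.4508 ^ 2 := exp_le_of_sum (by norm_num) (by norm_num) (by
    norm_num [sum_range_succ, Nat.factorial])
  have p3 := Real.exp_pos (-(4.803 ^ 2 / 2))
  refine Base.of_ratio (ρ := 0.036) (by omega) (by norm_num) (by norm_num) (ratio_of_two_le hk)
    (by norm_num) (by norm_num) (by norm_num) (by norm_num) (by norm_num) (by norm_num)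
    (by norm_num) (by norm_num) (by norm_num) (by norm_num) (by norm_num) ?_ ?_ ?_ ?_ (by norm_num)
    (by norm_num) ?_ ?_ ?_ hb hb1
  · calc _ ≤ (1.4508 : ℝ) ^ 2 * (4.803 ^ 3 * 0.0000098) := by gcongr
      _ ≤ _ := by norm_num
  · linarith
  · rw [hkt, ← sub_nonneg]; ring_nf; positivity
  · linarith
  · norm_num1 at e1 e2 ⊢; linarith
  · norm_num1 at e1 e2 ⊢; linarith
  · rw [powSum_two_eq, hkt, ← sub_nonneg]; ring_nf; positivity

end

end PoissonK
namespace PoissonK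

open Finset

lemma exp_le_of_mul {x E : ℝ} (hx1 : x < 1) (h : 1 ≤ E * (1 - x)) : Real.exp x ≤ E := by
  have h1 : 1 - x ≤ Real.exp (-x) := by have := Real.add_one_le_exp (-x); linarith
  have hE : 0 ≤ E := by
    by_contra hE
    have := mul_neg_of_neg_of_pos (not_le.1 hE) (sub_pos.2 hx1)
    linarith
  have h2 : 1 ≤ E * Real.exp (-x) := h.trans (mul_le_mul_of_nonneg_left h1 hE)
  rwa [Real.exp_neg, ← div_eq_mul_inv, one_le_div (Real.exp_pos x)] at h2

/-- The scale on which the median lags behind the mean. -/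
noncomputable def lag (k : ℕ) : ℝ := k * (k + 1) / (4 * (2 * k + 1))

lemma powSum_three_eq_lag (k : ℕ) : powSum k 3 / 6 = lag k * powSum k 2 := by
  rw [powSum_three_eq, powSum_two_eq, lag]
  field_simp

lemma mul_lag_cube_le (k : ℕ) : k * lag k ^ 3 ≤ powSum k 3 / 128 := by
  rw [powSum_three_eq, lag, div_pow, mul_div_assoc', div_le_iff₀ (by positivity), ← sub_nonneg]
  ring_nf; positivity

variable {k m n i : ℕ} {lam : ℝ}

lemma le_lag_of_le (c : ℕ) (hc : c ≤ k) : lag c ≤ lag k := by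
  have hc' : (c : ℝ) ≤ k := by exact_mod_cast hc
  obtain ⟨t, ht⟩ : ∃ t : ℝ, t = k - c := ⟨_, rfl⟩
  have ht0 : 0 ≤ t := by linarith
  rw [lag, lag, div_le_div_iff₀ (by positivity) (by positivity), show (k : ℝ) = t + c by linarith,
    ← sub_nonneg]
  ring_nf; positivity

lemma le_lag_seven (hk : 7 ≤ k) : 14 / 15 ≤ lag k := by
  refine le_trans ?_ (le_lag_of_le 7 hk)
  norm_num [lag]

lemma lag_le (k : ℕ) : lag k ≤ (k + 1) / 8 := by
  rw [lag, div_le_div_iff₀ (by positivity) (by positivity), ← sub_nonneg]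
  ring_nf; positivity

lemma mul_eq_of_eq (hk : 0 < k) {s : ℝ} (hs : (m : ℝ) + 1 / 2 = lam * powSum k 1 - s) :
    k * lam = 2 * (m + 1 / 2 + s) / (k + 1) := by
  rw [hs, powSum_one_eq]; field_simp; ring

lemma separated_of_seven_le (hk : 7 ≤ k) (hi : 7 * (k + 1) ≤ i + 1) : Separated k i := by
  have hk0 : (0 : ℝ) < k := by exact_mod_cast (by omega : 0 < k)
  have hi' : (7 : ℝ) * (k + 1) ≤ i + 1 := by exact_mod_cast hi
  have hγ := le_lag_seven hk
  have hp := powSum_pos (k := k) (by omega) 1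
  have hp2 := powSum_pos (k := k) (by omega) 2
  set s : ℝ := 1.35 * lag k with hsdef
  set lam : ℝ := (i + 1 / 2 + s) / powSum k 1 with hl
  have hs : (i : ℝ) + 1 / 2 = lam * powSum k 1 - s := by rw [hl, div_mul_cancel₀ _ hp.ne']; ring
  have hs0 : 0 ≤ s := by rw [hsdef]; linarith
  have hc : (14 : ℝ) ≤ k * lam := by
    rw [mul_eq_of_eq (by omega) hs, le_div_iff₀ (by positivity)]
    linarith
  have hx : s * powSum k 2 = 1.35 * (powSum k 3 / 6) := by
    rw [powSum_three_eq_lag, hsdef]; ring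
  have B := base_fourteen hk
  refine ⟨lam, by positivity, ?_, i, le_rfl, ?_⟩
  · have e4 : Real.exp 1.0886 ≤ 1.7235 ^ 2 := exp_le_of_sum (by norm_num) (by norm_num) (by
      norm_num [sum_range_succ, Nat.factorial])
    refine B.cdf_lt_half hc hs0 hs hx.le (by norm_num) hx.ge (κ := 1.811) (by norm_num)
      (e4.trans (by norm_num)) (S := 1.35 ^ 3 / 128 / 14) (by norm_num) ?_ (by norm_num)
    have := mul_lag_cube_le k
    calc k * s ^ 3 = 1.35 ^ 3 * (k * lag k ^ 3) := by rw [hsdef]; ring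
      _ ≤ 1.35 ^ 3 * (powSum k 3 / 128) := by gcongr
      _ = _ := by ring
  · refine B.pmf_succ_lt hc (by omega) hs0 hs (by norm_num) hx.le (by norm_num) (e₄ := 0.0122)
      (by norm_num) (E := 1.0124) (exp_le_of_mul (by norm_num) (by norm_num)) (by norm_num)

lemma half_le_cdf_pred (hk : 7 ≤ k) (hc : 14 ≤ k * lam) (hm : (m : ℝ) + 1 = lam * powSum k 1) :
    1 / 2 ≤ cdf k lam m := by
  have hγ := le_lag_seven hk
  have hp2 := powSum_pos (k := k) (by omega) 2
  refine (base_fourteen hk).half_le_cdf hc (s := 1 / 2) (by norm_num) (by linarith) (x := 0.54)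
    (by norm_num) ?_ (by norm_num) (e₄ := 0.002) (by norm_num) (E := 1.0021)
    (exp_le_of_mul (by norm_num) (by norm_num)) (by norm_num)
  have : 14 / 15 * powSum k 2 ≤ lag k * powSum k 2 := by gcongr
  rw [powSum_three_eq_lag]
  linarith

lemma strict_of_seven_le (hk : 7 ≤ k) (hc : 16 ≤ k * lam) {s : ℝ}
    (hm : (m : ℝ) + 1 / 2 = lam * powSum k 1 - s) (h1 : 1.2 * lag k ≤ s) (h2 : s ≤ 1.95 * lag k) :
    cdf k lam m < 1 / 2 ∧ poissonOrderKPmf k lam (m + 1) < poissonOrderKPmf k lam m := by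
  have hk0 : (0 : ℝ) < k := by exact_mod_cast (by omega : 0 < k)
  have hγ := le_lag_seven hk
  have hp2 := powSum_pos (k := k) (by omega) 2
  have hp3 := powSum_pos (k := k) (by omega) 3
  have hs0 : 0 ≤ s := by linarith
  have hx1 : 1.2 * (powSum k 3 / 6) ≤ s * powSum k 2 := by
    have : 1.2 * lag k * powSum k 2 ≤ s * powSum k 2 := by gcongr
    rw [powSum_three_eq_lag]; linarith
  have hx2 : s * powSum k 2 ≤ 1.95 * (powSum k 3 / 6) := by
    have : s * powSum k 2 ≤ 1.95 * lag k * powSum k 2 := by gcongr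
    rw [powSum_three_eq_lag]; linarith
  have B := base_sixteen hk
  have hkm : k + 1 ≤ m := by
    have h := lag_le k
    have h3 := mul_eq_of_eq (by omega) hm
    rw [h3, le_div_iff₀ (by positivity)] at hc
    have : (k : ℝ) + 1 ≤ m := by linarith
    exact_mod_cast this
  constructor
  · have e4 : Real.exp 1.0412 ≤ 1.6831 ^ 2 := exp_le_of_sum (by norm_num) (by norm_num) (by
      norm_num [sum_range_succ, Nat.factorial])
    refine B.cdf_lt_half hc hs0 hm hx2 (by norm_num) hx1 (κ := 1.761) (by norm_num)
      (e4.trans (by norm_num)) (S := 1.95 ^ 3 / 128 / 16) (by norm_num) ?_ (by norm_num)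
    have := mul_lag_cube_le k
    calc k * s ^ 3 ≤ k * (1.95 * lag k) ^ 3 := by gcongr
      _ = 1.95 ^ 3 * (k * lag k ^ 3) := by ring
      _ ≤ 1.95 ^ 3 * (powSum k 3 / 128) := by gcongr
      _ = _ := by ring
  · refine B.pmf_succ_lt hc hkm hs0 hm (by norm_num) hx2 (by norm_num) (e₄ := 0.0217)
      (by norm_num) (E := 1.0222) (exp_le_of_mul (by norm_num) (by norm_num)) (by norm_num)

lemma exists_half_integer (hk : 7 ≤ k) :
    ∃ j : ℕ, 1 ≤ j ∧ j ≤ k ∧ 1.2 * lag k ≤ (j : ℝ) + 1 / 2 ∧ (j : ℝ) + 1 / 2 ≤ 1.95 * lag k := by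
  have hγ := le_lag_seven hk
  have key : ∀ j : ℕ, 1 ≤ j → 1.2 * lag k ≤ (j : ℝ) + 1 / 2 → (j : ℝ) + 1 / 2 ≤ 1.95 * lag k →
      ∃ j : ℕ, 1 ≤ j ∧ j ≤ k ∧ 1.2 * lag k ≤ (j : ℝ) + 1 / 2 ∧ (j : ℝ) + 1 / 2 ≤ 1.95 * lag k := by
    intro j hj h1 h2
    refine ⟨j, hj, ?_, h1, h2⟩
    have := lag_le k
    have hk7 : (7 : ℝ) ≤ k := by exact_mod_cast hk
    have : (j : ℝ) ≤ k := by linarith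
    exact_mod_cast this
  rcases Nat.lt_or_ge k 12 with h | h
  · interval_cases k
    · exact key 1 le_rfl (by norm_num [lag]) (by norm_num [lag])
    · exact key 1 le_rfl (by norm_num [lag]) (by norm_num [lag])
    · exact key 1 le_rfl (by norm_num [lag]) (by norm_num [lag])
    · exact key 2 (by norm_num) (by norm_num [lag]) (by norm_num [lag])
    · exact key 2 (by norm_num) (by norm_num [lag]) (by norm_num [lag])
  · have h12 : 39 / 25 ≤ lag k := by
      refine le_trans ?_ (le_lag_of_le 12 h)
      norm_num [lag]
    have h0 : 0 ≤ 1.2 * lag k - 1 / 2 := by linarith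
    refine key ⌈1.2 * lag k - 1 / 2⌉₊ (Nat.one_le_iff_ne_zero.2 ?_) ?_ ?_
    · rw [Ne, Nat.ceil_eq_zero, not_le]; linarith
    · linarith [Nat.le_ceil (1.2 * lag k - 1 / 2)]
    · linarith [Nat.ceil_lt_add_one h0]

lemma base_of_le_six (hk : 2 ≤ k) : ∃ b, b ≤ 1.0713 ∧ (3 ≤ k → b ≤ 1.035) ∧
    (4 ≤ k → b ≤ 1.0208) ∧ Base k 64 (3 / 64 / 64) (0.075 / 64) (0.1 / 64) 0.7441 0.0296
    0.24675 0.0394 4.803 0.0023 1.2 2.35 1.25 0.6589 0.0001 0.00001 (1 / 160) b ∧ 0 < b := by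
  have hk2 : (2 : ℝ) ≤ k := by exact_mod_cast hk
  rcases Nat.lt_or_ge k 4 with h | h
  · rcases Nat.lt_or_ge k 3 with h' | h'
    · exact ⟨1.0713, le_rfl, by omega, by omega, base_sixty_four hk (by norm_num)
        (one_le_b_mul 2 (by norm_num) hk2 (by norm_num) (by norm_num)), by norm_num⟩
    · have hk3 : (3 : ℝ) ≤ k := by exact_mod_cast h'
      exact ⟨1.035, by norm_num, fun _ => le_rfl, by omega, base_sixty_four hk (by norm_num)
        (one_le_b_mul 3 (by norm_num) hk3 (by norm_num) (by norm_num)), by norm_num⟩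
  · have hk4 : (4 : ℝ) ≤ k := by exact_mod_cast h
    exact ⟨1.0208, by norm_num, fun _ => by norm_num, fun _ => le_rfl,
      base_sixty_four hk (by norm_num)
        (one_le_b_mul 4 (by norm_num) hk4 (by norm_num) (by norm_num)), by norm_num⟩

lemma exp_X_le : Real.exp 0.7441 ≤ 1 + 1.485 * 0.7441 :=
  (exp_le_of_sum (r := 1.4508) (by norm_num) (by norm_num) (by
    norm_num [sum_range_succ, Nat.factorial])).trans (by norm_num)

/-- `k = 4, 5, 6`. -/
lemma strict_of_le_six (hk : 4 ≤ k) (hk6 : k ≤ 6) (hc : 64 ≤ k * lam)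
    (hm : (m : ℝ) + 2 = lam * powSum k 1) :
    cdf k lam m < 1 / 2 ∧ poissonOrderKPmf k lam (m + 1) < poissonOrderKPmf k lam m := by
  obtain ⟨b, -, -, hb, B, hb0⟩ := base_of_le_six (k := k) (by omega)
  have hb := hb hk
  have hm' : (m : ℝ) + 1 / 2 = lam * powSum k 1 - 3 / 2 := by linarith
  have hkm : k + 1 ≤ m := by
    have h3 := mul_eq_of_eq (by omega) hm'
    rw [h3, le_div_iff₀ (by positivity)] at hc
    have : (k : ℝ) + 1 ≤ m := by
      have : (k : ℝ) ≤ 6 := by exact_mod_cast hk6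
      linarith
    exact_mod_cast this
  have hk4 : (4 : ℝ) ≤ k := by exact_mod_cast hk
  have hx1 : 1.7 * (powSum k 3 / 6) ≤ 3 / 2 * powSum k 2 := by
    rw [powSum_two_eq, powSum_three_eq]
    interval_cases k <;> norm_num
  have hx2 : 3 / 2 * powSum k 2 ≤ 2.7 * (powSum k 3 / 6) := by
    rw [powSum_two_eq, powSum_three_eq]
    interval_cases k <;> norm_num
  constructor
  · refine B.cdf_lt_half hc (by norm_num) hm' hx2 (by norm_num) hx1 (κ := 1.485) (by norm_num)
      exp_X_le (S := 0.01) (by norm_num) ?_ ?_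
    · rw [powSum_three_eq]
      interval_cases k <;> norm_num
    · ring_nf; linarith
  · exact B.pmf_succ_lt hc hkm (by norm_num) hm' (by norm_num) hx2 (by norm_num) (e₄ := 0.0093)
      (by norm_num) (E := 1.0094) (exp_le_of_mul (by norm_num) (by norm_num)) (by norm_num)

lemma half_le_cdf_pred_of_le_six (hk : 4 ≤ k) (hk6 : k ≤ 6) (hc : 64 ≤ k * lam)
    (hm : (m : ℝ) + 1 = lam * powSum k 1) : 1 / 2 ≤ cdf k lam m := by
  obtain ⟨b, -, -, hb, B, hb0⟩ := base_of_le_six (k := k) (by omega)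
  have hb := hb hk
  have hx2 : 1 / 2 * powSum k 2 ≤ 0.9 * (powSum k 3 / 6) := by
    rw [powSum_two_eq, powSum_three_eq]
    interval_cases k <;> norm_num
  refine B.half_le_cdf hc (s := 1 / 2) (by norm_num) (by linarith) (by norm_num) hx2 (by norm_num)
    (e₄ := 0.0011) (by norm_num) (E := 1.0012) (exp_le_of_mul (by norm_num) (by norm_num)) ?_
  ring_nf; linarith

lemma half_le_cdf_of_le_three (hk : 2 ≤ k) (hc : 64 ≤ k * lam)
    (hm : (m : ℝ) + 1 / 2 = lam * powSum k 1) : 1 / 2 ≤ cdf k lam m := by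
  obtain ⟨b, hb, -, -, B, hb0⟩ := base_of_le_six (k := k) (by omega)
  have hp := powSum_pos (k := k) (by omega) 3
  refine B.half_le_cdf hc (s := 0) (by norm_num) (by linarith) (x := 0) (by norm_num)
    (by simp) (by norm_num)
    (e₄ := 0.0011) (by norm_num) (E := 1.0012) (exp_le_of_mul (by norm_num) (by norm_num)) ?_
  ring_nf; linarith

/-- `k = 2, 3`. -/
lemma cdf_pred_lt_half_of_le_three (hk : 2 ≤ k) (hk3 : k ≤ 3) (hc : 64 ≤ k * lam)
    (hm : (m : ℝ) + 1 = lam * powSum k 1) :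
    cdf k lam m < 1 / 2 ∧ poissonOrderKPmf k lam (m + 1) < poissonOrderKPmf k lam m := by
  obtain ⟨b, hb, hb3, -, B, hb0⟩ := base_of_le_six (k := k) (by omega)
  have hm' : (m : ℝ) + 1 / 2 = lam * powSum k 1 - 1 / 2 := by linarith
  have hkm : k + 1 ≤ m := by
    have h3 := mul_eq_of_eq (by omega) hm'
    rw [h3, le_div_iff₀ (by positivity)] at hc
    have : (k : ℝ) + 1 ≤ m := by
      have : (k : ℝ) ≤ 3 := by exact_mod_cast hk3
      linarith
    exact_mod_cast this
  obtain ⟨x, hx0, hx, hx2, hbx⟩ : ∃ x : ℝ, x * (powSum k 3 / 6) = 1 / 2 * powSum k 2 ∧ 0 ≤ x ∧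
      x ≤ 5 / 3 ∧ b * 1.04 + 0.001 < x := by
    rw [powSum_two_eq, powSum_three_eq]
    interval_cases k
    · exact ⟨5 / 3, by norm_num, by norm_num, le_rfl, by linarith⟩
    · have := hb3 le_rfl
      exact ⟨7 / 6, by norm_num, by norm_num, by norm_num, by linarith⟩
  constructor
  · refine B.cdf_lt_half hc (by norm_num) hm' hx0.ge (by linarith) hx0.le (κ := 1.485)
      (by norm_num) exp_X_le (S := 0.001) (by norm_num) ?_ ?_
    · rw [powSum_three_eq]
      interval_cases k <;> norm_num
    · ring_nf; linarith
  · refine B.pmf_succ_lt hc hkm (by norm_num) hm' hx hx0.ge (by linarith) (e₄ := 0.0093)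
      ?_ (E := 1.0094) (exp_le_of_mul (by norm_num) (by norm_num)) (by linarith)
    calc _ ≤ 0.075 / 64 * ((5 / 3) / (1 - 0.0394)) ^ 2 := by gcongr
      _ ≤ (0.0093 : ℝ) := by norm_num

lemma pmf_lt_succ_of_le_three (hk : 2 ≤ k) (hk3 : k ≤ 3) (hc : 64 ≤ k * lam)
    (hm : (m : ℝ) + 2 = lam * powSum k 1) :
    poissonOrderKPmf k lam m < poissonOrderKPmf k lam (m + 1) := by
  obtain ⟨b, -, -, -, B, hb0⟩ := base_of_le_six (k := k) (by omega)
  have hm' : (m : ℝ) + 1 / 2 = lam * powSum k 1 - 3 / 2 := by linarith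
  refine B.pmf_lt_succ hc (by norm_num) hm' (x := 3.5) (x' := 5) ?_ (by norm_num) ?_ (κ := 1.485)
    (by norm_num) exp_X_le (S := 0.02) (by norm_num) ?_ ?_ (by norm_num)
  · rw [powSum_two_eq, powSum_three_eq]
    interval_cases k <;> norm_num
  · rw [powSum_two_eq, powSum_three_eq]
    interval_cases k <;> norm_num
  · rw [powSum_three_eq]
    interval_cases k <;> norm_num
  · interval_cases k <;> norm_num

end PoissonK

namespace PoissonK

open Finset

/-- Iterated backward differences with step one. -/
def bdiff : ℕ → (ℝ → ℝ) → ℝ → ℝ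
  | 0, f, w => f w
  | r + 1, f, w => bdiff r f w - bdiff r f (w - 1)

lemma bdiff_zero (f : ℝ → ℝ) (w : ℝ) : bdiff 0 f w = f w := rfl

lemma bdiff_succ (r : ℕ) (f : ℝ → ℝ) (w : ℝ) :
    bdiff (r + 1) f w = bdiff r f w - bdiff r f (w - 1) := rfl

lemma bdiff_add (r s : ℕ) (f : ℝ → ℝ) (w : ℝ) : bdiff (r + s) f w = bdiff s (bdiff r f) w := by
  induction s generalizing w with
  | zero => rfl
  | succ s ih => rw [← add_assoc, bdiff_succ, bdiff_succ, ih, ih]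

lemma bdiff_eq_sum (r : ℕ) (f : ℝ → ℝ) (w : ℝ) :
    bdiff r f w = ∑ i ∈ range (r + 1), (-1) ^ i * (r.choose i : ℝ) * f (w - i) := by
  induction r generalizing w with
  | zero => simp [bdiff]
  | succ r ih =>
    rw [bdiff_succ, ih, ih, sum_range_succ' _ (r + 1)]
    have h1 : ∑ i ∈ range (r + 1), (-1) ^ i * (r.choose i : ℝ) * f (w - i) =
        ∑ i ∈ range (r + 1), (-1) ^ (i + 1) * (r.choose (i + 1) : ℝ) * f (w - (i + 1 : ℕ)) +
          f w := by
      rw [sum_range_succ', sum_range_succ _ r]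
      simp
    rw [h1, add_sub_right_comm, ← sum_sub_distrib]
    simp only [pow_zero, Nat.choose_zero_right, Nat.cast_one, one_mul, Nat.cast_zero, sub_zero]
    congr 1
    refine sum_congr rfl fun i _ => ?_
    rw [Nat.choose_succ_succ, show w - 1 - (i : ℝ) = w - ((i + 1 : ℕ) : ℝ) by push_cast; ring]
    push_cast; ring

/-- The truncated divided power. -/
noncomputable def tpow (p : ℕ) (w : ℝ) : ℝ := max w 0 ^ p / p.factorial

lemma hasDerivAt_tpow {p : ℕ} (hp : 1 ≤ p) (w : ℝ) : HasDerivAt (tpow (p + 1)) (tpow p w) w := by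
  have hpoly : ∀ w : ℝ, HasDerivAt (fun x : ℝ => x ^ (p + 1) / (p + 1).factorial)
      (w ^ p / p.factorial) w := fun w => by
    refine ((hasDerivAt_pow (p + 1) w).div_const _).congr_deriv ?_
    rw [Nat.factorial_succ]; push_cast
    have : (p.factorial : ℝ) ≠ 0 := by positivity
    field_simp
  have hneg : ∀ x : ℝ, x ≤ 0 → ∀ q, 1 ≤ q → tpow q x = 0 := fun x hx q hq => by
    rw [tpow, max_eq_right hx, zero_pow (by omega), zero_div]
  have hpos : ∀ x : ℝ, 0 ≤ x → ∀ q, tpow q x = x ^ q / q.factorial := fun x hx q => by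
    rw [tpow, max_eq_left hx]
  rcases lt_trichotomy w 0 with h | h | h
  · rw [hneg w h.le p hp]
    refine (hasDerivAt_const w (0 : ℝ)).congr_of_eventuallyEq ?_
    filter_upwards [Iio_mem_nhds h] with x hx using hneg x (le_of_lt hx) _ (by omega)
  · subst h
    have h1 : HasDerivWithinAt (tpow (p + 1)) (tpow p 0) (Set.Iic 0) 0 := by
      rw [hneg 0 le_rfl p hp]
      exact (hasDerivWithinAt_const (0 : ℝ) _ (0 : ℝ)).congr
        (fun x hx => hneg x hx _ (by omega)) (hneg 0 le_rfl _ (by omega))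
    have h2 : HasDerivWithinAt (tpow (p + 1)) (tpow p 0) (Set.Ici 0) 0 := by
      rw [hpos 0 le_rfl p]
      exact (hpoly 0).hasDerivWithinAt.congr (fun x hx => hpos x hx _) (hpos 0 le_rfl _)
    have := h1.union h2
    rwa [Set.Iic_union_Ici, hasDerivWithinAt_univ] at this
  · rw [hpos w h.le p]
    refine (hpoly w).congr_of_eventuallyEq ?_
    filter_upwards [Ioi_mem_nhds h] with x hx using hpos x (le_of_lt hx) _

lemma hasDerivAt_bdiff {f f' : ℝ → ℝ} (h : ∀ w, HasDerivAt f (f' w) w) (r : ℕ) (w : ℝ) :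
    HasDerivAt (bdiff r f) (bdiff r f' w) w := by
  induction r generalizing w with
  | zero => exact h w
  | succ r ih => exact (ih w).sub ((ih (w - 1)).comp_sub_const w 1)

lemma hasDerivAt_bdiff_tpow {p : ℕ} (hp : 1 ≤ p) (r : ℕ) (w : ℝ) :
    HasDerivAt (bdiff r (tpow (p + 1))) (bdiff r (tpow p) w) w :=
  hasDerivAt_bdiff (hasDerivAt_tpow hp) r w

lemma tpow_one (w : ℝ) : tpow 1 w = max w 0 := by simp [tpow]

/-- `f` is Lipschitz with constant `L`. -/
def Lip (L : ℝ) (f : ℝ → ℝ) : Prop := ∀ v w, v ≤ w → |f w - f v| ≤ L * (w - v)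

lemma Lip.abs_sub_le_mul {L : ℝ} {f : ℝ → ℝ} (h : Lip L f) (v w : ℝ) : |f w - f v| ≤ L * |w - v| := by
  rcases le_total v w with hvw | hvw
  · rw [abs_of_nonneg (sub_nonneg.2 hvw)]; exact h v w hvw
  · rw [abs_sub_comm, abs_sub_comm w v, abs_of_nonneg (sub_nonneg.2 hvw)]; exact h w v hvw

lemma Lip.of_deriv {L : ℝ} {f f' : ℝ → ℝ} (hf : ∀ w, HasDerivAt f (f' w) w)
    (h : ∀ w, |f' w| ≤ L) : Lip L f := by
  intro v w hvw
  have := Convex.norm_image_sub_le_of_norm_hasDerivWithin_le (f := f) (f' := f') (C := L)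
    (s := Set.univ) (x := v) (y := w) (fun x _ => (hf x).hasDerivWithinAt) (fun x _ => h x)
    convex_univ trivial trivial
  rwa [Real.norm_eq_abs, Real.norm_eq_abs, abs_of_nonneg (sub_nonneg.2 hvw)] at this

lemma lip_bdiff_of_lip {L : ℝ} {p r : ℕ} (hp : 1 ≤ p) (h : Lip L (bdiff r (tpow p))) :
    Lip L (bdiff (r + 1) (tpow (p + 1))) := by
  refine Lip.of_deriv (hasDerivAt_bdiff_tpow hp (r + 1)) fun w => ?_
  rw [bdiff_succ]
  simpa using h (w - 1) w (by linarith)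

lemma tpow_one_mono {v w : ℝ} (h : v ≤ w) : tpow 1 v ≤ tpow 1 w := by
  rw [tpow_one, tpow_one]; exact max_le_max_right 0 h

lemma tpow_one_sub_le {v w : ℝ} (h : v ≤ w) : tpow 1 w - tpow 1 v ≤ w - v := by
  rw [tpow_one, tpow_one, sub_le_iff_le_add]
  exact max_le (by linarith [le_max_left v 0]) (by linarith [le_max_right v 0])

lemma bdiff_one_tpow_mono {v w : ℝ} (h : v ≤ w) : bdiff 1 (tpow 1) v ≤ bdiff 1 (tpow 1) w := by
  have e : ∀ x : ℝ, bdiff 1 (tpow 1) x = max (min x 1) 0 := fun x => by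
    rw [bdiff_succ, bdiff_zero, bdiff_zero, tpow_one, tpow_one]
    rcases le_total x 0 with h0 | h0
    · rw [max_eq_right h0, max_eq_right (by linarith), max_eq_right ((min_le_left _ _).trans h0)]
      simp
    · rcases le_total x 1 with h1 | h1
      · rw [max_eq_left h0, max_eq_right (by linarith), min_eq_left h1, max_eq_left h0]; simp
      · rw [max_eq_left h0, max_eq_left (by linarith), min_eq_right h1,
          max_eq_left zero_le_one]; ring
  rw [e, e]; exact max_le_max_right 0 (min_le_min_right 1 h)

lemma lip_two (p : ℕ) : Lip 1 (bdiff (p + 2) (tpow (p + 1))) := by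
  induction p with
  | zero =>
    intro v w h
    have h0 := bdiff_one_tpow_mono h
    have h1 := bdiff_one_tpow_mono (sub_le_sub_right h 1)
    have h2 := tpow_one_sub_le h
    have h3 := tpow_one_mono (sub_le_sub_right (sub_le_sub_right h 1) 1)
    simp only [zero_add, bdiff_succ, bdiff_zero] at *
    rw [abs_le]; constructor <;> linarith
  | succ p ih => exact lip_bdiff_of_lip (by omega) ih

lemma lip_four (p : ℕ) : Lip 3 (bdiff (p + 4) (tpow (p + 1))) := by
  induction p with
  | zero =>
    intro v w h
    have s := sub_le_sub_right h 1
    have s2 := sub_le_sub_right s 1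
    have s3 := sub_le_sub_right s2 1
    have h0 := bdiff_one_tpow_mono h
    have h1 := bdiff_one_tpow_mono s
    have h2 := bdiff_one_tpow_mono s2
    have h3 := bdiff_one_tpow_mono s3
    have h4 := tpow_one_sub_le h
    have h5 := tpow_one_mono (sub_le_sub_right s3 1)
    simp only [zero_add, bdiff_succ, bdiff_zero] at *
    rw [abs_le]; constructor <;> linarith
  | succ p ih => exact lip_bdiff_of_lip (by omega) ih

/-- The distribution function of a sum of `p` independent uniform variables on `[0, 1]`. -/
noncomputable def unif (p : ℕ) : ℝ → ℝ := bdiff p (tpow p)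

lemma unif_mono (p : ℕ) : Monotone (unif (p + 1)) := by
  induction p with
  | zero => exact fun v w h => bdiff_one_tpow_mono h
  | succ p ih =>
    refine monotone_of_deriv_nonneg
      (fun w => (hasDerivAt_bdiff_tpow (by omega) (p + 2) w).differentiableAt) fun w => ?_
    rw [unif, (hasDerivAt_bdiff_tpow (by omega) (p + 2) w).deriv, bdiff_succ, sub_nonneg]
    exact ih (by linarith)

lemma le_of_hasDerivAt_le {g g' G G' : ℝ → ℝ} (hg : ∀ x, HasDerivAt g (g' x) x)
    (hG : ∀ x, HasDerivAt G (G' x) x) (h : ∀ x, 0 ≤ x → g' x ≤ G' x) (h0 : g 0 = G 0) {d : ℝ}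
    (hd : 0 ≤ d) : g d ≤ G d := by
  have hs : ∀ x, HasDerivAt (fun x => G x - g x) (G' x - g' x) x := fun x => (hG x).sub (hg x)
  have hm : MonotoneOn (fun x => G x - g x) (Set.Ici 0) := by
    refine monotoneOn_of_deriv_nonneg (convex_Ici 0)
      (fun x _ => (hs x).continuousAt.continuousWithinAt)
      (fun x _ => (hs x).differentiableAt.differentiableWithinAt) fun x hx => ?_
    rw [interior_Ici] at hx
    rw [(hs x).deriv]
    exact sub_nonneg.2 (h x (le_of_lt hx))
  have := hm (Set.mem_Ici.2 le_rfl) (Set.mem_Ici.2 hd) hd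
  simp only [h0, sub_self] at this
  linarith

lemma abs_le_of_hasDerivAt {g g' G G' : ℝ → ℝ} (hg : ∀ x, HasDerivAt g (g' x) x)
    (hG : ∀ x, HasDerivAt G (G' x) x) (h : ∀ x, 0 ≤ x → |g' x| ≤ G' x) (h0 : g 0 = 0)
    (h0' : G 0 = 0) {d : ℝ} (hd : 0 ≤ d) : |g d| ≤ G d := by
  refine abs_le'.2 ⟨le_of_hasDerivAt_le hg hG (fun x hx => (le_abs_self _).trans (h x hx))
    (h0.trans h0'.symm) hd, ?_⟩
  exact le_of_hasDerivAt_le (fun x => (hg x).neg) hG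
    (fun x hx => (neg_le_abs _).trans (h x hx)) (by simp [h0, h0']) hd

/-- Taylor's formula of order two. -/
lemma Lip.abs_taylor_le {L : ℝ} {f f' : ℝ → ℝ} (hf : ∀ w, HasDerivAt f (f' w) w) (h : Lip L f')
    (a d : ℝ) : |f (a + d) - f a - f' a * d| ≤ L * d ^ 2 / 2 := by
  have key : ∀ (s : ℝ), s ^ 2 = 1 → ∀ x, 0 ≤ x →
      |f (a + s * x) - f a - f' a * (s * x)| ≤ L * x ^ 2 / 2 := fun s hs x hx => by
    have hs' : |s| = 1 := by rw [← Real.sqrt_sq_eq_abs, hs, Real.sqrt_one]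
    refine abs_le_of_hasDerivAt (g := fun x => f (a + s * x) - f a - f' a * (s * x))
      (g' := fun x => s * (f' (a + s * x) - f' a)) (G := fun x => L * x ^ 2 / 2)
      (G' := fun x => L * x) (fun x => ?_) (fun x => ?_) (fun x hx => ?_) (by simp) (by simp) hx
    · have h1 : HasDerivAt (fun x => a + s * x) s x := by
        simpa using ((hasDerivAt_id x).const_mul s).const_add a
      have h2 : HasDerivAt (fun x => s * x) s x := by
        simpa using (hasDerivAt_id x).const_mul s
      exact ((((hf (a + s * x)).comp x h1).sub_const (f a)).sub (h2.const_mul (f' a))).congr_deriv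
        (by ring)
    · exact (((hasDerivAt_pow 2 x).const_mul L).div_const 2).congr_deriv (by simp; ring)
    · rw [abs_mul, hs', one_mul]
      have := h.abs_sub_le_mul a (a + s * x)
      rwa [add_sub_cancel_left, abs_mul, hs', one_mul, abs_of_nonneg hx] at this
  rcases le_total 0 d with hd | hd
  · simpa using key 1 (by norm_num) d hd
  · simpa using key (-1) (by norm_num) (-d) (by linarith)

/-- The error of the midpoint rule. -/
lemma Lip.abs_midpoint_le {L : ℝ} {F f f' : ℝ → ℝ} (hF : ∀ w, HasDerivAt F (f w) w)
    (hf : ∀ w, HasDerivAt f (f' w) w) (h : Lip L f') (a : ℝ) {d : ℝ} (hd : 0 ≤ d) :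
    |F (a + d) - F (a - d) - 2 * d * f a| ≤ L * d ^ 3 / 3 := by
  refine abs_le_of_hasDerivAt (g := fun x => F (a + x) - F (a - x) - 2 * x * f a)
    (g' := fun x => f (a + x) + f (a - x) - 2 * f a) (G := fun x => L * x ^ 3 / 3)
    (G' := fun x => L * x ^ 2) (fun x => ?_) (fun x => ?_) (fun x hx => ?_) (by simp) (by simp) hd
  · have h1 : HasDerivAt (fun x => F (a + x)) (f (a + x)) x := (hF (a + x)).comp_const_add a x
    have h2 : HasDerivAt (fun x => F (a - x)) (-f (a - x)) x := (hF (a - x)).comp_const_sub a x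
    have h3 : HasDerivAt (fun x => 2 * x * f a) (2 * 1 * f a) x :=
      ((hasDerivAt_id x).const_mul 2).mul_const (f a)
    exact ((h1.sub h2).sub h3).congr_deriv (by ring)
  · exact (((hasDerivAt_pow 3 x).const_mul L).div_const 3).congr_deriv (by simp; ring)
  · have h1 := abs_le.1 (h.abs_taylor_le hf a x)
    have h2 := abs_le.1 (h.abs_taylor_le hf a (-x))
    rw [← sub_eq_add_neg] at h2
    rw [abs_le]; constructor <;> nlinarith

end PoissonK

namespace PoissonK

open Finset

lemma cum_one (k : ℕ) (y : ℤ) : (cum k 1 y : ℝ) = tpow 1 y - tpow 1 (y - k) := by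
  induction k with
  | zero => simp [cum]
  | succ k ih =>
    have h : (cum (k + 1) 1 y : ℝ) = cum k 1 y + if (k : ℤ) + 1 ≤ y then 1 else 0 := by
      simp only [cum, sum_range_succ]; push_cast; simp
    rw [h, ih]
    simp only [tpow_one]
    push_cast
    split_ifs with h1
    · have : (k : ℝ) + 1 ≤ y := by exact_mod_cast h1
      rw [max_eq_left (show (0 : ℝ) ≤ y - k by linarith),
        max_eq_left (show (0 : ℝ) ≤ y - (k + 1) by linarith)]; ring
    · have : (y : ℝ) ≤ k := by exact_mod_cast (show y ≤ k by omega)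
      rw [max_eq_right (show (y : ℝ) - k ≤ 0 by linarith),
        max_eq_right (show (y : ℝ) - (k + 1) ≤ 0 by linarith)]; ring

/-- The triangular number of `y - 1`, in terms of truncated powers. -/
noncomputable def tri (y : ℤ) : ℝ := tpow 2 (y - 1 / 2) - if 1 ≤ y then 1 / 8 else 0

lemma tri_sub_tri (y : ℤ) : tri y - tri (y - 1) = tpow 1 (y - 1) := by
  rw [tri, tri, tpow_one, tpow, tpow]
  push_cast
  rcases lt_trichotomy y 1 with h | h | h
  · have : (y : ℝ) ≤ 0 := by exact_mod_cast (show y ≤ 0 by omega)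
    rw [if_neg (by omega), if_neg (by omega), max_eq_right (by linarith),
      max_eq_right (by linarith), max_eq_right (by linarith)]; norm_num
  · subst h; norm_num
  · have : (2 : ℝ) ≤ y := by exact_mod_cast (show 2 ≤ y by omega)
    rw [if_pos (by omega), if_pos (by omega), max_eq_left (by linarith),
      max_eq_left (by linarith), max_eq_left (by linarith), Nat.factorial_two]; push_cast; ring

lemma sum_tpow_one (n : ℕ) (y : ℤ) :
    ∑ i ∈ range n, tpow 1 (y - (i + 1)) = tri y - tri (y - n) := by
  induction n with
  | zero => simp
  | succ n ih =>
    rw [sum_range_succ, ih]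
    have := tri_sub_tri (y - n)
    push_cast at this ⊢
    rw [show (y : ℝ) - (n + 1) = y - n - 1 by ring, ← this,
      show y - ((n : ℤ) + 1) = y - n - 1 by ring]
    ring

lemma cum_two (k : ℕ) (y : ℤ) :
    (cum k 2 y : ℝ) = tri y - 2 * tri (y - k) + tri (y - k - k) := by
  rw [cum_succ, Nat.cast_sum, sum_congr rfl fun (i : ℕ) _ => cum_one k (y - (i + 1)),
    sum_sub_distrib]
  have h1 := sum_tpow_one k y
  have h2 := sum_tpow_one k (y - k)
  push_cast at h1 h2 ⊢
  rw [h1, sum_congr rfl fun (i : ℕ) _ => show tpow 1 ((y : ℝ) - (i + 1) - k) =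
    tpow 1 ((y : ℝ) - k - (i + 1)) by ring_nf, h2]
  ring

lemma tpow_div {k : ℝ} (hk : 0 < k) (p : ℕ) (w : ℝ) : tpow p (w / k) = tpow p w / k ^ p := by
  have : max (w / k) 0 = max w 0 / k := by
    rw [← max_div_div_right hk.le, zero_div]
  rw [tpow, tpow, this, div_pow]; ring

/-- The bound for the distance between the discrete and the continuous distribution. -/
noncomputable def discErr (k p : ℕ) : ℝ := if p = 1 then 0 else (p + 1) / (24 * (k : ℝ) ^ 2)

lemma abs_cum_one_sub_unif {k : ℕ} (hk : 1 ≤ k) (y : ℤ) :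
    (cum k 1 y : ℝ) / k = unif 1 (y / k) := by
  have hk' : (0 : ℝ) < k := by exact_mod_cast hk
  rw [cum_one, unif, bdiff_succ, bdiff_zero, bdiff_zero,
    show (y : ℝ) / k - 1 = (y - k) / k by field_simp, tpow_div hk', tpow_div hk', pow_one, sub_div]

lemma abs_cum_two_sub_unif {k : ℕ} (hk : 1 ≤ k) (y : ℤ) :
    |(cum k 2 y : ℝ) / (k : ℝ) ^ 2 - unif 2 ((y - 1 / 2) / k)| ≤ 1 / (8 * (k : ℝ) ^ 2) := by
  have hk' : (0 : ℝ) < k := by exact_mod_cast hk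
  have e : (cum k 2 y : ℝ) / (k : ℝ) ^ 2 - unif 2 ((y - 1 / 2) / k) =
      -((if 1 ≤ y then 1 / 8 else 0) - 2 * (if 1 ≤ y - k then 1 / 8 else 0) +
        if 1 ≤ y - k - k then 1 / 8 else 0) / (k : ℝ) ^ 2 := by
    rw [cum_two, unif, bdiff_succ, bdiff_succ, bdiff_succ, bdiff_zero, bdiff_zero, bdiff_zero,
      show ((y : ℝ) - 1 / 2) / k - 1 = (((y - k : ℤ) : ℝ) - 1 / 2) / k by
        push_cast; field_simp; ring,
      show (((y - k : ℤ) : ℝ) - 1 / 2) / k - 1 = (((y - k - k : ℤ) : ℝ) - 1 / 2) / k by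
        push_cast; field_simp; ring,
      tpow_div hk', tpow_div hk', tpow_div hk', tri, tri, tri]
    ring
  rw [e, abs_div, abs_of_pos (pow_pos hk' 2), ← div_div, abs_neg]
  refine div_le_div_of_nonneg_right ?_ (by positivity)
  split_ifs <;> first | omega | norm_num

lemma abs_cum_sub_unif_succ {k : ℕ} (hk : 1 ≤ k) (p : ℕ) (y : ℤ) :
    |(cum k (p + 2) y : ℝ) / (k : ℝ) ^ (p + 2) - unif (p + 2) ((y + 1 / 2 - (p + 2) / 2) / k)| ≤
      (p + 3) / (24 * (k : ℝ) ^ 2) := by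
  have hk' : (0 : ℝ) < k := by exact_mod_cast hk
  induction p generalizing y with
  | zero =>
    have := abs_cum_two_sub_unif hk y
    rw [show ((0 : ℕ) + 3 : ℝ) / (24 * (k : ℝ) ^ 2) = 1 / (8 * (k : ℝ) ^ 2) by
      push_cast; field_simp; norm_num,
      show (y : ℝ) + 1 / 2 - ((0 : ℕ) + 2) / 2 = y - 1 / 2 by push_cast; ring]
    exact this
  | succ p ih =>
    set H := bdiff (p + 2) (tpow (p + 3)) with hH
    have hder : ∀ w, HasDerivAt H (unif (p + 2) w) w := hasDerivAt_bdiff_tpow (by omega) _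
    set w : ℝ := (y + 1 / 2 - ((p + 1 : ℕ) + 2) / 2) / k with hw
    set a : ℕ → ℝ := fun i => (((y - (i + 1) : ℤ) : ℝ) + 1 / 2 - (p + 2) / 2) / k with ha
    have hmid : ∀ i : ℕ, |H (w - i / k) - H (w - (i + 1 : ℕ) / k) - 1 / k * unif (p + 2) (a i)| ≤
        1 / (24 * (k : ℝ) ^ 3) := fun i => by
      have := (lip_two p).abs_midpoint_le hder (hasDerivAt_bdiff_tpow (by omega) (p + 2)) (a i)
        (d := 1 / (2 * k)) (by positivity)
      rw [show a i + 1 / (2 * (k : ℝ)) = w - i / k by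
          simp only [ha, hw]; push_cast; field_simp; ring,
        show a i - 1 / (2 * (k : ℝ)) = w - (i + 1 : ℕ) / k by
          simp only [ha, hw]; push_cast; field_simp; ring,
        show 2 * (1 / (2 * (k : ℝ))) = 1 / k by field_simp] at this
      refine this.trans (le_of_eq ?_)
      field_simp; norm_num
    have htel : unif (p + 3) w = ∑ i ∈ range k, (H (w - i / k) - H (w - (i + 1 : ℕ) / k)) := by
      rw [sum_range_sub' (fun i : ℕ => H (w - i / k)), unif, bdiff_succ]
      simp [div_self hk'.ne']; rfl
    have hcum : (cum k (p + 1 + 2) y : ℝ) / (k : ℝ) ^ (p + 1 + 2) =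
        ∑ i ∈ range k, 1 / k * ((cum k (p + 2) (y - (i + 1)) : ℝ) / (k : ℝ) ^ (p + 2)) := by
      rw [show p + 1 + 2 = p + 2 + 1 by ring, cum_succ, Nat.cast_sum, sum_div]
      refine sum_congr rfl fun i _ => ?_
      rw [pow_succ]; field_simp
    rw [hcum, show p + 1 + 2 = p + 3 by ring, htel, ← sum_sub_distrib]
    refine (abs_sum_le_sum_abs _ _).trans ?_
    have hterm : ∀ i ∈ range k, |1 / k * ((cum k (p + 2) (y - (i + 1)) : ℝ) / (k : ℝ) ^ (p + 2)) -
        (H (w - i / k) - H (w - (i + 1 : ℕ) / k))| ≤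
          1 / k * ((p + 3) / (24 * (k : ℝ) ^ 2)) + 1 / (24 * (k : ℝ) ^ 3) := fun i _ => by
      have h1 := hmid i
      have h2 := ih (y - (i + 1))
      have h3 : |1 / (k : ℝ) * ((cum k (p + 2) (y - (i + 1)) : ℝ) / (k : ℝ) ^ (p + 2) -
          unif (p + 2) (a i))| ≤ 1 / k * ((p + 3) / (24 * (k : ℝ) ^ 2)) := by
        rw [abs_mul, abs_of_pos (by positivity)]
        exact mul_le_mul_of_nonneg_left h2 (by positivity)
      rw [abs_le] at *
      constructor <;> linarith [h1.1, h1.2, h3.1, h3.2]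
    refine (sum_le_sum hterm).trans (le_of_eq ?_)
    rw [sum_const, card_range, nsmul_eq_mul]
    push_cast; field_simp; ring

lemma abs_cum_sub_unif {k : ℕ} (hk : 1 ≤ k) {p : ℕ} (hp : 1 ≤ p) (y : ℤ) :
    |(cum k p y : ℝ) / (k : ℝ) ^ p - unif p ((y + 1 / 2 - p / 2) / k)| ≤ discErr k p := by
  obtain ⟨p, rfl⟩ := Nat.exists_eq_add_of_le' hp
  rcases p with - | p
  · have := abs_cum_one_sub_unif hk y
    simp [discErr, this]
  · have := abs_cum_sub_unif_succ hk p y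
    rw [discErr, if_neg (by omega)]
    push_cast
    rw [show (p : ℝ) + 1 + 1 = p + 2 by ring, show (p : ℝ) + 2 + 1 = p + 3 by ring]
    exact this

/-- Second differences of the number of tuples. -/
lemma cnt_sub_cnt (k j : ℕ) (y : ℤ) :
    (cnt k (j + 2) y : ℝ) - cnt k (j + 2) (y + 1) =
      -(cum k j (y - 1) - 2 * cum k j (y - 1 - k) + cum k j (y - 1 - k - k) : ℝ) := by
  have h : ∀ (j : ℕ) (y : ℤ), (cnt k (j + 1) y : ℝ) = cum k j (y - 1) - cum k j (y - 1 - k) := by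
    intro j y
    rw [cnt_succ, Nat.cast_sum]
    have e : ∀ i : ℕ, (cnt k j (y - (i + 1)) : ℝ) =
        cum k j (y - 1 - i) - cum k j (y - 1 - (i + 1 : ℕ)) := fun i => by
      have := cum_add_cnt k j (y - (i + 1))
      rw [eq_sub_iff_add_eq', show y - 1 - (i : ℤ) = y - (i + 1) by ring,
        show y - 1 - ((i + 1 : ℕ) : ℤ) = y - (i + 1) - 1 by push_cast; ring]
      exact_mod_cast this
    simp_rw [e]
    rw [sum_range_sub' (fun i : ℕ => (cum k j (y - 1 - i) : ℝ))]
    simp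
  have h1 : (cum k (j + 1) (y - 1) : ℝ) + cnt k (j + 1) y = cum k (j + 1) y := by
    exact_mod_cast cum_add_cnt k (j + 1) y
  have h2 : (cum k (j + 1) (y - 1 - k) : ℝ) + cnt k (j + 1) (y - k) = cum k (j + 1) (y - k) := by
    have := cum_add_cnt k (j + 1) (y - k)
    rw [sub_right_comm] at this
    exact_mod_cast this
  rw [h (j + 1), h (j + 1), add_sub_cancel_right]
  rw [h j] at h1 h2
  rw [sub_right_comm y (k : ℤ) 1] at h2
  linarith

end PoissonK

namespace PoissonK

open Finset

/-- Alternating binomial sums of `p`-th powers of the positive terms of an arithmetic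
progression; the coefficient is updated along the way. -/
def altSum (r p D : ℕ) : ℕ → ℕ → ℤ → ℤ → ℤ
  | 0, _, _, _ => 0
  | f + 1, i, c, W =>
    if W ≤ 0 then 0
    else c * (W.toNat ^ p : ℕ) + altSum r p D f (i + 1) (-(c * (r - i : ℤ)) / (i + 1)) (W - D)

lemma altSum_eq {r p D : ℕ} (hp : 1 ≤ p) (f i : ℕ) (hf : f + i = r + 1) (W : ℤ) :
    (altSum r p D f i ((-1) ^ i * r.choose i) W : ℝ) =
      ∑ l ∈ range f, (-1) ^ (i + l) * (r.choose (i + l) : ℝ) *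
        max ((W : ℝ) - l * D) 0 ^ p := by
  induction f generalizing i W with
  | zero => simp [altSum]
  | succ f ih =>
    rw [altSum]
    split_ifs with h
    · have hW : (W : ℝ) ≤ 0 := by exact_mod_cast h
      rw [Int.cast_zero, sum_eq_zero]
      intro l _
      have : (0 : ℝ) ≤ l * D := by positivity
      rw [max_eq_right (by linarith), zero_pow (by omega), mul_zero]
    · have hc : -((-1) ^ i * (r.choose i : ℤ) * (r - i : ℤ)) / (i + 1) =
          (-1) ^ (i + 1) * r.choose (i + 1) := by
        have h1 := Nat.choose_succ_right_eq r i
        have h2 : (r.choose (i + 1) : ℤ) * (i + 1) = r.choose i * (r - i : ℤ) := by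
          have : ((r - i : ℕ) : ℤ) = r - i := by push_cast [show i ≤ r by omega]; ring
          rw [← this]; exact_mod_cast h1
        rw [mul_assoc, ← h2]
        refine Int.ediv_eq_of_eq_mul_left (by omega) (by ring)
      rw [hc]
      push_cast
      have hW : (0 : ℝ) ≤ W := by exact_mod_cast (show 0 ≤ W by omega)
      have hW' : ((W.toNat : ℕ) : ℝ) = W := by
        have : ((W.toNat : ℕ) : ℤ) = W := Int.toNat_of_nonneg (by omega)
        exact_mod_cast this
      rw [ih (i + 1) (by omega), sum_range_succ', hW']
      simp only [Nat.cast_zero, zero_mul, sub_zero, add_zero, max_eq_left hW]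
      rw [add_comm]
      congr 1
      refine sum_congr rfl fun l _ => ?_
      rw [show i + 1 + l = i + (l + 1) by ring]
      push_cast
      rw [show (W : ℝ) - D - l * D = W - (l + 1) * D by ring]

/-- The value of `bdiff r (tpow p)` at a rational point. -/
def bdq (r p : ℕ) (w : ℚ) : ℚ :=
  altSum r p w.den (r + 1) 0 1 w.num / ((w.den ^ p * p.factorial : ℕ) : ℚ)

lemma bdq_eq {p : ℕ} (hp : 1 ≤ p) (r : ℕ) (w : ℚ) : (bdq r p w : ℝ) = bdiff r (tpow p) w := by
  have hD : (0 : ℝ) < w.den := by exact_mod_cast w.den_pos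
  have hw : (w : ℝ) = w.num / w.den := by exact_mod_cast (Rat.num_div_den w).symm
  have h := altSum_eq (D := w.den) hp (r + 1) 0 rfl w.num
  simp only [pow_zero, Nat.choose_zero_right, Nat.cast_one, mul_one, zero_add] at h
  rw [bdq, bdiff_eq_sum]
  push_cast
  rw [h, sum_div]
  refine sum_congr rfl fun i _ => ?_
  rw [show (w : ℝ) - i = (w.num - i * w.den) / w.den by rw [hw]; field_simp, tpow_div hD, tpow]
  field_simp

/-- Evaluation of `∑ j < f, c ^ j / j! * v j` by Horner's scheme. -/
def horner (c : ℚ) (v : ℕ → ℚ) : ℕ → ℕ → ℚ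
  | 0, _ => 0
  | f + 1, j => v j + c / (j + 1 : ℕ) * horner c v f (j + 1)

lemma horner_eq_aux (c : ℚ) (v : ℕ → ℚ) (f j : ℕ) :
    c ^ j / j.factorial * horner c v f j =
      ∑ l ∈ range f, c ^ (j + l) / (j + l).factorial * v (j + l) := by
  induction f generalizing j with
  | zero => simp [horner]
  | succ f ih =>
    rw [horner, mul_add, sum_range_succ', add_zero, add_comm, add_left_inj]
    simp_rw [← add_assoc, add_right_comm j _ 1]
    rw [← ih (j + 1), Nat.factorial_succ]
    push_cast
    field_simp
    ring

lemma horner_eq (c : ℚ) (v : ℕ → ℚ) (f : ℕ) :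
    (horner c v f 0 : ℝ) = ∑ j ∈ range f, (c : ℝ) ^ j / j.factorial * v j := by
  have := horner_eq_aux c v f 0
  simp only [pow_zero, Nat.factorial_zero, Nat.cast_one, div_one, one_mul, zero_add] at this
  rw [this]; push_cast; rfl

end PoissonK

namespace PoissonK

open Finset

lemma pow_div_factorial_add_le {c : ℝ} (hc : 0 ≤ c) {J : ℕ} (hJ : 2 * c ≤ J + 1) (i : ℕ) :
    c ^ (i + J) / (i + J).factorial ≤ c ^ J / J.factorial * (1 / 2) ^ i := by
  induction i with
  | zero => simp
  | succ i ih =>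
    have e : c ^ (i + 1 + J) / (i + 1 + J).factorial =
        c ^ (i + J) / (i + J).factorial * (c / (i + J + 1 : ℕ)) := by
      rw [show i + 1 + J = i + J + 1 by ring, Nat.factorial_succ]
      push_cast; field_simp; ring
    rw [e, pow_succ, ← mul_assoc]
    refine mul_le_mul ih ?_ (by positivity) (by positivity)
    rw [div_le_iff₀ (by positivity)]
    push_cast
    have : (0 : ℝ) ≤ i := by positivity
    linarith

lemma le_of_hasSum_of_tail {g : ℕ → ℝ} {S c : ℝ} (hg : HasSum g S) (hc : 0 ≤ c) {J : ℕ}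
    (hJ : 2 * c ≤ J + 1) (h : ∀ j, J ≤ j → -(c ^ j / j.factorial) ≤ g j) :
    ∑ j ∈ range J, g j - 2 * (c ^ J / J.factorial) ≤ S := by
  have h1 := (hasSum_nat_add_iff' J).2 hg
  have h2 := (hasSum_geometric_two.mul_left (c ^ J / J.factorial)).neg
  have := hasSum_le (fun i => ?_) h2 h1
  · linarith
  · exact (neg_le_neg (pow_div_factorial_add_le hc hJ i)).trans (h (i + J) (by omega))

lemma le_sum_of_hasSum {g : ℕ → ℝ} {S : ℝ} (hg : HasSum g S) {J : ℕ}
    (h : ∀ j, J ≤ j → g j ≤ 0) : S ≤ ∑ j ∈ range J, g j := by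
  have := sum_le_hasSum (range J) (fun i hi => ?_) hg.neg
  · simp only [sum_neg_distrib] at this; linarith
  · simp only [mem_range, not_lt] at hi
    linarith [h i hi]

/-- A rational bound for `discErr k p` valid for `30 ≤ k`. -/
def errQ (p : ℕ) : ℚ := if p = 1 then 0 else (p + 1 : ℕ) / 21600

variable {k m : ℕ}

lemma discErr_le (hk : 30 ≤ k) (p : ℕ) : discErr k p ≤ errQ p := by
  rw [discErr, errQ]
  split_ifs
  · simp
  · push_cast
    have : (30 : ℝ) ≤ k := by exact_mod_cast hk
    refine div_le_div_of_nonneg_left (by positivity) (by norm_num) (by nlinarith)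

/-- The position of `m` in units of `k + 1`. -/
noncomputable def pos (k m : ℕ) : ℝ := (m + 1 / 2) / (k + 1)

lemma pos_eq (hk : 30 ≤ k) (m : ℕ) (a : ℝ) :
    ((m : ℝ) + 1 / 2 - a) / k = pos k m + 1 / k * (pos k m - a) := by
  have : (30 : ℝ) ≤ k := by exact_mod_cast hk
  rw [pos]; field_simp; ring

lemma cum_bounds (hk : 30 ≤ k) {p : ℕ} (hp : 1 ≤ p) (m : ℕ) :
    |(cum k p m : ℝ) / (k : ℝ) ^ p - unif p (pos k m + 1 / k * (pos k m - p / 2))| ≤ errQ p := by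
  have := abs_cum_sub_unif (show 1 ≤ k by omega) hp m
  rw [Int.cast_natCast, pos_eq hk] at this
  exact this.trans (discErr_le hk p)

/-- An upper bound for the `j`-th term of the centred cdf for positions up to `X`. -/
def cdfUpper (X : ℚ) (j : ℕ) : ℚ :=
  if j = 0 then 1
  else
    let v := min 1 (2 * (bdq j j (X + max (X - j / 2) 0 / 30) + errQ j) - 1)
    if 2 * X ≤ j then min 0 v else v

/-- A lower bound for the `j`-th term of the centred cdf for positions from `X` on. -/
def cdfLower (X : ℚ) (j : ℕ) : ℚ :=
  if j = 0 then 1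
  else
    let v := max (-1) (2 * (bdq j j (X + min (X - j / 2) 0 / 30) - errQ j) - 1)
    if (j : ℚ) ≤ 2 * X then max 0 v else v

lemma two_mul_pos_le (j : ℕ) (h : 2 * pos k m ≤ j) :
    2 * (cum k j m : ℝ) ≤ (k : ℝ) ^ j := by
  have h1 : 2 * (m : ℤ) + 1 ≤ j * (k + 1) := by
    rw [pos, ← mul_div_assoc, div_le_iff₀ (by positivity)] at h
    have : 2 * (m : ℝ) + 1 ≤ j * (k + 1) := by linarith
    exact_mod_cast this
  exact_mod_cast two_mul_cum_le k j h1

lemma le_two_mul_pos (j : ℕ) (h : j ≤ 2 * pos k m) :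
    (k : ℝ) ^ j ≤ 2 * (cum k j m : ℝ) := by
  have h1 : (j : ℤ) * (k + 1) ≤ 2 * m + 1 := by
    rw [pos, ← mul_div_assoc, le_div_iff₀ (by positivity)] at h
    have : (j : ℝ) * (k + 1) ≤ 2 * m + 1 := by linarith
    exact_mod_cast this
  have h2 := two_mul_cum_le k j (m := j * (k + 1) - 1 - m) (by linarith)
  have h3 := cum_add_cum k j m
  exact_mod_cast (show k ^ j ≤ 2 * cum k j m by omega)

lemma one_div_le (hk : 30 ≤ k) : 1 / (k : ℝ) ≤ 1 / 30 := by
  have : (30 : ℝ) ≤ k := by exact_mod_cast hk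
  exact one_div_le_one_div_of_le (by norm_num) this

lemma le_cdfUpper (hk : 30 ≤ k) {X : ℚ} (hX : pos k m ≤ X) (j : ℕ) :
    2 * ((cum k j m : ℝ) / (k : ℝ) ^ j) - 1 ≤ cdfUpper X j := by
  have hk' : (0 : ℝ) < k := by exact_mod_cast (show 0 < k by omega)
  rw [cdfUpper]
  split_ifs with h0 h1
  · subst h0; simp [cum]; norm_num
  all_goals
    have hle : (cum k j m : ℝ) / (k : ℝ) ^ j ≤ 1 :=
      (div_le_one (by positivity)).2 (by exact_mod_cast cum_le_pow k j m)
    have hv : 2 * ((cum k j m : ℝ) / (k : ℝ) ^ j) - 1 ≤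
        min 1 (2 * (unif j (X + max ((X : ℝ) - j / 2) 0 / 30) + errQ j) - 1) := by
      refine le_min (by linarith) ?_
      have h2 := (abs_le.1 (cum_bounds hk (show 1 ≤ j by omega) m)).2
      have h3 : unif j (pos k m + 1 / k * (pos k m - j / 2)) ≤
          unif j (X + max ((X : ℝ) - j / 2) 0 / 30) := by
        obtain ⟨p, rfl⟩ := Nat.exists_eq_add_of_le' (show 1 ≤ j by omega)
        refine unif_mono p (add_le_add hX ?_)
        have h4 : pos k m - (p + 1 : ℕ) / 2 ≤ max ((X : ℝ) - (p + 1 : ℕ) / 2) 0 :=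
          le_max_of_le_left (by linarith)
        have h5 : (0 : ℝ) ≤ max ((X : ℝ) - (p + 1 : ℕ) / 2) 0 := le_max_right _ _
        calc 1 / (k : ℝ) * (pos k m - (p + 1 : ℕ) / 2)
            ≤ 1 / k * max ((X : ℝ) - (p + 1 : ℕ) / 2) 0 :=
              mul_le_mul_of_nonneg_left h4 (by positivity)
          _ ≤ 1 / 30 * max ((X : ℝ) - (p + 1 : ℕ) / 2) 0 :=
              mul_le_mul_of_nonneg_right (one_div_le hk) h5
          _ = _ := by ring
      linarith
    have e := bdq_eq (show 1 ≤ j by omega) j (X + max (X - j / 2) 0 / 30)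
    push_cast at e
    push_cast
    rw [e]
  · refine le_min ?_ hv
    rw [sub_nonpos, ← mul_div_assoc, div_le_one (by positivity)]
    refine two_mul_pos_le j (le_trans (mul_le_mul_of_nonneg_left hX zero_le_two) ?_)
    exact_mod_cast h1
  · exact hv

lemma cdfLower_le (hk : 30 ≤ k) {X : ℚ} (hX : X ≤ pos k m) (j : ℕ) :
    cdfLower X j ≤ 2 * ((cum k j m : ℝ) / (k : ℝ) ^ j) - 1 := by
  have hk' : (0 : ℝ) < k := by exact_mod_cast (show 0 < k by omega)
  rw [cdfLower]
  split_ifs with h0 h1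
  · subst h0; simp [cum]; norm_num
  all_goals
    have hle : 0 ≤ (cum k j m : ℝ) / (k : ℝ) ^ j := by positivity
    have hv : max (-1) (2 * (unif j (X + min ((X : ℝ) - j / 2) 0 / 30) - errQ j) - 1) ≤
        2 * ((cum k j m : ℝ) / (k : ℝ) ^ j) - 1 := by
      refine max_le (by linarith) ?_
      have h2 := (abs_le.1 (cum_bounds hk (show 1 ≤ j by omega) m)).1
      have h3 : unif j (X + min ((X : ℝ) - j / 2) 0 / 30) ≤
          unif j (pos k m + 1 / k * (pos k m - j / 2)) := by
        obtain ⟨p, rfl⟩ := Nat.exists_eq_add_of_le' (show 1 ≤ j by omega)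
        refine unif_mono p (add_le_add hX ?_)
        have h4 : min ((X : ℝ) - (p + 1 : ℕ) / 2) 0 ≤ pos k m - (p + 1 : ℕ) / 2 :=
          min_le_of_left_le (by linarith)
        have h5 : min ((X : ℝ) - (p + 1 : ℕ) / 2) 0 ≤ 0 := min_le_right _ _
        calc min ((X : ℝ) - (p + 1 : ℕ) / 2) 0 / 30
            = 1 / 30 * min ((X : ℝ) - (p + 1 : ℕ) / 2) 0 := by ring
          _ ≤ 1 / k * min ((X : ℝ) - (p + 1 : ℕ) / 2) 0 :=
              mul_le_mul_of_nonpos_right (one_div_le hk) h5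
          _ ≤ _ := mul_le_mul_of_nonneg_left h4 (by positivity)
      linarith
    have e := bdq_eq (show 1 ≤ j by omega) j (X + min (X - j / 2) 0 / 30)
    push_cast at e
    push_cast
    rw [e]
  · refine max_le ?_ hv
    rw [sub_nonneg, ← mul_div_assoc, one_le_div (by positivity)]
    refine le_two_mul_pos j (le_trans ?_ (mul_le_mul_of_nonneg_left hX zero_le_two))
    exact_mod_cast h1
  · exact hv

/-- The centred cdf as a Poisson mixture. -/
lemma hasSum_cdf' (hk : 1 ≤ k) (c : ℝ) (m : ℕ) :
    HasSum (fun j : ℕ => c ^ j / j.factorial * (2 * ((cum k j m : ℝ) / (k : ℝ) ^ j) - 1))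
      (Real.exp c * (2 * cdf k (c / k) m - 1)) := by
  have hk' : (0 : ℝ) < k := by exact_mod_cast hk
  have h := hasSum_cdf k (c / k) m
  rw [mul_div_cancel₀ c hk'.ne'] at h
  refine hasSum_congr h (fun j => ?_) rfl
  rw [div_pow]; field_simp

/-- A test for the cdf to be below one half. -/
def cdfBelow (X c : ℚ) (J : ℕ) : Bool :=
  decide (0 ≤ c ∧ 2 * X ≤ J ∧ horner c (cdfUpper X) J 0 < 0)

lemma cdf_lt_half_of_cdfBelow (hk : 30 ≤ k) {X c : ℚ} {J : ℕ} (h : cdfBelow X c J = true)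
    (hX : pos k m ≤ X) : cdf k (c / k) m < 1 / 2 := by
  obtain ⟨hc, hJ, h1⟩ := of_decide_eq_true h
  have hk' : (0 : ℝ) < k := by exact_mod_cast (show 0 < k by omega)
  have hc' : (0 : ℝ) ≤ c := by exact_mod_cast hc
  have h2 : (horner c (cdfUpper X) J 0 : ℝ) < 0 := by exact_mod_cast h1
  rw [horner_eq] at h2
  have h3 := le_sum_of_hasSum (J := J) (hasSum_cdf' (show 1 ≤ k by omega) c m) fun j hj => by
    refine mul_nonpos_of_nonneg_of_nonpos (by positivity) ?_
    rw [sub_nonpos, ← mul_div_assoc, div_le_one (by positivity)]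
    refine two_mul_pos_le j (le_trans (mul_le_mul_of_nonneg_left hX zero_le_two) ?_)
    have : (J : ℝ) ≤ j := by exact_mod_cast hj
    refine le_trans ?_ this
    exact_mod_cast hJ
  have h4 := h3.trans (sum_le_sum fun j _ =>
    mul_le_mul_of_nonneg_left (le_cdfUpper hk hX j) (by positivity))
  have := (pos_iff_neg_of_mul_neg (h4.trans_lt h2)).1 (Real.exp_pos _)
  linarith

/-- A test for the cdf to be at least one half. -/
def cdfAbove (X c : ℚ) (J : ℕ) : Bool :=
  decide (0 ≤ c ∧ 2 * c ≤ J + 1 ∧ 2 * (c ^ J / J.factorial) ≤ horner c (cdfLower X) J 0)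

lemma half_le_cdf_of_cdfAbove (hk : 30 ≤ k) {X c : ℚ} {J : ℕ} (h : cdfAbove X c J = true)
    (hX : X ≤ pos k m) : 1 / 2 ≤ cdf k (c / k) m := by
  obtain ⟨hc, hJ, h1⟩ := of_decide_eq_true h
  have hk' : (0 : ℝ) < k := by exact_mod_cast (show 0 < k by omega)
  have hc' : (0 : ℝ) ≤ c := by exact_mod_cast hc
  have hJ' : 2 * (c : ℝ) ≤ J + 1 := by exact_mod_cast hJ
  have h2 : 2 * ((c : ℝ) ^ J / J.factorial) ≤ (horner c (cdfLower X) J 0 : ℝ) := by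
    exact_mod_cast h1
  rw [horner_eq] at h2
  have h3 := le_of_hasSum_of_tail (hasSum_cdf' (show 1 ≤ k by omega) c m) hc' hJ' fun j _ => by
    have h4 : 0 ≤ (cum k j m : ℝ) / (k : ℝ) ^ j := by positivity
    have h5 : 0 ≤ (c : ℝ) ^ j / j.factorial := by positivity
    nlinarith
  have h4 := sum_le_sum fun j (_ : j ∈ range J) =>
    mul_le_mul_of_nonneg_left (cdfLower_le hk hX j)
      (show 0 ≤ (c : ℝ) ^ j / j.factorial by positivity)
  have := nonneg_of_mul_nonneg_right (show 0 ≤ Real.exp c * (2 * cdf k (c / k) m - 1) by linarith)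
    (Real.exp_pos _)
  linarith

end PoissonK

namespace PoissonK

open Finset

variable {k m : ℕ}

/-- The normalized first difference of the number of `n`-tuples. -/
noncomputable def dcnt (k m n : ℕ) : ℝ :=
  (k : ℝ) ^ 2 * (((cnt k n m : ℝ) - cnt k n (m + 1 : ℕ)) / (k : ℝ) ^ n)

lemma hasSum_dcnt (hk : 1 ≤ k) (c : ℝ) (m : ℕ) :
    HasSum (fun n : ℕ => c ^ n / n.factorial * dcnt k m n)
      ((k : ℝ) ^ 2 * (Real.exp c *
        (poissonOrderKPmf k (c / k) m - poissonOrderKPmf k (c / k) (m + 1)))) := by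
  have hk' : (0 : ℝ) < k := by exact_mod_cast hk
  have h := hasSum_pmf_sub k (c / k) m (m + 1)
  rw [mul_div_cancel₀ c hk'.ne'] at h
  refine hasSum_congr (h.mul_left ((k : ℝ) ^ 2)) (fun n => ?_) rfl
  rw [dcnt, div_pow]; field_simp

lemma dcnt_eq (hk : 1 ≤ k) (p : ℕ) : dcnt k m (p + 2) =
    -((cum k p (m - 1) : ℝ) / (k : ℝ) ^ p - 2 * ((cum k p (m - 1 - k) : ℝ) / (k : ℝ) ^ p) +
      (cum k p (m - 1 - k - k) : ℝ) / (k : ℝ) ^ p) := by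
  have hk' : (0 : ℝ) < k := by exact_mod_cast hk
  have := cnt_sub_cnt k p m
  rw [dcnt, Nat.cast_succ, this, pow_add]
  field_simp

lemma neg_one_le_dcnt (hk : 1 ≤ k) {n : ℕ} (hn : 2 ≤ n) : -1 ≤ dcnt k m n := by
  have hk' : (0 : ℝ) < k := by exact_mod_cast hk
  obtain ⟨p, rfl⟩ := Nat.exists_eq_add_of_le' hn
  rw [dcnt_eq hk]
  have h1 : (cum k p (m - 1) : ℝ) / (k : ℝ) ^ p ≤ 1 :=
    (div_le_one (by positivity)).2 (by exact_mod_cast cum_le_pow k p _)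
  have h2 : (cum k p (m - 1 - k - k) : ℝ) / (k : ℝ) ^ p ≤
      (cum k p (m - 1 - k) : ℝ) / (k : ℝ) ^ p :=
    div_le_div_of_nonneg_right (by exact_mod_cast cum_mono k p (by omega)) (by positivity)
  have h3 : 0 ≤ (cum k p (m - 1 - k) : ℝ) / (k : ℝ) ^ p := by positivity
  linarith

lemma abs_dcnt_add_le (hk : 30 ≤ k) {n : ℕ} (hn : 3 ≤ n) (m : ℕ) :
    |dcnt k m n + bdiff n (tpow (n - 2)) (pos k m + 1 / k * (pos k m - n / 2))| ≤
      4 * errQ (n - 2) := by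
  have hk' : (0 : ℝ) < k := by exact_mod_cast (show 0 < k by omega)
  obtain ⟨p, rfl⟩ := Nat.exists_eq_add_of_le' (show 2 ≤ n by omega)
  rw [add_tsub_cancel_right, dcnt_eq (by omega), ← pos_eq hk, bdiff_add]
  set w : ℝ := ((m : ℝ) + 1 / 2 - (p + 2 : ℕ) / 2) / k with hw
  have h : ∀ y : ℤ, |(cum k p y : ℝ) / (k : ℝ) ^ p - unif p ((y + 1 / 2 - p / 2) / k)| ≤ errQ p :=
    fun y => (abs_cum_sub_unif (by omega) (by omega) y).trans (discErr_le hk p)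
  have h0 := h (m - 1)
  have h1 := h (m - 1 - k)
  have h2 := h (m - 1 - k - k)
  rw [show (((m - 1 : ℤ) : ℝ) + 1 / 2 - p / 2) / k = w by
    rw [hw]; push_cast; field_simp; ring] at h0
  rw [show (((m - 1 - k : ℤ) : ℝ) + 1 / 2 - p / 2) / k = w - 1 by
    rw [hw]; push_cast; field_simp; ring] at h1
  rw [show (((m - 1 - k - k : ℤ) : ℝ) + 1 / 2 - p / 2) / k = w - 1 - 1 by
    rw [hw]; push_cast; field_simp; ring] at h2
  simp only [bdiff_succ, bdiff_zero]
  rw [← unif]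
  rw [abs_le] at *
  constructor <;> linarith

/-- The central position of the `n`-th summand. -/
def ctr (X0 : ℚ) (n : ℕ) : ℚ := X0 + (X0 - n / 2) / 60

/-- The constant part of the lower bound for `dcnt` on a box. -/
def slopeMain (X0 dX : ℚ) (n : ℕ) : ℚ :=
  if n < 2 then 0
  else if n = 2 then if X0 + dX ≤ 195 / 100 then 1 else 0
  else if n = 3 then
    max 0 (min (2 * (X0 - dX) - 3) (3 - (X0 + dX + (X0 + dX - 3 / 2) / 30)))
  else -bdq n (n - 2) (ctr X0 n) - 3 / 2 * (dX * (31 / 30) + |X0 - n / 2| / 60) ^ 2 -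
    4 * errQ (n - 2)

/-- The coefficient of the shift of the position in the lower bound for `dcnt` on a box. -/
def slopeX (X0 : ℚ) (n : ℕ) : ℚ := if n < 4 then 0 else -bdq n (n - 3) (ctr X0 n)

/-- The coefficient of `1 / k - 1 / 60` in the lower bound for `dcnt` on a box. -/
def slopeEps (X0 : ℚ) (n : ℕ) : ℚ := slopeX X0 n * (X0 - n / 2)

lemma le_dcnt_of_four_le (hk : 30 ≤ k) {X0 dX : ℚ} (hX : |pos k m - X0| ≤ dX) {n : ℕ}
    (hn : 4 ≤ n) :
    slopeMain X0 dX n + (pos k m - X0) * (1 + 1 / k) * slopeX X0 n +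
      (1 / k - 1 / 60) * slopeEps X0 n ≤ dcnt k m n := by
  have hk' : (0 : ℝ) < k := by exact_mod_cast (show 0 < k by omega)
  obtain ⟨q, rfl⟩ := Nat.exists_eq_add_of_le' hn
  have h1 := abs_le.1 (abs_dcnt_add_le hk (show 3 ≤ q + 4 by omega) m)
  set d : ℝ := (pos k m - X0) * (1 + 1 / k) + (1 / k - 1 / 60) * (X0 - (q + 4 : ℕ) / 2) with hd
  have h2 := abs_le.1 ((lip_four q).abs_taylor_le (hasDerivAt_bdiff_tpow (by omega) (q + 4))
    (ctr X0 (q + 4) : ℚ) d)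
  have e : ((ctr X0 (q + 4) : ℚ) : ℝ) + d = pos k m + 1 / k * (pos k m - (q + 4 : ℕ) / 2) := by
    rw [hd, ctr]; push_cast; ring
  rw [e, show q + 1 + 1 = q + 2 from rfl] at h2
  rw [show q + 4 - 2 = q + 2 by omega] at h1
  have h3 : d ^ 2 ≤ (dX * (31 / 30) + |(X0 : ℝ) - (q + 4 : ℕ) / 2| / 60) ^ 2 := by
    refine sq_le_sq' ?_ ?_
    all_goals
      have hb : |1 / (k : ℝ) - 1 / 60| ≤ 1 / 60 := by
        have := one_div_le hk
        have : 0 < 1 / (k : ℝ) := by positivity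
        rw [abs_le]; constructor <;> linarith
      have ha : |(pos k m - X0) * (1 + 1 / k)| ≤ dX * (31 / 30) := by
        rw [abs_mul, abs_of_pos (show 0 < 1 + 1 / (k : ℝ) by positivity)]
        exact mul_le_mul hX (by linarith [one_div_le hk]) (by positivity)
          ((abs_nonneg _).trans hX)
      have hc : |(1 / (k : ℝ) - 1 / 60) * (X0 - (q + 4 : ℕ) / 2)| ≤
          1 / 60 * |(X0 : ℝ) - (q + 4 : ℕ) / 2| := by
        rw [abs_mul]; exact mul_le_mul_of_nonneg_right hb (abs_nonneg _)
      have ha' := abs_le.1 ha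
      have hc' := abs_le.1 hc
      linarith [ha'.1, ha'.2, hc'.1, hc'.2]
  have e1 := bdq_eq (show 1 ≤ q + 2 by omega) (q + 4) (ctr X0 (q + 4))
  have e2 := bdq_eq (show 1 ≤ q + 1 by omega) (q + 4) (ctr X0 (q + 4))
  rw [slopeEps, slopeMain, slopeX, if_neg (by omega), if_neg (by omega), if_neg (by omega),
    if_neg (by omega), show q + 4 - 2 = q + 2 by omega, show q + 4 - 3 = q + 1 by omega]
  push_cast at h2 h3 e1 e2 hd ⊢
  rw [e1, e2]
  have h5 := h2.2
  have h6 := h1.1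
  have e3 : bdiff (q + 4) (tpow (q + 1)) (ctr X0 (q + 4)) * d =
      -((pos k m - X0) * (1 + 1 / k) * -bdiff (q + 4) (tpow (q + 1)) (ctr X0 (q + 4)) +
        (1 / k - 1 / 60) * (-bdiff (q + 4) (tpow (q + 1)) (ctr X0 (q + 4)) *
          (X0 - (q + 4) / 2))) := by
    rw [hd]; ring
  rw [e3] at h5
  push_cast at h6
  linarith

lemma le_dcnt_three (hk : 30 ≤ k) {X0 dX : ℚ} (hX : |pos k m - X0| ≤ dX)
    (h0 : 158 / 100 ≤ X0 - dX) : slopeMain X0 dX 3 ≤ dcnt k m 3 := by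
  have hk' : (0 : ℝ) < k := by exact_mod_cast (show 0 < k by omega)
  have h1 := abs_dcnt_add_le hk le_rfl m
  set w := pos k m + 1 / k * (pos k m - (3 : ℕ) / 2) with hw
  have e : (errQ (3 - 2) : ℝ) = 0 := by simp [errQ]
  rw [e, mul_zero] at h1
  have h2 : dcnt k m 3 = -bdiff 3 (tpow 1) w := by
    have := abs_eq_zero.1 (le_antisymm h1 (abs_nonneg _))
    linarith
  obtain ⟨h3, h4⟩ := abs_le.1 hX
  have h0' : (158 / 100 : ℝ) ≤ X0 - dX := by
    have := (Rat.cast_le (K := ℝ)).2 h0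
    push_cast at this
    exact this
  have hpos : 0 ≤ pos k m - 3 / 2 := by linarith
  have h5 : 1 / (k : ℝ) * (pos k m - 3 / 2) ≤ 1 / 30 * (pos k m - 3 / 2) :=
    mul_le_mul_of_nonneg_right (one_div_le hk) hpos
  have h6 : 0 ≤ 1 / (k : ℝ) * (pos k m - 3 / 2) := by positivity
  push_cast at hw
  have hw1 : (X0 : ℝ) - dX ≤ w := by linarith
  have hw2 : w ≤ X0 + dX + (X0 + dX - 3 / 2) / 30 := by linarith
  have h7 : ((slopeMain X0 dX 3 : ℚ) : ℝ) =
      max 0 (min (2 * ((X0 : ℝ) - dX) - 3) (3 - ((X0 : ℝ) + dX + (X0 + dX - 3 / 2) / 30))) := by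
    simp [slopeMain]
  rw [h2, h7]
  simp only [bdiff_succ, bdiff_zero, tpow_one]
  rcases le_total w 2 with hc | hc
  · rw [max_eq_left (show 0 ≤ w by linarith), max_eq_left (show 0 ≤ w - 1 by linarith),
      max_eq_right (show w - 1 - 1 ≤ 0 by linarith),
      max_eq_right (show w - 1 - 1 - 1 ≤ 0 by linarith)]
    exact max_le (by linarith) (min_le_of_left_le (by linarith))
  · rcases le_total w 3 with hc' | hc'
    · rw [max_eq_left (show 0 ≤ w by linarith), max_eq_left (show 0 ≤ w - 1 by linarith),
        max_eq_left (show 0 ≤ w - 1 - 1 by linarith),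
        max_eq_right (show w - 1 - 1 - 1 ≤ 0 by linarith)]
      exact max_le (by linarith) (min_le_of_right_le (by linarith))
    · rw [max_eq_left (show 0 ≤ w by linarith), max_eq_left (show 0 ≤ w - 1 by linarith),
        max_eq_left (show 0 ≤ w - 1 - 1 by linarith),
        max_eq_left (show 0 ≤ w - 1 - 1 - 1 by linarith)]
      exact max_le (by linarith) (min_le_of_right_le (by linarith))

lemma le_dcnt_of_lt_three (hk : 30 ≤ k) {X0 dX : ℚ} (hX : |pos k m - X0| ≤ dX)
    (h0 : 158 / 100 ≤ X0 - dX) {n : ℕ} (hn : n < 3) : slopeMain X0 dX n ≤ dcnt k m n := by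
  have hk' : (30 : ℝ) ≤ k := by exact_mod_cast hk
  obtain ⟨h3, h4⟩ := abs_le.1 hX
  have h0' : (158 / 100 : ℝ) ≤ X0 - dX := by
    have := (Rat.cast_le (K := ℝ)).2 h0
    push_cast at this
    exact this
  have hm : k + 1 ≤ m := by
    have : (158 / 100 : ℝ) ≤ pos k m := by linarith
    rw [pos, le_div_iff₀ (by positivity)] at this
    have : (k : ℝ) + 1 ≤ m := by linarith
    exact_mod_cast this
  have h7 : ∀ j ≤ 1, cnt k j (m + 1 : ℕ) = 0 := by
    intro j hj
    interval_cases j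
    · simp only [cnt]; rw [if_neg (by omega)]
    · simp only [cnt]
      exact sum_eq_zero fun i hi => if_neg (by have := mem_range.1 hi; omega)
  have h8 : ∀ j ≤ 1, 0 ≤ dcnt k m j := fun j hj => by
    rw [dcnt, h7 j hj, Nat.cast_zero, sub_zero]; positivity
  interval_cases n
  · simpa [slopeMain] using h8 0 (by omega)
  · simpa [slopeMain] using h8 1 (by omega)
  · rw [dcnt_eq (by omega)]
    simp only [cum]
    rw [slopeMain, if_neg (by omega), if_pos rfl, if_pos (show (0 : ℤ) ≤ m - 1 by omega),
      if_pos (show (0 : ℤ) ≤ m - 1 - k by omega)]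
    split_ifs with h h9 h9
    · have h := (Rat.cast_le (K := ℝ)).2 h
      push_cast at h
      have : pos k m ≤ 195 / 100 := by linarith
      rw [pos, div_le_iff₀ (by positivity)] at this
      have h9 : (k : ℝ) + 1 + k ≤ m := by exact_mod_cast (show (k : ℤ) + 1 + k ≤ m by omega)
      linarith
    all_goals norm_num

/-- A test for `pmf (m + 1) < pmf m` on a box of positions. -/
def slopeBox (X0 dX c : ℚ) (J : ℕ) : Bool :=
  decide (0 ≤ c ∧ 2 * c ≤ J + 1 ∧ 2 ≤ J ∧ 158 / 100 ≤ X0 - dX ∧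
    |horner c (slopeX X0) J 0| * (dX * (31 / 30)) + |horner c (slopeEps X0) J 0| / 60 +
      2 * (c ^ J / J.factorial) < horner c (slopeMain X0 dX) J 0)

lemma pmf_succ_lt_of_slopeBox (hk : 30 ≤ k) {X0 dX c : ℚ} {J : ℕ}
    (h : slopeBox X0 dX c J = true) (hX : |pos k m - X0| ≤ dX) :
    poissonOrderKPmf k (c / k) (m + 1) < poissonOrderKPmf k (c / k) m := by
  obtain ⟨hc, hJ, hJ2, h0, h1⟩ := of_decide_eq_true h
  have hk' : (0 : ℝ) < k := by exact_mod_cast (show 0 < k by omega)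
  have hc' : (0 : ℝ) ≤ c := by exact_mod_cast hc
  have hJ' : 2 * (c : ℝ) ≤ J + 1 := by exact_mod_cast hJ
  have h2 : |(horner c (slopeX X0) J 0 : ℝ)| * (dX * (31 / 30)) +
      |(horner c (slopeEps X0) J 0 : ℝ)| / 60 + 2 * ((c : ℝ) ^ J / J.factorial) <
        (horner c (slopeMain X0 dX) J 0 : ℝ) := by
    have := (Rat.cast_lt (K := ℝ)).2 h1
    push_cast at this
    exact this
  have h3 := le_of_hasSum_of_tail (hasSum_dcnt (show 1 ≤ k by omega) c m) hc' hJ' fun j hj => by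
    have h4 := neg_one_le_dcnt (k := k) (m := m) (by omega) (show 2 ≤ j by omega)
    have h5 : 0 ≤ (c : ℝ) ^ j / j.factorial := by positivity
    nlinarith
  set a := (pos k m - X0) * (1 + 1 / (k : ℝ)) with ha
  set b := 1 / (k : ℝ) - 1 / 60 with hb
  have hterm : ∀ n, slopeMain X0 dX n + a * slopeX X0 n + b * slopeEps X0 n ≤ dcnt k m n := by
    intro n
    rcases lt_or_ge n 4 with hn | hn
    · have e : slopeX X0 n = 0 := if_pos hn
      rw [slopeEps, e]
      simp only [zero_mul, Rat.cast_zero, mul_zero, add_zero]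
      rcases Nat.lt_succ_iff_lt_or_eq.1 hn with hn | rfl
      · exact le_dcnt_of_lt_three hk hX h0 hn
      · exact le_dcnt_three hk hX h0
    · exact le_dcnt_of_four_le hk hX hn
  have h4 := sum_le_sum fun n (_ : n ∈ range J) =>
    mul_le_mul_of_nonneg_left (hterm n) (show 0 ≤ (c : ℝ) ^ n / n.factorial by positivity)
  have e : ∑ n ∈ range J, (c : ℝ) ^ n / n.factorial *
      (slopeMain X0 dX n + a * slopeX X0 n + b * slopeEps X0 n) =
      horner c (slopeMain X0 dX) J 0 + a * horner c (slopeX X0) J 0 +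
        b * horner c (slopeEps X0) J 0 := by
    simp only [horner_eq, mul_sum, ← sum_add_distrib]
    exact sum_congr rfl fun n _ => by ring
  rw [e] at h4
  have h5 : |a * horner c (slopeX X0) J 0| ≤
      |(horner c (slopeX X0) J 0 : ℝ)| * (dX * (31 / 30)) := by
    rw [abs_mul, mul_comm]
    refine mul_le_mul_of_nonneg_left ?_ (abs_nonneg _)
    rw [ha, abs_mul, abs_of_pos (show 0 < 1 + 1 / (k : ℝ) by positivity)]
    exact mul_le_mul hX (by linarith [one_div_le hk]) (by positivity) ((abs_nonneg _).trans hX)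
  have h6 : |b * horner c (slopeEps X0) J 0| ≤ |(horner c (slopeEps X0) J 0 : ℝ)| / 60 := by
    have : |b| ≤ 1 / 60 := by
      have := one_div_le hk
      have : 0 < 1 / (k : ℝ) := by positivity
      rw [hb, abs_le]; constructor <;> linarith
    rw [abs_mul]
    have := mul_le_mul_of_nonneg_right this (abs_nonneg (horner c (slopeEps X0) J 0 : ℝ))
    linarith
  have h7 : 0 < (k : ℝ) ^ 2 * (Real.exp c *
      (poissonOrderKPmf k (c / k) m - poissonOrderKPmf k (c / k) (m + 1))) := by
    linarith [(abs_le.1 h5).1, (abs_le.1 h6).1]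
  exact sub_pos.1 (pos_of_mul_pos_right (pos_of_mul_pos_right h7 (by positivity))
    (Real.exp_pos _).le)

end PoissonK

namespace PoissonK

open Finset

variable {k i n : ℕ}

/-- Boxes of positions covering `[158 / 100, 7]`, given by their right endpoint in units of
`1 / 1000` and a parameter in units of `1 / 100`. -/
def boxes : List (ℕ × ℕ) :=
  [(1680, 363), (1800, 388), (1920, 412), (1950, 418), (1964, 420), (2004, 428), (2064, 440),
    (2124, 452), (2184, 464), (2244, 476), (2324, 492), (2404, 508), (2484, 524), (2584, 544),
    (2684, 564), (2784, 584), (2884, 604), (3004, 628), (3124, 652), (3244, 676), (3364, 700),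
    (3484, 724), (3604, 748), (3724, 773), (3824, 793), (3924, 813), (4024, 833), (4124, 853),
    (4224, 873), (4324, 893), (4424, 913), (4504, 929), (4584, 945), (4664, 961), (4744, 977),
    (4824, 993), (4904, 1009), (4984, 1025), (5064, 1041), (5144, 1057), (5224, 1073),
    (5284, 1085), (5344, 1097), (5404, 1109), (5464, 1121), (5524, 1133), (5584, 1145),
    (5644, 1157), (5704, 1169), (5764, 1181), (5824, 1193), (5884, 1205), (5944, 1217),
    (6004, 1229), (6064, 1241), (6124, 1253), (6184, 1265), (6244, 1277), (6294, 1287),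
    (6344, 1298), (6394, 1308), (6444, 1318), (6494, 1328), (6544, 1337), (6594, 1348),
    (6644, 1358), (6684, 1366), (6724, 1374), (6764, 1382), (6804, 1390), (6844, 1398),
    (6884, 1406), (6924, 1414), (6964, 1422), (7004, 1430)]

/-- The tests for consecutive boxes starting at `a / 1000`. -/
def boxesOk : ℕ → List (ℕ × ℕ) → Bool
  | a, [] => decide (7000 ≤ a)
  | a, (b, c) :: l => decide (0 < c) && cdfBelow (b / 1000) (c / 100) (2 * (c / 100) + 8) &&
      slopeBox ((a + b) / 2000) ((b - a) / 2000) (c / 100) (2 * (c / 100) + 8) && boxesOk b l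

set_option maxRecDepth 100000 in
lemma boxesOk_boxes : boxesOk 1580 boxes = true := by decide +kernel

lemma separated_of_boxesOk (hk : 30 ≤ k) (l : List (ℕ × ℕ)) (a : ℕ) (h : boxesOk a l = true)
    (ha : (a : ℝ) / 1000 ≤ pos k i) (hi : pos k i < 7) : Separated k i := by
  induction l generalizing a with
  | nil =>
    have := of_decide_eq_true h
    have : (7000 : ℝ) ≤ a := by exact_mod_cast this
    linarith
  | cons p l ih =>
    obtain ⟨b, c⟩ := p
    simp only [boxesOk, Bool.and_eq_true, decide_eq_true_eq] at h
    obtain ⟨⟨⟨h1, h2⟩, h3⟩, h4⟩ := h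
    rcases le_total ((b : ℝ) / 1000) (pos k i) with hb | hb
    · exact ih b h4 hb
    · have hk' : (0 : ℝ) < k := by exact_mod_cast (show 0 < k by omega)
      have hc : (0 : ℝ) < c := by exact_mod_cast h1
      refine ⟨((c / 100 : ℚ) : ℝ) / k, by push_cast; positivity,
        cdf_lt_half_of_cdfBelow hk h2 (by push_cast; exact hb), i, le_rfl,
        pmf_succ_lt_of_slopeBox hk h3 ?_⟩
      push_cast
      rw [abs_le]
      constructor <;> linarith

lemma cnt_succ_le_pow (k j : ℕ) (y : ℤ) : cnt k (j + 1) y ≤ k ^ j := by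
  induction j generalizing y with
  | zero =>
    rw [cnt_succ, pow_zero]
    simp only [cnt]
    rw [← card_filter, card_le_one]
    intro a ha b hb
    simp only [mem_filter] at ha hb
    omega
  | succ j ih =>
    rw [cnt_succ]
    refine (sum_le_sum fun i _ => ih _).trans ?_
    simp [pow_succ, mul_comm]

lemma pmf_succ_lt_pmf_zero (hk : 30 ≤ k) (i : ℕ) :
    poissonOrderKPmf k (343 / 100 / k) (i + 1) < poissonOrderKPmf k (343 / 100 / k) 0 := by
  have hk' : (30 : ℝ) ≤ k := by exact_mod_cast hk
  set lam : ℝ := 343 / 100 / k with hlam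
  have hl : 0 < lam := by positivity
  have hkl : k * lam = 343 / 100 := by rw [hlam]; field_simp
  have h1 := hasSum_pmf_sub k lam 0 (i + 1)
  have h2 := (hasSum_pow_div_factorial (k * lam)).mul_left (1 / (k : ℝ))
  have h3 : HasSum (fun j : ℕ => if j = 0 then 1 + 1 / (k : ℝ) else 0) (1 + 1 / (k : ℝ)) :=
    hasSum_ite_eq 0 _
  have h4 := hasSum_le (fun j => ?_) (h3.sub h2) h1
  · have he : Real.exp (k * lam) < 31 := by
      have h5 : Real.exp (k * lam) = Real.exp 1 ^ 3 * Real.exp (43 / 100) := by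
        rw [hkl, ← Real.exp_nat_mul, ← Real.exp_add]; norm_num
      have h6 := Real.exp_bound' (show (0 : ℝ) ≤ 43 / 100 by norm_num) (by norm_num)
        (show 0 < 4 by norm_num)
      have h7 : Real.exp (43 / 100) < 1.54 :=
        h6.trans_lt (by norm_num [sum_range_succ, Nat.factorial])
      have h8 : Real.exp 1 ^ 3 < 2.7182818286 ^ 3 :=
        pow_lt_pow_left₀ Real.exp_one_lt_d9 (Real.exp_pos 1).le (by norm_num)
      rw [h5]
      have := mul_lt_mul'' h8 h7 (by positivity) (Real.exp_pos _).le
      norm_num at this ⊢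
      linarith
    have h5 : 0 < 1 + 1 / (k : ℝ) - 1 / k * Real.exp (k * lam) := by
      have : 1 / (k : ℝ) * Real.exp (k * lam) < 1 / (k : ℝ) * 31 :=
        mul_lt_mul_of_pos_left he (by positivity)
      have : 1 / (k : ℝ) * 30 ≤ 1 := by
        rw [one_div_mul_eq_div]; exact (div_le_one (by positivity)).2 hk'
      linarith
    exact sub_pos.1 (pos_of_mul_pos_right (h5.trans_le h4) (Real.exp_pos _).le)
  · rcases j with _ | j
    · have e : cnt k 0 (i + 1 : ℕ) = 0 := by simp only [cnt]; rw [if_neg (by omega)]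
      rw [e]; simp [cnt]
    · have e := cnt_succ_le_pow k j (i + 1 : ℕ)
      have e' : (cnt k (j + 1) (i + 1 : ℕ) : ℝ) ≤ (k : ℝ) ^ j := by exact_mod_cast e
      rw [if_neg (by omega), cnt_of_lt k (show ((0 : ℕ) : ℤ) < (j + 1 : ℕ) by omega), mul_pow]
      have : lam ^ (j + 1) / (j + 1).factorial * cnt k (j + 1) (i + 1 : ℕ) ≤
          lam ^ (j + 1) / (j + 1).factorial * (k : ℝ) ^ j :=
        mul_le_mul_of_nonneg_left e' (by positivity)
      have e2 : 1 / (k : ℝ) * ((k : ℝ) ^ (j + 1) * lam ^ (j + 1) / (j + 1).factorial) =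
          lam ^ (j + 1) / (j + 1).factorial * (k : ℝ) ^ j := by
        rw [pow_succ (k : ℝ)]; field_simp
      rw [e2]
      push_cast at this ⊢
      linarith

set_option maxRecDepth 100000 in
lemma cdfBelow_base : cdfBelow (158 / 100) (343 / 100) 16 = true := by decide +kernel

lemma separated_of_thirty_le (hk : 30 ≤ k) (hi : i + 1 < 7 * (k + 1)) : Separated k i := by
  have hk' : (0 : ℝ) < k := by exact_mod_cast (show 0 < k by omega)
  rcases le_total (pos k i) (158 / 100) with h | h
  · have h1 := cdf_lt_half_of_cdfBelow hk cdfBelow_base (by push_cast; exact h)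
    push_cast at h1
    exact ⟨343 / 100 / k, by positivity, h1, 0, by omega, pmf_succ_lt_pmf_zero hk i⟩
  · refine separated_of_boxesOk hk boxes 1580 boxesOk_boxes (by push_cast; linarith) ?_
    rw [pos, div_lt_iff₀ (by positivity)]
    have : (i : ℝ) + 1 < 7 * (k + 1) := by exact_mod_cast hi
    linarith

/-- The cdf tests at the parameters `(86 + 17 s) / 100`. -/
def chainOk : Bool :=
  (List.range 80).all fun s => 
    cdfAbove ((69 + 17 * s) / 200) ((86 + 17 * s) / 100) ((86 + 17 * s) / 50 + 9)

set_option maxRecDepth 100000 in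
lemma chainOk_eq : chainOk = true := by decide +kernel

lemma half_le_cdf_of_thirty_le (hk : 30 ≤ k) (hn1 : 1 ≤ n) (hn : n < 7 * (k + 1)) :
    1 / 2 ≤ cdf k (2 * n / (k + 1) / k) n := by
  have hk' : (0 : ℝ) < k := by exact_mod_cast (show 0 < k by omega)
  have hn0 : (0 : ℝ) < n := by exact_mod_cast hn1
  set c : ℝ := 2 * n / (k + 1) with hc
  have hc0 : 0 < c := by positivity
  have hpos : c / 2 ≤ pos k n := by
    rw [hc, pos, div_div, mul_comm (2 : ℝ), mul_div_mul_right _ _ two_ne_zero]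
    gcongr; linarith
  have key : ∀ s : ℕ, s ≤ 80 → c ≤ (69 + 17 * s) / 100 → 1 / 2 ≤ cdf k (c / k) n := by
    intro s hs hcs
    induction s with
    | zero =>
      have h1 : poissonOrderKPmf k (c / k) 0 ≤ cdf k (c / k) n :=
        single_le_sum (fun i _ => pmf_nonneg k (by positivity) i) (mem_range.2 (Nat.succ_pos n))
      rw [pmf_eq k (c / k) Nat.zero_lt_one, mul_div_cancel₀ c hk'.ne'] at h1
      simp only [range_one, sum_singleton, cnt] at h1
      have h2 : Real.exp (-Real.log 2) ≤ Real.exp (-c) := by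
        refine Real.exp_le_exp.2 (neg_le_neg (hcs.trans ?_))
        have := Real.log_two_gt_d9
        norm_num at this ⊢
        linarith
      rw [Real.exp_neg (Real.log 2), Real.exp_log two_pos] at h2
      simp at h1
      linarith
    | succ s ih =>
      rcases le_total c ((69 + 17 * s) / 100) with h | h
      · exact ih (by omega) h
      · have h1 := List.all_eq_true.1 chainOk_eq s (List.mem_range.2 (by omega))
        have h2 := half_le_cdf_of_cdfAbove (k := k) (m := n) hk h1 (by push_cast; linarith)
        push_cast at h2 hcs
        exact half_le_cdf_of_le (by omega) (by positivity)
          (div_le_div_of_nonneg_right (by linarith) hk'.le) h2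
  refine key 80 le_rfl ?_
  rw [hc, div_le_div_iff₀ (by positivity) (by norm_num)]
  have : (n : ℝ) < 7 * (k + 1) := by exact_mod_cast hn
  push_cast
  nlinarith

end PoissonK

namespace PoissonK

open Finset Polynomial

/-! ### Reading a distribution off the base-`B` digits of one integer -/

lemma sum_mul_pow_lt {a : ℕ → ℕ} {B : ℕ} (h : ∀ i, a i < B) (m : ℕ) :
    ∑ i ∈ range m, a i * B ^ i < B ^ m := by
  induction m with
  | zero => simp
  | succ m ih =>
    rw [sum_range_succ, pow_succ]
    nlinarith [h m, Nat.mul_le_mul_right (B ^ m) (Nat.succ_le_of_lt (h m))]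

lemma sum_coeff_le_eval_one (P : ℕ[X]) (m : ℕ) :
    ∑ i ∈ range m, P.coeff i ≤ P.eval 1 := by
  rw [eval_eq_sum_range' (n := m + (P.natDegree + 1)) (by omega), sum_range_add]
  simp

lemma coeff_le_eval_one (P : ℕ[X]) (m : ℕ) : P.coeff m ≤ P.eval 1 := by
  refine le_trans ?_ (sum_coeff_le_eval_one P (m + 1))
  rw [sum_range_succ]; omega

lemma eval_mod_pow (P : ℕ[X]) {B : ℕ} (hB : P.eval 1 < B) (m : ℕ) :
    P.eval B % B ^ m = ∑ i ∈ range m, P.coeff i * B ^ i := by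
  rw [eval_eq_sum_range' (n := m + (P.natDegree + 1)) (by omega), sum_range_add]
  have h : ∑ x ∈ range (P.natDegree + 1), P.coeff (m + x) * B ^ (m + x) =
      B ^ m * ∑ x ∈ range (P.natDegree + 1), P.coeff (m + x) * B ^ x := by
    rw [mul_sum]; exact sum_congr rfl fun i _ => by ring
  rw [h, Nat.add_mul_mod_self_left, Nat.mod_eq_of_lt]
  exact sum_mul_pow_lt (fun i => (coeff_le_eval_one P i).trans_lt hB) m

lemma eval_div_pow_mod (P : ℕ[X]) {B : ℕ} (hB : P.eval 1 < B) (m : ℕ) :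
    P.eval B / B ^ m % B = P.coeff m := by
  rw [← Nat.mod_mul_right_div_self, ← pow_succ, eval_mod_pow P hB, sum_range_succ,
    Nat.add_mul_div_right _ _ (pow_pos (by omega) _), Nat.div_eq_of_lt, zero_add]
  exact sum_mul_pow_lt (fun i => (coeff_le_eval_one P i).trans_lt hB) m

lemma eval_mod_pow_mod (P : ℕ[X]) {B : ℕ} (hB : P.eval 1 + 1 < B) (m : ℕ) :
    P.eval B % B ^ m % (B - 1) = ∑ i ∈ range m, P.coeff i := by
  rw [eval_mod_pow P (by omega)]
  have h1 : B ≡ 1 [MOD B - 1] :=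
    ((Nat.modEq_iff_dvd' (by omega)).2 dvd_rfl).symm
  have h2 : ∑ i ∈ range m, P.coeff i * B ^ i ≡ ∑ i ∈ range m, P.coeff i [MOD B - 1] := by
    induction m with
    | zero => rfl
    | succ m ih =>
      rw [sum_range_succ, sum_range_succ]
      refine ih.add ?_
      simpa using (h1.pow m).mul_left (P.coeff m)
  rw [h2, Nat.mod_eq_of_lt]
  have := sum_coeff_le_eval_one P m
  omega

/-- Horner evaluation of `∑_{j ≤ J} (J! / j!) p ^ j q ^ (J - j) x ^ j`. -/
def hor (p q x : ℕ) : ℕ → ℕ → ℕ → ℕ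
  | 0, _, acc => acc
  | j + 1, w, acc => hor p q x j (w * (q * (j + 1))) (w * (q * (j + 1)) + p * x * acc)

/-- Horner evaluation of the same sum modulo `Q`. -/
def horMod (p q x Q : ℕ) : ℕ → ℕ → ℕ → ℕ
  | 0, _, acc => acc
  | j + 1, w, acc =>
    horMod p q x Q j (w * (q * (j + 1))) ((w * (q * (j + 1)) + p * x * acc) % Q)

lemma horMod_modEq (p q x Q J w : ℕ) {acc acc' : ℕ} (h : acc ≡ acc' [MOD Q]) :
    horMod p q x Q J w acc ≡ hor p q x J w acc' [MOD Q] := by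
  induction J generalizing w acc acc' with
  | zero => exact h
  | succ J ih =>
    exact ih _ ((Nat.mod_modEq _ _).trans ((h.mul_left (p * x)).add_left _))

/-- The weight `(J! / j!) p ^ j q ^ (J - j)`. -/
def weight (p q J j : ℕ) : ℕ := p ^ j * q ^ (J - j) * J.descFactorial (J - j)

lemma weight_succ (p q : ℕ) {J j : ℕ} (h : j ≤ J) :
    weight p q (J + 1) j = q * (J + 1) * weight p q J j := by
  have : J + 1 - j = J - j + 1 := by omega
  rw [weight, weight, this, Nat.succ_descFactorial_succ]
  ring

lemma hor_eq_aux (p q x J w acc : ℕ) : hor p q x J w acc =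
    (p * x) ^ J * acc + w * ∑ j ∈ range J, weight p q J j * x ^ j := by
  induction J generalizing w acc with
  | zero => simp [hor]
  | succ J ih =>
    have h : ∑ j ∈ range J, weight p q (J + 1) j * x ^ j =
        q * (J + 1) * ∑ j ∈ range J, weight p q J j * x ^ j := by
      rw [mul_sum]
      refine sum_congr rfl fun j hj => ?_
      rw [weight_succ _ _ (mem_range.1 hj).le]; ring
    rw [hor, ih, sum_range_succ, h, weight_succ _ _ le_rfl]
    simp only [weight, Nat.sub_self, pow_zero, Nat.descFactorial_zero]
    ring

lemma hor_eq (p q x J : ℕ) :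
    hor p q x J 1 1 = ∑ j ∈ range (J + 1), weight p q J j * x ^ j := by
  rw [hor_eq_aux, sum_range_succ]
  simp only [weight, Nat.sub_self, pow_zero, Nat.descFactorial_zero]
  ring

lemma cast_weight {q : ℕ} (hq : 0 < q) (p : ℕ) {J j : ℕ} (h : j ≤ J) :
    (weight p q J j : ℝ) = q ^ J * J.factorial * ((p / q : ℝ) ^ j / j.factorial) := by
  have h1 := Nat.factorial_mul_descFactorial (Nat.sub_le J j)
  rw [Nat.sub_sub_self h] at h1
  have h2 : (J.factorial : ℝ) = j.factorial * J.descFactorial (J - j) := by exact_mod_cast h1.symm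
  have h3 : (q : ℝ) ^ J = q ^ (J - j) * q ^ j := by rw [← pow_add]; congr 1; omega
  have h4 : (0 : ℝ) < q := by exact_mod_cast hq
  rw [weight, h2, h3, div_pow]
  push_cast
  field_simp

/-- `rep B k = B + B ^ 2 + ⋯ + B ^ k`. -/
def rep (B : ℕ) : ℕ → ℕ
  | 0 => 0
  | k + 1 => B * (1 + rep B k)

lemma rep_eq (B k : ℕ) : rep B k = ∑ i ∈ range k, B ^ (i + 1) := by
  induction k with
  | zero => rfl
  | succ k ih =>
    rw [rep, ih, sum_range_succ', mul_add, mul_sum, add_comm]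
    congr 1
    · exact sum_congr rfl fun i _ => by ring
    · ring

/-- The truncated generating polynomial at `lam = p / q`, times `q ^ J * J!`. -/
noncomputable def genPoly (k p q J : ℕ) : ℕ[X] :=
  ∑ j ∈ range (J + 1), C (weight p q J j) * (∑ i ∈ range k, X ^ (i + 1)) ^ j

lemma coeff_genPoly (k p q J m : ℕ) :
    (genPoly k p q J).coeff m = ∑ j ∈ range (J + 1), weight p q J j * cnt k j m := by
  simp only [genPoly, finsetSum_coeff, coeff_C_mul, cnt_eq_coeff]

lemma eval_genPoly (k p q J B : ℕ) : (genPoly k p q J).eval B = hor p q (rep B k) J 1 1 := by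
  rw [hor_eq, rep_eq, genPoly, eval_finsetSum]
  refine sum_congr rfl fun j _ => ?_
  rw [eval_mul, eval_C, eval_pow, eval_finsetSum]
  simp

lemma eval_one_genPoly (k p q J : ℕ) : (genPoly k p q J).eval 1 = hor p q k J 1 1 := by
  rw [eval_genPoly, rep_eq]; simp

/-- The total mass of the scaled truncated distribution. -/
def mass (k p q J : ℕ) : ℕ := hor p q k J 1 1

/-- The first `L` masses of the scaled truncated distribution, packed in base `mass + 2`. -/
def packed (k p q J L : ℕ) : ℕ :=
  horMod p q (rep (mass k p q J + 2) k) ((mass k p q J + 2) ^ L) J 1 1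

/-- The first `m` masses of a packed distribution of total mass `E`. -/
def prefixSum (E A m : ℕ) : ℕ := A % (E + 2) ^ m % (E + 1)

/-- The mass at `m` of a packed distribution of total mass `E`. -/
def digit (E A m : ℕ) : ℕ := A / (E + 2) ^ m % (E + 2)

lemma packed_mod_pow (k p q J : ℕ) {L m : ℕ} (h : m ≤ L) :
    packed k p q J L % (mass k p q J + 2) ^ m =
      (genPoly k p q J).eval (mass k p q J + 2) % (mass k p q J + 2) ^ m := by
  rw [eval_genPoly]
  exact (horMod_modEq p q _ _ J 1 rfl).of_dvd (pow_dvd_pow _ h)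

lemma prefixSum_packed (k p q J : ℕ) {L m : ℕ} (hm : m < L) :
    prefixSum (mass k p q J) (packed k p q J L) (m + 1) =
      ∑ j ∈ range (J + 1), weight p q J j * cum k j m := by
  have h := eval_mod_pow_mod (genPoly k p q J) (B := mass k p q J + 2)
    (by rw [eval_one_genPoly, mass]; omega) (m + 1)
  rw [prefixSum, packed_mod_pow k p q J hm]
  refine h.trans ?_
  simp_rw [coeff_genPoly]
  rw [sum_comm]
  refine sum_congr rfl fun j _ => ?_
  rw [← mul_sum, sum_cnt]

lemma digit_packed (k p q J : ℕ) {L m : ℕ} (hm : m < L) :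
    digit (mass k p q J) (packed k p q J L) m =
      ∑ j ∈ range (J + 1), weight p q J j * cnt k j m := by
  have h := eval_div_pow_mod (genPoly k p q J) (B := mass k p q J + 2)
    (by rw [eval_one_genPoly, mass]; omega) m
  rw [coeff_genPoly, ← Nat.mod_mul_right_div_self, ← pow_succ] at h
  rw [digit, ← Nat.mod_mul_right_div_self, ← pow_succ, packed_mod_pow k p q J hm, h]

lemma mass_eq (k p q J : ℕ) :
    mass k p q J = ∑ j ∈ range (J + 1), weight p q J j * k ^ j := hor_eq _ _ _ _

lemma cast_sum_weight {q : ℕ} (hq : 0 < q) (p J : ℕ) (u : ℕ → ℕ) :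
    ((∑ j ∈ range (J + 1), weight p q J j * u j : ℕ) : ℝ) =
      q ^ J * J.factorial *
        ∑ j ∈ range (J + 1), (p / q : ℝ) ^ j / j.factorial * u j := by
  push_cast
  rw [mul_sum]
  refine sum_congr rfl fun j hj => ?_
  rw [cast_weight hq p (by have := mem_range.1 hj; omega)]
  ring

/-- A test for `cdf k (p / q) m < 1 / 2`. -/
def ltTest (k J E A m : ℕ) : Bool :=
  decide (2 * m + 1 ≤ (J + 1) * (k + 1)) && decide (2 * prefixSum E A (m + 1) < E)

/-- A test for `1 / 2 ≤ cdf k (p / q) m`. -/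
def geTest (k p q J E A m : ℕ) : Bool :=
  decide (2 * k * p ≤ (J + 2) * q) &&
    decide (E * ((J + 1) * q) + 2 * (k * p) ^ (J + 1) ≤ 2 * prefixSum E A (m + 1) * ((J + 1) * q))

/-- A test for `poissonOrderKPmf k (p / q) a < poissonOrderKPmf k (p / q) b`. -/
def cmpTest (k p q J E A a b : ℕ) : Bool :=
  decide (2 * k * p ≤ (J + 2) * q) &&
    decide (digit E A a * ((J + 1) * q) + 2 * (k * p) ^ (J + 1) < digit E A b * ((J + 1) * q))

section

variable {k p q J L : ℕ}

lemma cdf_lt_half_of_ltTest (hq : 0 < q) {m : ℕ} (hm : m < L)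
    (h : ltTest k J (mass k p q J) (packed k p q J L) m = true) : cdf k (p / q) m < 1 / 2 := by
  simp only [ltTest, Bool.and_eq_true, decide_eq_true_eq] at h
  obtain ⟨h1, h2⟩ := h
  rw [prefixSum_packed _ _ _ _ hm, mass_eq] at h2
  have h3 := le_sum_of_hasSum (hasSum_cdf k (p / q) m) (J := J + 1) fun j hj => by
    refine mul_nonpos_of_nonneg_of_nonpos (by positivity) ?_
    have := two_mul_cum_le k j (m := m) (by
      have := Nat.mul_le_mul_right (k + 1) hj
      exact_mod_cast h1.trans this)
    have : (2 * cum k j m : ℝ) ≤ k ^ j := by exact_mod_cast this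
    linarith
  have h4 := (Nat.cast_lt (α := ℝ)).2 h2
  rw [Nat.cast_mul, cast_sum_weight hq, cast_sum_weight hq] at h4
  have h5 : (0 : ℝ) < q ^ J * J.factorial := by
    have : (0 : ℝ) < q := by exact_mod_cast hq
    positivity
  have h6 : ∑ j ∈ range (J + 1), (p / q : ℝ) ^ j / j.factorial * (2 * cum k j m - (k : ℝ) ^ j) =
      2 * ∑ j ∈ range (J + 1), (p / q : ℝ) ^ j / j.factorial * cum k j m -
        ∑ j ∈ range (J + 1), (p / q : ℝ) ^ j / j.factorial * ((k ^ j : ℕ) : ℝ) := by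
    rw [mul_sum, ← sum_sub_distrib]
    refine sum_congr rfl fun j _ => ?_
    push_cast; ring
  rw [h6] at h3
  by_contra! hc
  have h7 : 0 ≤ Real.exp (k * (p / q)) * (2 * cdf k (p / q) m - 1) :=
    mul_nonneg (Real.exp_pos _).le (by linarith)
  have h8 := mul_nonneg h5.le (h7.trans h3)
  push_cast at h4 h8
  linarith

lemma tail_mul_eq (hq : 0 < q) :
    (q : ℝ) ^ J * J.factorial * (2 * ((k * (p / q)) ^ (J + 1) / (J + 1).factorial)) *
      ((J + 1) * q) = 2 * (k * p) ^ (J + 1) := by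
  have : (0 : ℝ) < q := by exact_mod_cast hq
  rw [Nat.factorial_succ, ← mul_div_assoc (k : ℝ), div_pow, pow_succ (q : ℝ)]
  push_cast
  field_simp

lemma two_mul_le_of_test (hq : 0 < q) (h : 2 * k * p ≤ (J + 2) * q) :
    2 * (k * (p / q : ℝ)) ≤ (J + 1 : ℕ) + 1 := by
  have : (0 : ℝ) < q := by exact_mod_cast hq
  have h' : (2 * k * p : ℝ) ≤ (J + 2) * q := by exact_mod_cast h
  have : 2 * (k * (p / q : ℝ)) = 2 * k * p / q := by ring
  rw [this, div_le_iff₀ (by assumption)]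
  push_cast; linarith

lemma half_le_cdf_of_geTest (hq : 0 < q) {m : ℕ} (hm : m < L)
    (h : geTest k p q J (mass k p q J) (packed k p q J L) m = true) : 1 / 2 ≤ cdf k (p / q) m := by
  simp only [geTest, Bool.and_eq_true, decide_eq_true_eq] at h
  obtain ⟨h1, h2⟩ := h
  rw [prefixSum_packed _ _ _ _ hm, mass_eq] at h2
  have hq' : (0 : ℝ) < q := by exact_mod_cast hq
  have h3 := le_of_hasSum_of_tail (hasSum_cdf k (p / q) m) (c := k * (p / q)) (by positivity)
    (two_mul_le_of_test hq h1) fun j _ => by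
      rw [mul_pow]
      have h5 : (0 : ℝ) ≤ (p / q) ^ j / j.factorial := by positivity
      have h6 : (0 : ℝ) ≤ cum k j m := by positivity
      have : -((k : ℝ) ^ j * (p / q) ^ j / j.factorial) = (p / q) ^ j / j.factorial * -k ^ j := by
        ring
      rw [this]
      exact mul_le_mul_of_nonneg_left (by linarith) h5
  have h4 := (Nat.cast_le (α := ℝ)).2 h2
  simp only [Nat.cast_add, Nat.cast_mul, cast_sum_weight hq] at h4
  have h5 : (0 : ℝ) < q ^ J * J.factorial * ((J + 1) * q) := by positivity
  have h6 : ∑ j ∈ range (J + 1), (p / q : ℝ) ^ j / j.factorial * (2 * cum k j m - (k : ℝ) ^ j) =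
      2 * ∑ j ∈ range (J + 1), (p / q : ℝ) ^ j / j.factorial * cum k j m -
        ∑ j ∈ range (J + 1), (p / q : ℝ) ^ j / j.factorial * ((k ^ j : ℕ) : ℝ) := by
    rw [mul_sum, ← sum_sub_distrib]
    refine sum_congr rfl fun j _ => ?_
    push_cast; ring
  rw [h6] at h3
  by_contra! hc
  have h7 : Real.exp (k * (p / q)) * (2 * cdf k (p / q) m - 1) < 0 :=
    mul_neg_of_pos_of_neg (Real.exp_pos _) (by linarith)
  have h8 := mul_neg_of_pos_of_neg h5 (h3.trans_lt h7)
  have h9 := tail_mul_eq (k := k) (p := p) (J := J) hq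
  push_cast at h4 h8
  linarith

lemma pmf_lt_of_cmpTest (hq : 0 < q) {a b : ℕ} (ha : a < L) (hb : b < L)
    (h : cmpTest k p q J (mass k p q J) (packed k p q J L) a b = true) :
    poissonOrderKPmf k (p / q) a < poissonOrderKPmf k (p / q) b := by
  simp only [cmpTest, Bool.and_eq_true, decide_eq_true_eq] at h
  obtain ⟨h1, h2⟩ := h
  rw [digit_packed _ _ _ _ ha, digit_packed _ _ _ _ hb] at h2
  have hq' : (0 : ℝ) < q := by exact_mod_cast hq
  have h3 := le_of_hasSum_of_tail (hasSum_pmf_sub k (p / q) b a) (c := k * (p / q)) (by positivity)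
    (two_mul_le_of_test hq h1) fun j _ => by
      rw [mul_pow]
      have h5 : (0 : ℝ) ≤ (p / q) ^ j / j.factorial := by positivity
      have h6 : (0 : ℝ) ≤ cnt k j b := by positivity
      have h7 : (cnt k j a : ℝ) ≤ k ^ j := by exact_mod_cast cnt_le_pow k j a
      have : -((k : ℝ) ^ j * (p / q) ^ j / j.factorial) = (p / q) ^ j / j.factorial * -k ^ j := by
        ring
      rw [this]
      exact mul_le_mul_of_nonneg_left (by linarith) h5
  have h4 := (Nat.cast_lt (α := ℝ)).2 h2
  rw [Nat.cast_add, Nat.cast_mul, Nat.cast_mul (∑ j ∈ range (J + 1), weight p q J j * cnt k j b),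
    cast_sum_weight hq, cast_sum_weight hq] at h4
  have h5 : (0 : ℝ) < q ^ J * J.factorial * ((J + 1) * q) := by positivity
  have h6 : ∑ j ∈ range (J + 1), (p / q : ℝ) ^ j / j.factorial * ((cnt k j b : ℝ) - cnt k j a) =
      ∑ j ∈ range (J + 1), (p / q : ℝ) ^ j / j.factorial * cnt k j b -
        ∑ j ∈ range (J + 1), (p / q : ℝ) ^ j / j.factorial * cnt k j a := by
    rw [← sum_sub_distrib]
    exact sum_congr rfl fun j _ => by ring
  rw [h6] at h3
  by_contra! hc
  have h7 : Real.exp (k * (p / q)) *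
      (poissonOrderKPmf k (p / q) b - poissonOrderKPmf k (p / q) a) ≤ 0 :=
    mul_nonpos_of_nonneg_of_nonpos (Real.exp_pos _).le (by linarith)
  have h8 := mul_nonpos_of_nonneg_of_nonpos h5.le (h3.trans h7)
  have h9 := tail_mul_eq (k := k) (p := p) (J := J) hq
  push_cast at h4 h8
  linarith

end

end PoissonK

namespace PoissonK

open Finset

/-! ### The finitely many orders and means left to direct evaluation -/

/-- A truncation length for `lam = p / q`. -/
def len (k p q : ℕ) : ℕ := 2 * k * p / q + 8

/-- A test for `Separated k i`, with witness `lam = p / q`. -/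
def sepTest (k p q J E A i : ℕ) : Bool :=
  ltTest k J E A i && (cmpTest k p q J E A (i + 1) 0 || cmpTest k p q J E A (i + 1) i ||
    (decide (k ≤ i) && cmpTest k p q J E A (i + 1) k))

/-- The witness for `Separated k i` is `(i + 1 + sepShift k (i + 1) / 10) / (k (k + 1) / 2)`. -/
def sepShift (k r : ℕ) : ℕ :=
  if r ≤ k then (if k ≤ 4 then 4 * k - 7 else 7 * k / 2)
  else (if k ≤ 3 then 2 * (k - 2) else 8 * k / 5)

/-- Runs `sepTest` on truncated data. -/
def sepCheck (k p q i : ℕ) : Bool :=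
  sepTest k p q (len k p q) (mass k p q (len k p q)) (packed k p q (len k p q) (i + 2)) i

/-- Runs `sepCheck` for all small `i`. -/
def sepAll (k : ℕ) : Bool :=
  (List.range (min k 7 * (k + 1) - 1)).all fun i =>
    sepCheck k (10 * (i + 1) + sepShift k (i + 1)) (5 * k * (k + 1)) i

/-- Runs `geTest` at mean `n`. -/
def geCheck (k p q n : ℕ) : Bool :=
  geTest k p q (len k p q) (mass k p q (len k p q)) (packed k p q (len k p q) (n + 1)) n

/-- Runs `geCheck` for all small `n`. -/
def geAll (k : ℕ) : Bool :=
  (List.range (min k 7 * (k + 1) - 1)).all fun i => geCheck k (i + 1) (k * (k + 1) / 2) (i + 1)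

lemma separated_of_sepCheck {k p q i : ℕ} (hp : 0 < p) (hq : 0 < q)
    (h : sepCheck k p q i = true) : Separated k i := by
  simp only [sepCheck, sepTest, Bool.and_eq_true, Bool.or_eq_true, decide_eq_true_eq] at h
  obtain ⟨h1, h2⟩ := h
  have hp' : (0 : ℝ) < p := by exact_mod_cast hp
  have hq' : (0 : ℝ) < q := by exact_mod_cast hq
  refine ⟨p / q, by positivity, cdf_lt_half_of_ltTest hq (by omega) h1, ?_⟩
  rcases h2 with (h2 | h2) | ⟨h3, h2⟩
  · exact ⟨0, by omega, pmf_lt_of_cmpTest hq (by omega) (by omega) h2⟩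
  · exact ⟨i, le_rfl, pmf_lt_of_cmpTest hq (by omega) (by omega) h2⟩
  · exact ⟨k, h3, pmf_lt_of_cmpTest hq (by omega) (by omega) h2⟩

set_option maxRecDepth 100000 in
lemma sepAll_of_lt_thirty {k : ℕ} (hk : 2 ≤ k) (hk' : k < 30) : sepAll k = true := by
  interval_cases k <;> decide +kernel

set_option maxRecDepth 100000 in
lemma geAll_of_lt_thirty {k : ℕ} (hk : 2 ≤ k) (hk' : k < 30) : geAll k = true := by
  interval_cases k <;> decide +kernel

theorem separated_of_lt_thirty {k i : ℕ} (hk : 2 ≤ k) (hk' : k < 30)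
    (hi : i + 1 < min k 7 * (k + 1)) : Separated k i := by
  have h := List.all_eq_true.1 (sepAll_of_lt_thirty hk hk') i (List.mem_range.2 (by omega))
  exact separated_of_sepCheck (by omega) (by positivity) h

lemma kappa_pos {k : ℕ} (hk : 2 ≤ k) : 0 < k * (k + 1) / 2 :=
  Nat.div_pos (by nlinarith) (by norm_num)

theorem half_le_cdf_of_lt_thirty {k n : ℕ} (hk : 2 ≤ k) (hk' : k < 30) (hn1 : 1 ≤ n)
    (hn : n < min k 7 * (k + 1)) : 1 / 2 ≤ cdf k (n / (k * (k + 1) / 2 : ℕ)) n := by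
  have h := List.all_eq_true.1 (geAll_of_lt_thirty hk hk') (n - 1) (List.mem_range.2 (by omega))
  rw [Nat.sub_add_cancel hn1] at h
  exact half_le_cdf_of_geTest (kappa_pos hk) (by omega) h

/-- A test that at mean `n = p` and `q = k (k + 1) / 2` the median is `n` and the mode is near
`n - 1`. -/
def atMeanTest (k p q J E A n : ℕ) : Bool :=
  ltTest k J E A (n - 1) && geTest k p q J E A n &&
    (cmpTest k p q J E A n (n - 1) && cmpTest k p q J E A (n - 2) (n - 1))

/-- Runs `atMeanTest` for all `n` below the range of the asymptotic estimates. -/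
def atMeanAll (k q : ℕ) : Bool :=
  (List.range (32 * (k + 1) - 2 * q)).all fun i =>
    let n := 2 * q + i
    atMeanTest k n q (len k n q) (mass k n q (len k n q)) (packed k n q (len k n q) (n + 1)) n

/-- A test that at `q = k (k + 1) / 2` and mean `n = p` the median is `n - 1` and the mode is at
most `n - 2`. -/
def belowMeanTest (k p q J E A n : ℕ) : Bool :=
  ltTest k J E A (n - 2) && geTest k p q J E A (n - 1) && cmpTest k p q J E A (n - 1) (n - 2)

/-- Runs `belowMeanTest` for `2 * q ≤ n < N`. -/
def belowMeanAll (k q N : ℕ) : Bool :=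
  (List.range (N - 2 * q)).all fun i =>
    let n := 2 * q + i
    belowMeanTest k n q (len k n q) (mass k n q (len k n q)) (packed k n q (len k n q) n) n

/-- A test that the masses increase up to `M + 1` at `lam = 2`. -/
def increasingTest (k M : ℕ) : Bool :=
  (List.range (M + 1)).all fun i =>
    cmpTest k 2 1 (len k 2 1) (mass k 2 1 (len k 2 1)) (packed k 2 1 (len k 2 1) (M + 2)) i (i + 1)

set_option maxRecDepth 100000 in
lemma atMeanAll_of_le_three {k : ℕ} (hk : 2 ≤ k) (hk' : k ≤ 3) :
    atMeanAll k (k * (k + 1) / 2) = true := by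
  interval_cases k <;> decide +kernel

set_option maxRecDepth 100000 in
lemma belowMeanAll_of_le_six {k : ℕ} (hk : 4 ≤ k) (hk' : k ≤ 6) :
    belowMeanAll k (k * (k + 1) / 2) (32 * (k + 1)) = true := by
  interval_cases k <;> decide +kernel

set_option maxRecDepth 100000 in
lemma belowMeanAll_seven : belowMeanAll 7 28 64 = true := by decide +kernel

set_option maxRecDepth 100000 in
lemma increasingTest_of_le_three {k : ℕ} (hk : 2 ≤ k) (hk' : k ≤ 3) :
    increasingTest k (k * (k + 1) - 2) = true := by
  interval_cases k <;> decide +kernel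

theorem at_mean_of_le_three {k n : ℕ} (hk : 2 ≤ k) (hk' : k ≤ 3) (hn : 2 * (k * (k + 1) / 2) ≤ n)
    (hn' : n < 32 * (k + 1)) :
    cdf k (n / (k * (k + 1) / 2 : ℕ)) (n - 1) < 1 / 2 ∧
    1 / 2 ≤ cdf k (n / (k * (k + 1) / 2 : ℕ)) n ∧
    poissonOrderKPmf k (n / (k * (k + 1) / 2 : ℕ)) n <
      poissonOrderKPmf k (n / (k * (k + 1) / 2 : ℕ)) (n - 1) ∧
    poissonOrderKPmf k (n / (k * (k + 1) / 2 : ℕ)) (n - 2) <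
      poissonOrderKPmf k (n / (k * (k + 1) / 2 : ℕ)) (n - 1) := by
  have h := List.all_eq_true.1 (atMeanAll_of_le_three hk hk') (n - 2 * (k * (k + 1) / 2))
    (List.mem_range.2 (by omega))
  dsimp only at h
  rw [Nat.add_sub_cancel' hn] at h
  simp only [atMeanTest, Bool.and_eq_true] at h
  obtain ⟨⟨h1, h2⟩, h3, h4⟩ := h
  have hq := kappa_pos hk
  exact ⟨cdf_lt_half_of_ltTest hq (by omega) h1, half_le_cdf_of_geTest hq (by omega) h2,
    pmf_lt_of_cmpTest hq (by omega) (by omega) h3, pmf_lt_of_cmpTest hq (by omega) (by omega) h4⟩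

lemma below_mean_of_belowMeanAll {k n N : ℕ} (hk : 2 ≤ k)
    (h : belowMeanAll k (k * (k + 1) / 2) N = true) (hn : 2 * (k * (k + 1) / 2) ≤ n)
    (hn' : n < N) :
    cdf k (n / (k * (k + 1) / 2 : ℕ)) (n - 2) < 1 / 2 ∧
    1 / 2 ≤ cdf k (n / (k * (k + 1) / 2 : ℕ)) (n - 1) ∧
    poissonOrderKPmf k (n / (k * (k + 1) / 2 : ℕ)) (n - 1) <
      poissonOrderKPmf k (n / (k * (k + 1) / 2 : ℕ)) (n - 2) := by
  replace h := List.all_eq_true.1 h (n - 2 * (k * (k + 1) / 2)) (List.mem_range.2 (by omega))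
  dsimp only at h
  rw [Nat.add_sub_cancel' hn] at h
  simp only [belowMeanTest, Bool.and_eq_true] at h
  obtain ⟨⟨h1, h2⟩, h3⟩ := h
  have hq := kappa_pos hk
  exact ⟨cdf_lt_half_of_ltTest hq (by omega) h1, half_le_cdf_of_geTest hq (by omega) h2,
    pmf_lt_of_cmpTest hq (by omega) (by omega) h3⟩

lemma pmf_two_lt_succ {k m : ℕ} (hk : 2 ≤ k) (hk' : k ≤ 3) (hm : m + 2 ≤ k * (k + 1)) :
    poissonOrderKPmf k 2 m < poissonOrderKPmf k 2 (m + 1) := by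
  have h := List.all_eq_true.1 (increasingTest_of_le_three hk hk') m
    (List.mem_range.2 (by omega))
  have := pmf_lt_of_cmpTest (by norm_num) (by omega) (by omega) h
  norm_num at this
  exact this

end PoissonK

namespace PoissonK

open Finset

/-! ### Mode, median and mean -/

/-- The parameter of the distribution with mean `n`. -/
noncomputable def rate (k n : ℕ) : ℝ := (n : ℝ) / ((k * (k + 1) / 2 : ℕ) : ℝ)

section

variable {k n m i : ℕ}

lemma two_mul_kappa (k : ℕ) : 2 * (k * (k + 1) / 2) = k * (k + 1) :=
  Nat.mul_div_cancel' (Nat.even_mul_succ_self k).two_dvd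

lemma cast_kappa (k : ℕ) : ((k * (k + 1) / 2 : ℕ) : ℝ) = powSum k 1 := by
  rw [powSum_one_eq, eq_div_iff two_ne_zero, mul_comm]
  exact_mod_cast two_mul_kappa k

lemma rate_mul_powSum (hk : 2 ≤ k) (n : ℕ) : rate k n * powSum k 1 = n := by
  rw [rate, cast_kappa, div_mul_cancel₀ _ (powSum_pos (by omega) 1).ne']

lemma rate_pos (hk : 2 ≤ k) (hn : 1 ≤ n) : 0 < rate k n :=
  div_pos (by exact_mod_cast hn) (by exact_mod_cast kappa_pos hk)

lemma rate_le_rate (hn : n ≤ m) : rate k n ≤ rate k m :=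
  div_le_div_of_nonneg_right (by exact_mod_cast hn) (Nat.cast_nonneg _)

lemma mul_rate (hk : 2 ≤ k) (n : ℕ) : k * rate k n = 2 * n / (k + 1) := by
  have : (0 : ℝ) < k := by exact_mod_cast (by omega : 0 < k)
  rw [rate, cast_kappa, powSum_one_eq]
  field_simp

lemma le_mul_rate (hk : 2 ≤ k) {a : ℕ} (h : a * (k + 1) ≤ 2 * n) : (a : ℝ) ≤ k * rate k n := by
  rw [mul_rate hk, le_div_iff₀ (by positivity)]
  exact_mod_cast h

theorem below_mean_of_le_six (hk : 4 ≤ k) (hk6 : k ≤ 6) (hn : 2 * (k * (k + 1) / 2) ≤ n) :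
    cdf k (rate k n) (n - 2) < 1 / 2 ∧ 1 / 2 ≤ cdf k (rate k n) (n - 1) ∧
    poissonOrderKPmf k (rate k n) (n - 1) < poissonOrderKPmf k (rate k n) (n - 2) := by
  rcases lt_or_ge n (32 * (k + 1)) with h | h
  · exact below_mean_of_belowMeanAll (by omega) (belowMeanAll_of_le_six hk hk6) hn h
  · obtain ⟨m, rfl⟩ : ∃ m, n = m + 2 := ⟨n - 2, by omega⟩
    have hc : (64 : ℝ) ≤ k * rate k (m + 2) := le_mul_rate (by omega) (a := 64) (by omega)
    have hm := rate_mul_powSum (show 2 ≤ k by omega) (m + 2)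
    push_cast at hm
    have h1 := strict_of_le_six hk hk6 hc hm.symm
    exact ⟨h1.1, half_le_cdf_pred_of_le_six hk hk6 hc (m := m + 1) (by rw [hm]; push_cast; ring),
      h1.2⟩

theorem at_mean (hk : 2 ≤ k) (hk3 : k ≤ 3) (hn : 2 * (k * (k + 1) / 2) ≤ n) :
    cdf k (rate k n) (n - 1) < 1 / 2 ∧ 1 / 2 ≤ cdf k (rate k n) n ∧
    poissonOrderKPmf k (rate k n) n < poissonOrderKPmf k (rate k n) (n - 1) ∧
    poissonOrderKPmf k (rate k n) (n - 2) < poissonOrderKPmf k (rate k n) (n - 1) := by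
  rcases lt_or_ge n (32 * (k + 1)) with h | h
  · exact at_mean_of_le_three hk hk3 hn h
  · obtain ⟨m, rfl⟩ : ∃ m, n = m + 2 := ⟨n - 2, by omega⟩
    have hc : (64 : ℝ) ≤ k * rate k (m + 2) := le_mul_rate hk (a := 64) (by omega)
    have hm := rate_mul_powSum hk (m + 2)
    push_cast at hm
    have h1 := cdf_pred_lt_half_of_le_three hk hk3 hc (m := m + 1) (by rw [hm]; push_cast; ring)
    refine ⟨h1.1, ?_, h1.2, pmf_lt_succ_of_le_three hk hk3 hc hm.symm⟩
    have hp := powSum_pos (k := k) (by omega) 1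
    have hle : rate k (m + 2) ≤ (m + 2 + 1 / 2) / powSum k 1 := by
      rw [le_div_iff₀ hp, hm]; linarith
    refine half_le_cdf_of_le (by omega) (rate_pos hk (by omega)) hle
      (half_le_cdf_of_le_three hk (hc.trans (by gcongr)) ?_)
    rw [div_mul_cancel₀ _ hp.ne']; push_cast; ring

theorem separated (hk : 2 ≤ k) (i : ℕ) : Separated k i := by
  have hκ := two_mul_kappa k
  rcases le_or_gt 7 k with h7 | h7
  · rcases le_or_gt (7 * (k + 1)) (i + 1) with hi | hi
    · exact separated_of_seven_le h7 hi
    rcases le_or_gt 30 k with h | h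
    · exact separated_of_thirty_le h hi
    · exact separated_of_lt_thirty hk h (by rwa [min_eq_right h7])
  rcases lt_or_ge (i + 1) (k * (k + 1)) with hi | hi
  · exact separated_of_lt_thirty hk (by omega) (by rwa [min_eq_left h7.le])
  rcases le_or_gt k 3 with h3 | h3
  · have h := at_mean (n := i + 1) hk h3 (by omega)
    exact ⟨rate k (i + 1), rate_pos hk (by omega), h.1, i, le_rfl, h.2.2.1⟩
  · have h := below_mean_of_le_six (n := i + 2) h3 (by omega) (by omega)
    exact ⟨rate k (i + 2), rate_pos hk (by omega), h.1, i, le_rfl, h.2.2⟩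

theorem half_le_cdf_mean (hk : 2 ≤ k) (hn1 : 1 ≤ n) (hn : k ≤ 6 → n < 2 * (k * (k + 1) / 2)) :
    1 / 2 ≤ cdf k (rate k n) n := by
  have hκ := two_mul_kappa k
  rcases le_or_gt k 6 with h6 | h6
  · refine half_le_cdf_of_lt_thirty hk (by omega) hn1 ?_
    rw [min_eq_left (by omega), ← hκ]
    exact hn h6
  rcases le_or_gt (7 * (k + 1)) n with h | h
  · obtain ⟨m, rfl⟩ : ∃ m, n = m + 1 := ⟨n - 1, by omega⟩
    have h1 : 1 / 2 ≤ cdf k (rate k (m + 1)) m :=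
      half_le_cdf_pred h6 (le_mul_rate hk (a := 14) (by omega))
        (by rw [rate_mul_powSum hk]; push_cast; ring)
    rw [cdf, sum_range_succ]
    exact le_add_of_le_of_nonneg h1 (pmf_nonneg k (rate_pos hk hn1).le _)
  rcases le_or_gt 30 k with h30 | h30
  · have h1 := half_le_cdf_of_thirty_le h30 hn1 h
    rwa [← mul_rate hk, mul_div_cancel_left₀] at h1
    exact_mod_cast (by omega : k ≠ 0)
  · exact half_le_cdf_of_lt_thirty hk h30 hn1 (by rwa [min_eq_right h6])

theorem mode_le_median (hk : 2 ≤ k) {lam : ℝ} (hlam : 0 < lam) {M : ℕ}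
    (hM : 1 / 2 ≤ cdf k lam M)
    (hm : ∀ j, poissonOrderKPmf k lam j ≤ poissonOrderKPmf k lam m) :
    m ≤ poissonOrderKMedian k lam := by
  by_contra! hlt
  obtain ⟨i, rfl⟩ : ∃ i, m = i + 1 := ⟨m - 1, by omega⟩
  obtain ⟨a, ha, h1, i', hi', h2⟩ := separated hk i
  have h3 : ¬ cdf k lam i < 1 / 2 := fun h => by
    have := lt_median hlam.le h hM
    omega
  rcases le_total a lam with h | h
  · exact h3 (cdf_lt_half_of_le (by omega) ha h h1)
  · exact absurd (hm i') (not_le.2 (pmf_lt_of_le (by omega) hlam h h2))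

theorem half_le_cdf_pred_mean (hk : 4 ≤ k) (hn : 2 * (k * (k + 1) / 2) ≤ n) :
    1 / 2 ≤ cdf k (rate k n) (n - 1) := by
  have hκ := two_mul_kappa k
  rcases le_or_gt k 6 with h6 | h6
  · exact (below_mean_of_le_six hk h6 hn).2.1
  have : 7 * (k + 1) ≤ k * (k + 1) := Nat.mul_le_mul_right _ h6
  obtain ⟨m, rfl⟩ : ∃ m, n = m + 1 := ⟨n - 1, by omega⟩
  exact half_le_cdf_pred h6 (le_mul_rate (by omega) (a := 14) (by omega))
    (by rw [rate_mul_powSum (by omega)]; push_cast; ring)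

/-- If the mean is at least `n`, the masses decrease from a point strictly below the median. -/
theorem exists_lt_median (hk : 4 ≤ k) (hn : 2 * (k * (k + 1) / 2) ≤ n) :
    ∃ m, cdf k (rate k n) m < 1 / 2 ∧
      ∀ i, m ≤ i → poissonOrderKPmf k (rate k n) (i + 1) < poissonOrderKPmf k (rate k n) i := by
  have hκ := two_mul_kappa k
  have hk2 : 2 ≤ k := by omega
  have h5 : 4 * (k + 1) ≤ k * (k + 1) := Nat.mul_le_mul_right _ hk
  have hpos := rate_pos (n := n) hk2 (by omega)
  rcases le_or_gt k 6 with h6 | h6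
  · refine ⟨n - 2, (below_mean_of_le_six hk h6 hn).1, fun i hi => ?_⟩
    exact pmf_lt_of_le (by omega) hpos (rate_le_rate (by omega))
      (below_mean_of_le_six (n := i + 2) hk h6 (by omega)).2.2
  have h7 : 7 * (k + 1) ≤ k * (k + 1) := Nat.mul_le_mul_right _ h6
  obtain ⟨j, hj1, hjk, hj2, hj3⟩ := exists_half_integer h6
  have strict : ∀ i, 8 * (k + 1) ≤ i + 1 + j →
      cdf k (rate k (i + 1 + j)) i < 1 / 2 ∧ poissonOrderKPmf k (rate k (i + 1 + j)) (i + 1) <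
        poissonOrderKPmf k (rate k (i + 1 + j)) i := fun i hi =>
    strict_of_seven_le h6 (le_mul_rate hk2 (a := 16) (by omega))
      (by rw [rate_mul_powSum hk2]; push_cast; ring) hj2 hj3
  rcases le_or_gt (8 * (k + 1)) n with h8 | h8
  · refine ⟨n - 1 - j, ?_, fun i hi => ?_⟩
    · have := (strict (n - 1 - j) (by omega)).1
      rwa [show n - 1 - j + 1 + j = n by omega] at this
    · exact pmf_lt_of_le (by omega) hpos (rate_le_rate (by omega)) (strict i (by omega)).2
  · obtain rfl : k = 7 := by
      by_contra hne
      have : 8 * (k + 1) ≤ k * (k + 1) := Nat.mul_le_mul_right _ (by omega)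
      omega
    have small : ∀ i, 56 ≤ i + 2 → i + 2 < 64 → _ := fun i hi hi' =>
      below_mean_of_belowMeanAll (k := 7) (n := i + 2) (by norm_num) belowMeanAll_seven hi hi'
    refine ⟨n - 2, ?_, fun i hi => ?_⟩
    · have := (small (n - 2) (by omega) (by omega)).1
      rwa [show n - 2 + 2 = n by omega] at this
    · rcases lt_or_ge (i + 2) 64 with hi' | hi'
      · exact pmf_lt_of_le (by omega) hpos (rate_le_rate (by omega)) (small i (by omega) hi').2.2
      · exact pmf_lt_of_le (by omega) hpos (rate_le_rate (by omega)) (strict i (by omega)).2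

theorem mode_lt_median (hk : 4 ≤ k) (hn : 2 * (k * (k + 1) / 2) ≤ n)
    (hm : ∀ j, poissonOrderKPmf k (rate k n) j ≤ poissonOrderKPmf k (rate k n) m) :
    m < poissonOrderKMedian k (rate k n) := by
  obtain ⟨M, hM, hdec⟩ := exists_lt_median hk hn
  have h1 := lt_median (div_nonneg (Nat.cast_nonneg _) (Nat.cast_nonneg _)) hM
    (half_le_cdf_pred_mean hk hn)
  refine lt_of_le_of_lt ?_ h1
  by_contra! hlt
  obtain ⟨i, rfl⟩ : ∃ i, m = i + 1 := ⟨m - 1, by omega⟩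
  exact absurd (hm i) (not_le.2 (hdec i (by omega)))

theorem mode_eq_of_le_three (hk : 2 ≤ k) (hk3 : k ≤ 3) (hn1 : 1 ≤ n)
    (hn : 2 * (k * (k + 1) / 2) ≤ n)
    (hm : ∀ j, poissonOrderKPmf k (rate k n) j ≤ poissonOrderKPmf k (rate k n) m) :
    m = n - 1 := by
  have hκ := two_mul_kappa k
  have h2 : rate k (k * (k + 1)) = 2 := by
    rw [rate, div_eq_iff (by exact_mod_cast (kappa_pos hk).ne')]
    exact_mod_cast hκ.symm
  rcases lt_trichotomy m (n - 1) with h | h | h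
  · refine absurd (hm (m + 1)) (not_le.2 ?_)
    rcases le_or_gt (m + 2) (k * (k + 1)) with h' | h'
    · refine lt_pmf_of_le (by omega) two_pos ?_ (pmf_two_lt_succ hk hk3 h')
      rw [← h2]
      exact rate_le_rate (by omega)
    · exact lt_pmf_of_le (by omega) (rate_pos hk (by omega)) (rate_le_rate (by omega))
        (at_mean (n := m + 2) hk hk3 (by omega)).2.2.2
  · exact h
  · obtain ⟨i, rfl⟩ : ∃ i, m = i + 1 := ⟨m - 1, by omega⟩
    exact absurd (hm i) (not_le.2 (pmf_lt_of_le (by omega) (rate_pos hk hn1)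
      (rate_le_rate (by omega)) (at_mean (n := i + 1) hk hk3 (by omega)).2.2.1))

theorem median_eq_of_le_three (hk : 2 ≤ k) (hk3 : k ≤ 3) (hn : 2 * (k * (k + 1) / 2) ≤ n) :
    poissonOrderKMedian k (rate k n) = n := by
  have h := at_mean hk hk3 hn
  have h1 := median_le h.2.1
  have h2 : _ < poissonOrderKMedian k (rate k n) := lt_median (div_nonneg (Nat.cast_nonneg _) (Nat.cast_nonneg _)) h.1 h.2.1
  omega

end

end PoissonK

/-- Conjecture: Fix k and n ≥ 2κ and set λ = n/κ (so the mean equals n).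
If k = 2 or k = 3 then the mode is n − 1 and the median equals the mean n; if k ≥ 4
then mode < median < mean strictly; and for all k ≥ 2 and 1 ≤ n' < 2κ one has the weak
ordering mode ≤ median ≤ mean. -/
theorem poissonOrderK_ordering (k n : ℕ) (hn1 : 1 ≤ n)
    (hn : 2 * (k * (k + 1) / 2) ≤ n) (lam : ℝ)
    (hlam : lam = (n : ℝ) / ((k * (k + 1) / 2 : ℕ) : ℝ)) :
    ((k = 2 ∨ k = 3) →
      ((∀ m : ℕ, (∀ j : ℕ, poissonOrderKPmf k lam j ≤ poissonOrderKPmf k lam m) →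
          m = n - 1) ∧
        poissonOrderKMedian k lam = n)) ∧
    (4 ≤ k →
      ∀ m : ℕ, (∀ j : ℕ, poissonOrderKPmf k lam j ≤ poissonOrderKPmf k lam m) →
        m < poissonOrderKMedian k lam ∧ poissonOrderKMedian k lam < n) ∧
    (∀ n' : ℕ, 2 ≤ k → 1 ≤ n' → n' < 2 * (k * (k + 1) / 2) →
      ∀ m : ℕ,
        (∀ j : ℕ, poissonOrderKPmf k ((n' : ℝ) / ((k * (k + 1) / 2 : ℕ) : ℝ)) j ≤
          poissonOrderKPmf k ((n' : ℝ) / ((k * (k + 1) / 2 : ℕ) : ℝ)) m) →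
        m ≤ poissonOrderKMedian k ((n' : ℝ) / ((k * (k + 1) / 2 : ℕ) : ℝ)) ∧
          poissonOrderKMedian k ((n' : ℝ) / ((k * (k + 1) / 2 : ℕ) : ℝ)) ≤ n') := by
  subst hlam
  refine ⟨fun hk => ⟨fun m hm => ?_, ?_⟩, fun hk m hm => ⟨?_, ?_⟩, fun n' hk hn1' hn' m hm => ?_⟩
  · exact PoissonK.mode_eq_of_le_three (by omega) (by omega) hn1 hn hm
  · exact PoissonK.median_eq_of_le_three (by omega) (by omega) hn
  · exact PoissonK.mode_lt_median hk hn hm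
  · have := PoissonK.median_le (PoissonK.half_le_cdf_pred_mean hk hn)
    exact this.trans_lt (by omega)
  · have h := PoissonK.half_le_cdf_mean hk hn1' fun _ => hn'
    exact ⟨PoissonK.mode_le_median hk (PoissonK.rate_pos hk hn1') h hm, PoissonK.median_le h⟩
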